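/- arXiv:math/0506066 — 3 statements merged into one kernel-verified Lean document; each statement's English description precedes it below -/
import Mathlib

section
/- (Rentschler–Gabriel) Let K be a field of characteristic zero. Then the left Krull dimension (in the sense of Rentschler and Gabriel) of the n-th Weyl algebra A_n equals n. -/
/- Common definitions: degree of a function, standard finite-dimensional filtrations,
Gelfand-Kirillov dimension, return functions and filter dimensions (V. Bavula,
"Filter dimension"), and the Rentschler–Gabriel (left) Krull dimension via deviation. -/

open Filter

noncomputable section

/-- The degree `γ(f)` (as an extended real) of a function `f : ℕ → ℕ∞`:
`inf { r : ℝ | f i ≤ i ^ r for all sufficiently large i }` (`⊤` if no such `r` exists). -/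
def gammaDeg (f : ℕ → ℕ∞) : EReal :=
  sInf { x : EReal | ∃ r : ℝ, x = (r : EReal) ∧
    ∀ᶠ i in atTop, f i ≤ (⌊(i : ℝ) ^ r⌋₊ : ℕ∞) }

/-- `V` is the degree-one piece of a standard finite-dimensional filtration `{A_i = V ^ i}`
of the `K`-algebra `A`: it is finite-dimensional, contains `1` and generates `A`
(this is the filtration associated with a finite set of algebra generators). -/
structure IsStdFilt (K A : Type) [Field K] [Ring A] [Algebra K A] (V : Submodule K A) :
    Prop where
  one_mem : (1 : A) ∈ V
  fin : FiniteDimensional K V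
  gen : Algebra.adjoin K (V : Set A) = ⊤

/-- The Gelfand-Kirillov dimension `GK(A) = γ(i ↦ dim A_i)` of the algebra `A` w.r.t. the
standard filtration `{A_i = V ^ i}`. -/
def gkAlg (K A : Type) [Field K] [Ring A] [Algebra K A] (V : Submodule K A) : EReal :=
  gammaDeg fun i => (Module.finrank K (V ^ i : Submodule K A) : ℕ∞)

/-- The `K`-subspace `p • W` of the module `M` spanned by products `a • w`, `a ∈ p`, `w ∈ W`. -/
def smulSub (K : Type) [Field K] {A M : Type} [Ring A] [Algebra K A] [AddCommGroup M]
    [Module K M] [Module A M] [IsScalarTower K A M] (p : Submodule K A) (W : Submodule K M) :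
    Submodule K M :=
  Submodule.span K {x : M | ∃ a ∈ p, ∃ w ∈ W, x = a • w}

/-- `W` is a finite-dimensional generating subspace of the `A`-module `M`. -/
def IsGenSub (K A : Type) {M : Type} [Field K] [Ring A] [Algebra K A] [AddCommGroup M]
    [Module K M] [Module A M] [IsScalarTower K A M] (W : Submodule K M) : Prop :=
  FiniteDimensional K W ∧ Submodule.span A (W : Set M) = ⊤

/-- The Gelfand-Kirillov dimension `GK(M) = γ(i ↦ dim M_i)` of the module `M` w.r.t. the
standard filtration `{M_i = V ^ i • W}`. -/
def gkModW (K : Type) [Field K] {A M : Type} [Ring A] [Algebra K A] [AddCommGroup M]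
    [Module K M] [Module A M] [IsScalarTower K A M] (V : Submodule K A) (W : Submodule K M) :
    EReal :=
  gammaDeg fun i => (Module.finrank K (smulSub K (V ^ i) W) : ℕ∞)

/-- The Gelfand-Kirillov dimension of a module, as the infimum over all finite-dimensional
generating subspaces (it agrees with `gkModW` for each of them). -/
def gkMod (K A M : Type) [Field K] [Ring A] [Algebra K A] [AddCommGroup M] [Module K M]
    [Module A M] [IsScalarTower K A M] (V : Submodule K A) : EReal :=
  ⨅ W : {W : Submodule K M // IsGenSub K A W}, gkModW K V W.1

/-- The return function `ν_{F,W}` of the `A`-module `M` associated with the standard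
filtration `F = {V ^ i}` of `A` and the generating subspace `W` of `M`:
`ν(i) = min { j | V ^ j • N ⊇ W for every generating subspace N ⊆ V ^ i • W }`. -/
def retMod (K : Type) [Field K] {A M : Type} [Ring A] [Algebra K A] [AddCommGroup M]
    [Module K M] [Module A M] [IsScalarTower K A M] (V : Submodule K A) (W : Submodule K M)
    (i : ℕ) : ℕ∞ :=
  sInf { j : ℕ∞ | ∃ n : ℕ, j = (n : ℕ∞) ∧ ∀ N : Submodule K M,
      Submodule.span A (N : Set M) = ⊤ → N ≤ smulSub K (V ^ i) W →
      W ≤ smulSub K (V ^ n) N }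

/-- The filter dimension `fd(M) = γ(ν_{F,W})` of the `A`-module `M`. -/
def fdModW (K : Type) [Field K] {A M : Type} [Ring A] [Algebra K A] [AddCommGroup M]
    [Module K M] [Module A M] [IsScalarTower K A M] (V : Submodule K A) (W : Submodule K M) :
    EReal :=
  gammaDeg (retMod K V W)

/-- The return function `ν_F` of a (simple) algebra `A` w.r.t. the standard filtration
`F = {A_i = V ^ i}`: `ν_F(i) = min { j | 1 ∈ A_j a A_j for all 0 ≠ a ∈ A_i }`, where
`A_j a A_j` is the `K`-span of `{ x * a * y | x, y ∈ A_j }`. -/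
def nuFn (K : Type) [Field K] {A : Type} [Ring A] [Algebra K A] (V : Submodule K A)
    (i : ℕ) : ℕ∞ :=
  sInf { j : ℕ∞ | ∃ n : ℕ, j = (n : ℕ∞) ∧ ∀ a ∈ (V ^ i : Submodule K A), a ≠ 0 →
    (1 : A) ∈ Submodule.span K
      {x : A | ∃ u ∈ (V ^ n : Submodule K A), ∃ w ∈ (V ^ n : Submodule K A), x = u * a * w} }

/-- The left return function `λ_F` of a (simple) algebra `A`:
`λ_F(i) = min { j | 1 ∈ A a A_j for all 0 ≠ a ∈ A_i }`, where `A a A_j` is the left ideal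
of `A` generated by the set `a A_j`. -/
def lamFn (K : Type) [Field K] {A : Type} [Ring A] [Algebra K A] (V : Submodule K A)
    (i : ℕ) : ℕ∞ :=
  sInf { j : ℕ∞ | ∃ n : ℕ, j = (n : ℕ∞) ∧ ∀ a ∈ (V ^ i : Submodule K A), a ≠ 0 →
    (1 : A) ∈ Submodule.span A {x : A | ∃ w ∈ (V ^ n : Submodule K A), x = a * w} }

/-- The filter dimension `fd(A) = γ(ν_F)` of a simple finitely generated algebra `A`. -/
def fdAlg (K : Type) [Field K] {A : Type} [Ring A] [Algebra K A] (V : Submodule K A) : EReal :=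
  gammaDeg (nuFn K V)

/-- The left filter dimension `lfd(A) = γ(λ_F)` of a simple finitely generated algebra `A`. -/
def lfdAlg (K : Type) [Field K] {A : Type} [Ring A] [Algebra K A] (V : Submodule K A) : EReal :=
  gammaDeg (lamFn K V)

/-- `DevLE n α` : the deviation of the poset `α` is at most `n`. -/
def DevLE : ℕ → (α : Type) → [inst : Preorder α] → Prop
  | 0, α, _ => ∀ f : ℕ → α, Antitone f → ∀ᶠ i in atTop, ¬ f (i + 1) < f i
  | n + 1, α, _ => ∀ f : ℕ → α, Antitone f →
      ∀ᶠ i in atTop, DevLE n (Set.Icc (f (i + 1)) (f i))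

open Classical in
/-- The left Krull dimension in the sense of Rentschler–Gabriel of the `A`-module `M`:
the deviation of the poset of submodules of `M`, as an extended real (`⊥` for the zero
module, `⊤` if the deviation is not a natural number). For `M = A` this is the left Krull
dimension `K.dim A` of the ring `A`. -/
def kdimE (A M : Type) [Ring A] [AddCommGroup M] [Module A M] : EReal :=
  if Subsingleton M then ⊥
  else sInf { x : EReal | ∃ n : ℕ, x = (n : EReal) ∧ DevLE n (Submodule A M) }

/-- `A` is the `n`-th Weyl algebra over `K` with canonical generators `X i`, `D i`:
it is a nontrivial `K`-algebra generated by `X 0, …, X (n-1), D 0, …, D (n-1)` subject to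
the defining relations `D i * X j - X j * D i = δ_{ij}`, `[X i, X j] = [D i, D j] = 0`
(over a field of characteristic zero any such algebra is a copy of the Weyl algebra,
since the latter is simple). -/
structure IsWeylAlgebra (K A : Type) [Field K] [Ring A] [Algebra K A] (n : ℕ)
    (X D : Fin n → A) : Prop where
  nontrivial : Nontrivial A
  comm_XX : ∀ i j, X i * X j = X j * X i
  comm_DD : ∀ i j, D i * D j = D j * D i
  rel : ∀ i j, D i * X j - X j * D i = if i = j then 1 else 0
  gen : Algebra.adjoin K (Set.range X ∪ Set.range D) = ⊤

theorem devLE_strictMono : ∀ (n : ℕ) {α β : Type} [PartialOrder α] [PartialOrder β] (f : α → β),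
    StrictMono f → DevLE n β → DevLE n α := by
  intro n
  induction n with
  | zero =>
    intro α β _ _ f hf h a ha
    refine (h (fun i => f (a i)) (fun i j hij => hf.monotone (ha hij))).mono ?_
    intro i hi hlt
    exact hi (hf hlt)
  | succ n ih =>
    intro α β _ _ f hf h a ha
    refine (h (fun i => f (a i)) (fun i j hij => hf.monotone (ha hij))).mono ?_
    intro i hi
    refine ih (fun x : Set.Icc (a (i+1)) (a i) =>
      (⟨f x.1, hf.monotone x.2.1, hf.monotone x.2.2⟩ : Set.Icc (f (a (i+1))) (f (a i)))) ?_ hi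
    intro x y hxy
    exact hf hxy

theorem devLE_pi : ∀ (n : ℕ) {ι : Type} [Finite ι] (P : ι → Type) [∀ i, PartialOrder (P i)],
    (∀ i, DevLE n (P i)) → DevLE n (∀ i, P i) := by
  intro n
  induction n with
  | zero =>
    intro ι _ P _ h a ha
    have h1 : ∀ᶠ k in atTop, ∀ i, ¬ a (k+1) i < a k i :=
      eventually_all.2 fun i => h i (fun k => a k i) (fun k l hkl => ha hkl i)
    refine h1.mono ?_
    intro k hk hlt
    obtain ⟨i, hi⟩ := (Pi.lt_def.1 hlt).2
    exact hk i hi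
  | succ n ih =>
    intro ι _ P _ h a ha
    have h1 : ∀ᶠ k in atTop, ∀ i, DevLE n (Set.Icc (a (k+1) i) (a k i)) :=
      eventually_all.2 fun i => h i (fun k => a k i) (fun k l hkl => ha hkl i)
    refine h1.mono ?_
    intro k hk
    refine devLE_strictMono n (fun x : Set.Icc (a (k+1)) (a k) =>
      (fun i => (⟨x.1 i, x.2.1 i, x.2.2 i⟩ : Set.Icc (a (k+1) i) (a k i)))) ?_ (ih _ hk)
    intro x y hxy
    obtain ⟨h1, i, hi⟩ := Pi.lt_def.1 (show x.1 < y.1 from hxy)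
    exact Pi.lt_def.2 ⟨fun j => h1 j, i, hi⟩

theorem devLE_prod : ∀ (n : ℕ) {α β : Type} [PartialOrder α] [PartialOrder β],
    DevLE n α → DevLE n β → DevLE n (α × β) := by
  intro n
  induction n with
  | zero =>
    intro α β _ _ h h' a ha
    filter_upwards [h (fun k => (a k).1) (fun k l hkl => (ha hkl).1),
      h' (fun k => (a k).2) (fun k l hkl => (ha hkl).2)] with k h1 h2 hlt
    rcases Prod.lt_iff.1 hlt with h3 | h3
    · exact h1 h3.1
    · exact h2 h3.2
  | succ n ih =>
    intro α β _ _ h h' a ha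
    filter_upwards [h (fun k => (a k).1) (fun k l hkl => (ha hkl).1),
      h' (fun k => (a k).2) (fun k l hkl => (ha hkl).2)] with k h1 h2
    refine devLE_strictMono n (fun x : Set.Icc (a (k+1)) (a k) =>
      ((⟨x.1.1, x.2.1.1, x.2.2.1⟩, ⟨x.1.2, x.2.1.2, x.2.2.2⟩) :
        Set.Icc (a (k+1)).1 (a k).1 × Set.Icc (a (k+1)).2 (a k).2)) ?_ (ih h1 h2)
    intro x y hxy
    rcases Prod.lt_iff.1 (show x.1 < y.1 from hxy) with h3 | h3
    · exact Prod.lt_iff.2 (Or.inl ⟨h3.1, h3.2⟩)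
    · exact Prod.lt_iff.2 (Or.inr ⟨h3.1, h3.2⟩)

theorem exists_stab {P : Type} [PartialOrder P] [WellFoundedGT P] (f : ℕ → (ℕ →o P)) :
    ∃ m : ℕ → ℕ, ∀ j i, m j ≤ i → f j i = f j (m j) := by
  have : ∀ j, ∃ m, ∀ i, m ≤ i → f j i = f j m := by
    intro j
    obtain ⟨m, hm⟩ := WellFoundedGT.monotone_chain_condition (f j)
    exact ⟨m, fun i hi => (hm i hi).symm⟩
  choose m hm using this
  exact ⟨m, hm⟩

theorem devLE_seq : ∀ (n : ℕ) {P : Type} [PartialOrder P] [WellFoundedGT P],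
    DevLE n P → DevLE (n+1) (ℕ →o P) := by
  intro n
  induction n with
  | zero =>
    intro P _ _ h f hf
    obtain ⟨m, hm⟩ := exists_stab f
    have hanti : Antitone fun j => f j (m j) := by
      intro i j hij
      have h1 := hf hij (max (m i) (m j))
      rwa [hm i _ (le_max_left _ _), hm j _ (le_max_right _ _)] at h1
    filter_upwards [h _ hanti] with j hj
    have heq : f (j+1) (m (j+1)) = f j (m j) := by
      rcases (hanti (Nat.le_succ j)).lt_or_eq with h1 | h1
      · exact absurd h1 hj
      · exact h1
    set N := max (m j) (m (j+1)) with hN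
    have hfix : ∀ g : Set.Icc (f (j+1)) (f j), ∀ i, N ≤ i → g.1 i = f j (m j) := by
      intro g i hi
      have h1 := g.2.1 i
      have h2 := g.2.2 i
      rw [hm _ _ (le_trans (le_max_right _ _) hi), heq] at h1
      rw [hm _ _ (le_trans (le_max_left _ _) hi)] at h2
      exact le_antisymm h2 h1
    refine devLE_strictMono 0 (fun g : Set.Icc (f (j+1)) (f j) => (fun i : Fin N => g.1 i)) ?_
      (devLE_pi 0 _ fun _ => h)
    intro x y hxy
    have hle : x.1 ≤ y.1 := hxy.le
    refine lt_of_le_of_ne (fun i => hle i) ?_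
    intro he
    apply hxy.ne
    apply Subtype.ext
    apply OrderHom.ext
    funext i
    by_cases hi : i < N
    · exact congrFun he ⟨i, hi⟩
    · rw [hfix x i (not_lt.1 hi), hfix y i (not_lt.1 hi)]
  | succ n ih =>
    intro P _ _ h f hf
    obtain ⟨m, hm⟩ := exists_stab f
    have hanti : Antitone fun j => f j (m j) := by
      intro i j hij
      have h1 := hf hij (max (m i) (m j))
      rwa [hm i _ (le_max_left _ _), hm j _ (le_max_right _ _)] at h1
    filter_upwards [h _ hanti] with j hj
    set N := max (m j) (m (j+1)) with hN
    have hfix : ∀ g : Set.Icc (f (j+1)) (f j), ∀ i,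
        g.1 (N + i) ∈ Set.Icc (f (j+1) (m (j+1))) (f j (m j)) := by
      intro g i
      have h1 := g.2.1 (N+i)
      have h2 := g.2.2 (N+i)
      rw [hm _ _ (le_trans (le_max_right _ _) (Nat.le_add_right N i))] at h1
      rw [hm _ _ (le_trans (le_max_left _ _) (Nat.le_add_right N i))] at h2
      exact ⟨h1, h2⟩
    have : WellFoundedGT (Set.Icc (f (j+1) (m (j+1))) (f j (m j))) :=
      ⟨InvImage.wf Subtype.val (wellFounded_gt (α := P))⟩
    refine devLE_strictMono (n+1) (fun g : Set.Icc (f (j+1)) (f j) =>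
      ((fun i : Fin N => g.1 i, ⟨fun i => ⟨g.1 (N+i), hfix g i⟩, fun a b hab =>
        g.1.monotone (Nat.add_le_add_left hab N)⟩) :
        (Fin N → P) × (ℕ →o Set.Icc (f (j+1) (m (j+1))) (f j (m j))))) ?_
      (devLE_prod _ (devLE_pi _ _ fun _ => ?_) (ih hj))
    · intro x y hxy
      have hle : x.1 ≤ y.1 := hxy.le
      refine lt_of_le_of_ne ⟨fun i => hle i, fun i => hle _⟩ ?_
      intro he
      apply hxy.ne
      apply Subtype.ext
      apply OrderHom.ext
      funext i
      by_cases hi : i < N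
      · exact congrFun (congrArg Prod.fst he) ⟨i, hi⟩
      · have h1 := congrArg (fun q => (q.2 (i - N)).1) he
        have h2 : N + (i - N) = i := by omega
        change x.1 (N + (i - N)) = y.1 (N + (i - N)) at h1
        rwa [h2] at h1
    · exact h

/-- upper sets ordered by inclusion -/
abbrev USet (σ : Type) [Preorder σ] := {s : Set σ // IsUpperSet s}

theorem uset_wf (n : ℕ) : WellFoundedGT (USet (Fin n → ℕ)) := by
  refine ⟨?_⟩
  rw [RelEmbedding.wellFounded_iff_isEmpty]
  refine ⟨fun e => ?_⟩
  have hlt : ∀ i j, i < j → (e i).1 < (e j).1 := fun i j hij => e.map_rel_iff.2 hij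
  have : ∀ i, ∃ a, a ∈ (e (i+1)).1 ∧ a ∉ (e i).1 := by
    intro i
    exact Set.exists_of_ssubset (hlt i (i+1) (Nat.lt_succ_self i))
  choose a ha ha' using this
  obtain ⟨i, j, hij, hle⟩ := wellQuasiOrdered_le a
  have h1 : a j ∈ (e (i+1)).1 := (e (i+1)).2 hle (ha i)
  rcases (Nat.succ_le_of_lt hij).lt_or_eq with h2 | h2
  · exact ha' j ((hlt _ _ h2).le h1)
  · subst h2
    exact ha' _ h1

theorem devLE_uset (n : ℕ) : DevLE n (USet (Fin n → ℕ)) := by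
  induction n with
  | zero =>
    intro f hf
    obtain ⟨m, hm⟩ := WellFoundedGT.monotone_chain_condition
      (⟨fun i => OrderDual.toDual (f i), fun i j hij => hf hij⟩ : ℕ →o (USet (Fin 0 → ℕ))ᵒᵈ)
    filter_upwards [eventually_ge_atTop m] with i hi
    have h1 : f m = f i := hm i hi
    have h2 : f m = f (i+1) := hm (i+1) (by omega)
    rw [← h1, ← h2]
    exact lt_irrefl _
  | succ n ih =>
    have := uset_wf n
    refine devLE_strictMono (n+1) (fun U : USet (Fin (n+1) → ℕ) =>
      (⟨fun i => ⟨{a | (Fin.cons i a : Fin (n+1) → ℕ) ∈ U.1}, ?_⟩, ?_⟩ :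
        ℕ →o USet (Fin n → ℕ))) ?_ (devLE_seq n ih)
    · intro a b hab ha
      exact U.2 (Fin.cons_le_cons.2 ⟨le_rfl, hab⟩) ha
    · intro i j hij a ha
      exact U.2 (Fin.cons_le_cons.2 ⟨hij, le_rfl⟩) ha
    · intro U V hUV
      refine lt_of_le_of_ne (fun i a ha => hUV.le ha) ?_
      intro he
      apply hUV.ne
      apply Subtype.ext
      ext a
      have h1 := congrArg (fun q => (Fin.tail a) ∈ (q (a 0)).1) he
      change ((Fin.cons (a 0) (Fin.tail a) : Fin (n+1) → ℕ) ∈ U.1) =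
        ((Fin.cons (a 0) (Fin.tail a) : Fin (n+1) → ℕ) ∈ V.1) at h1
      rw [Fin.cons_self_tail] at h1
      exact iff_of_eq h1

theorem le_of_devLE_uset (n : ℕ) : ∀ m, DevLE m (USet (Fin n → ℕ)) → n ≤ m := by
  induction n with
  | zero => intro m _; exact Nat.zero_le m
  | succ n ih =>
    intro m h
    let U : ℕ → USet (Fin (n+1) → ℕ) := fun i => ⟨{a | i ≤ a 0}, fun a b hab ha => le_trans ha (hab 0)⟩
    have hU : Antitone U := fun i j hij a ha => le_trans hij ha
    cases m with
    | zero =>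
      obtain ⟨i, hi⟩ := (h U hU).exists
      exfalso
      apply hi
      refine lt_of_le_of_ne (hU (Nat.le_succ i)) ?_
      intro he
      have h1 : (fun _ => i : Fin (n+1) → ℕ) ∈ (U (i+1)).1 := by
        rw [he]; exact le_refl i
      exact absurd (show i + 1 ≤ i from h1) (by omega)
    | succ k =>
      obtain ⟨i, hi⟩ := (h U hU).exists
      refine Nat.succ_le_succ (ih k ?_)
      refine devLE_strictMono k (fun V : USet (Fin n → ℕ) =>
        (⟨⟨{a | i + 1 ≤ a 0 ∨ (i ≤ a 0 ∧ Fin.tail a ∈ V.1)}, ?_⟩, ?_, ?_⟩ :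
          Set.Icc (U (i+1)) (U i))) ?_ hi
      · rintro a b hab (ha | ⟨ha, ha'⟩)
        · exact Or.inl (le_trans ha (hab 0))
        · exact Or.inr ⟨le_trans ha (hab 0), V.2 (fun j => hab j.succ) ha'⟩
      · intro a ha
        exact Or.inl ha
      · rintro a (ha | ⟨ha, ha'⟩)
        · exact le_trans (Nat.le_succ i) ha
        · exact ha
      · intro V W hVW
        refine lt_of_le_of_ne ?_ ?_
        · rintro a (ha | ⟨ha, ha'⟩)
          · exact Or.inl ha
          · exact Or.inr ⟨ha, hVW.le ha'⟩
        · intro he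
          apply hVW.ne
          apply Subtype.ext
          ext a
          have h1 := congrArg (fun q => (Fin.cons i a : Fin (n+1) → ℕ) ∈ q.1.1) he
          simpa using h1

theorem exists_chom (K A : Type) [Field K] [Ring A] [Algebra K A] {n : ℕ} (y : Fin n → A)
    (hy : ∀ i j, y i * y j = y j * y i) :
    ∃ φ : MvPolynomial (Fin n) K →ₐ[K] A, ∀ i, φ (MvPolynomial.X i) = y i := by
  have hc : ∀ a ∈ Set.range y, ∀ b ∈ Set.range y, a * b = b * a := by
    rintro _ ⟨i, rfl⟩ _ ⟨j, rfl⟩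
    exact hy i j
  have := Algebra.isMulCommutative_adjoin K hc
  open scoped IsMulCommutative in
  exact ⟨(Algebra.adjoin K (Set.range y)).val.comp
    (MvPolynomial.aeval fun i => ⟨y i, Algebra.subset_adjoin ⟨i, rfl⟩⟩), fun i => by simp⟩

/-- commutator with a polynomial -/
theorem comm_chom {K A : Type} [Field K] [Ring A] [Algebra K A] {n : ℕ} (y : Fin n → A)
    (z : A) (i : Fin n) (c : K) (hz : ∀ j, z * y j - y j * z = if i = j then algebraMap K A c else 0)
    (φ : MvPolynomial (Fin n) K →ₐ[K] A) (hφ : ∀ i, φ (MvPolynomial.X i) = y i)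
    (p : MvPolynomial (Fin n) K) :
    z * φ p = φ p * z + φ (MvPolynomial.C c * MvPolynomial.pderiv i p) := by
  induction p using MvPolynomial.induction_on with
  | C a =>
    have : φ (MvPolynomial.C a) = algebraMap K A a := φ.commutes a
    simp [this, Algebra.commutes]
  | add p q hp hq => simp only [map_add, mul_add, add_mul, hp, hq]; abel
  | mul_X p j hp =>
    have h1 : z * y j = y j * z + if i = j then algebraMap K A c else 0 := by
      rw [← hz j]; abel
    have h2 : φ (MvPolynomial.C c) = algebraMap K A c := φ.commutes c
    rw [map_mul, ← mul_assoc, hp, MvPolynomial.pderiv_mul, hφ, add_mul, mul_assoc, h1,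
      MvPolynomial.pderiv_X]
    simp only [map_mul, map_add, hφ, h2, mul_add, Pi.single_apply]
    by_cases hij : i = j
    · subst hij
      simp only [if_true, mul_one, map_one, ← mul_assoc]
      rw [← Algebra.commutes c (φ p)]
      abel
    · simp only [hij, if_false, Ne.symm hij, map_zero, mul_zero, add_zero, ← mul_assoc]

theorem field_step {F V : Type} [Field F] [CharZero F] [AddCommGroup V] [Module F V]
    (x d : Module.End F V) (h : d * x - x * d = 1) (p : Polynomial F) (hp : p ≠ 0) :
    ∀ (v : V), (∃ q : Polynomial F, q ≠ 0 ∧ Polynomial.aeval d q v = 0) →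
      Polynomial.aeval x p v = 0 → v = 0 := by
  have hdx : d * x = x * d + 1 := by rw [← h]; abel
  have hcd : ∀ f : Polynomial F, d * Polynomial.aeval x f =
      Polynomial.aeval x f * d + Polynomial.aeval x (Polynomial.derivative f) := by
    intro f
    induction f using Polynomial.induction_on' with
    | add f g hf hg => simp only [map_add, mul_add, add_mul, hf, hg]; abel
    | monomial k a =>
      have : ∀ k : ℕ, d * x ^ k = x ^ k * d + (k : Module.End F V) * x ^ (k - 1) := by
        intro k
        induction k with
        | zero => simp
        | succ k ih =>
          rw [pow_succ, ← mul_assoc, ih, add_mul, mul_assoc, hdx]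
          rcases k with _ | k
          · simp [mul_add]
          · simp only [Nat.add_sub_cancel, pow_succ, Nat.cast_add, Nat.cast_one]
            noncomm_ring
      rw [Polynomial.derivative_monomial, Polynomial.aeval_monomial, Polynomial.aeval_monomial,
        ← mul_assoc, ← Algebra.commutes a d, mul_assoc, this]
      simp [mul_add, mul_assoc]
  have hcx : ∀ f : Polynomial F, Polynomial.aeval d f * x =
      x * Polynomial.aeval d f + Polynomial.aeval d (Polynomial.derivative f) := by
    intro f
    induction f using Polynomial.induction_on' with
    | add f g hf hg => simp only [map_add, mul_add, add_mul, hf, hg]; abel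
    | monomial k a =>
      have : ∀ k : ℕ, d ^ k * x = x * d ^ k + (k : Module.End F V) * d ^ (k - 1) := by
        intro k
        induction k with
        | zero => simp
        | succ k ih =>
          rw [pow_succ', mul_assoc, ih, mul_add, ← mul_assoc, hdx]
          rcases k with _ | k
          · simp [add_mul]
          · simp only [Nat.add_sub_cancel, pow_succ', Nat.cast_add, Nat.cast_one]
            have := (Nat.cast_commute k d).eq
            simp only [add_mul, mul_add, one_mul, mul_assoc]
            rw [← mul_assoc d (k : Module.End F V), ← this]
            simp only [mul_assoc]
            abel
      rw [Polynomial.derivative_monomial, Polynomial.aeval_monomial, Polynomial.aeval_monomial,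
        mul_assoc, this, mul_add, ← mul_assoc, ← mul_assoc, ← mul_assoc, Algebra.commutes a x]
      simp [mul_assoc]
  -- d-torsion is closed
  have htx : ∀ v : V, (∃ q : Polynomial F, q ≠ 0 ∧ Polynomial.aeval d q v = 0) →
      (∃ q : Polynomial F, q ≠ 0 ∧ Polynomial.aeval d q (x v) = 0) := by
    rintro v ⟨q, hq, hv⟩
    refine ⟨q * q, mul_ne_zero hq hq, ?_⟩
    have h1 := congrArg (fun T : Module.End F V => T v) (hcx (q * q))
    simp only [Module.End.mul_apply, LinearMap.add_apply] at h1
    rw [h1]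
    simp only [Polynomial.derivative_mul, map_add, map_mul, LinearMap.add_apply,
      Module.End.mul_apply, hv, map_zero, add_zero]
    rw [← Module.End.mul_apply, ← map_mul, mul_comm, map_mul, Module.End.mul_apply, hv]
    simp
  have htp : ∀ (f : Polynomial F) (v : V), (∃ q : Polynomial F, q ≠ 0 ∧ Polynomial.aeval d q v = 0) →
      (∃ q : Polynomial F, q ≠ 0 ∧ Polynomial.aeval d q (Polynomial.aeval x f v) = 0) := by
    intro f v hv
    induction f using Polynomial.induction_on' with
    | add f g hf hg =>
      obtain ⟨q1, h1, h1'⟩ := hf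
      obtain ⟨q2, h2, h2'⟩ := hg
      refine ⟨q1 * q2, mul_ne_zero h1 h2, ?_⟩
      rw [map_add, LinearMap.add_apply, map_add]
      nth_rewrite 1 [mul_comm q1 q2]
      simp [map_mul, Module.End.mul_apply, h1', h2']
    | monomial k a =>
      have : ∀ k : ℕ, ∃ q : Polynomial F, q ≠ 0 ∧ Polynomial.aeval d q ((x ^ k) v) = 0 := by
        intro k
        induction k with
        | zero => simpa using hv
        | succ k ih => simpa [pow_succ', Module.End.mul_apply] using htx _ ih
      obtain ⟨q, hq, hq'⟩ := this k
      refine ⟨q, hq, ?_⟩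
      simp [Polynomial.aeval_monomial, hq']
  -- irreducible case
  have hirr : ∀ f : Polynomial F, Irreducible f → ∀ v : V,
      (∃ q : Polynomial F, q ≠ 0 ∧ Polynomial.aeval d q v = 0) →
      Polynomial.aeval x f v = 0 → v = 0 := by
    rintro f hf v ⟨q, hq, hqv⟩ hv
    have hstep : ∀ (k : ℕ) (u : V), (Polynomial.aeval x f ^ (k+1)) (d u) =
        d ((Polynomial.aeval x f ^ (k+1)) u) -
          ((k : F) + 1) • Polynomial.aeval x (Polynomial.derivative f)
            ((Polynomial.aeval x f ^ k) u) := by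
      intro k u
      have h1 := congrArg (fun T : Module.End F V => T u) (hcd (f ^ (k+1)))
      simp only [Module.End.mul_apply, LinearMap.add_apply] at h1
      rw [← map_pow, h1, Polynomial.derivative_pow]
      have h2 : Polynomial.aeval x (Polynomial.C ((k+1 : ℕ) : F) * f ^ (k+1-1) *
          Polynomial.derivative f) u = ((k : F) + 1) • Polynomial.aeval x (Polynomial.derivative f)
            ((Polynomial.aeval x f ^ k) u) := by
        rw [mul_assoc, mul_comm (f ^ _)]
        have h3 : (k : F) • Polynomial.aeval x (Polynomial.derivative f)
            ((Polynomial.aeval x f ^ k) u) = k • Polynomial.aeval x (Polynomial.derivative f)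
            ((Polynomial.aeval x f ^ k) u) := Nat.cast_smul_eq_nsmul F k _
        simp [map_mul, Module.End.mul_apply, add_smul, h3]
      rw [h2]; abel
    have hkey : ∀ b : ℕ, (∀ k, b < k → (Polynomial.aeval x f ^ k) ((d ^ b) v) = 0) ∧
        (Polynomial.aeval x f ^ b) ((d ^ b) v) =
          ((-1) ^ b * (b.factorial : F)) •
            (Polynomial.aeval x (Polynomial.derivative f) ^ b) v := by
      intro b
      induction b with
      | zero =>
        refine ⟨?_, by simp⟩
        intro k hk
        obtain ⟨k, rfl⟩ := Nat.exists_eq_succ_of_ne_zero hk.ne'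
        simp [pow_succ, Module.End.mul_apply, hv]
      | succ b ih =>
        refine ⟨?_, ?_⟩
        · intro k hk
          obtain ⟨k, rfl⟩ := Nat.exists_eq_succ_of_ne_zero (by omega : k ≠ 0)
          rw [pow_succ' d, Module.End.mul_apply, Nat.succ_eq_add_one, hstep,
            ih.1 _ (by omega), ih.1 _ (by omega)]
          simp
        · rw [pow_succ' d, Module.End.mul_apply, hstep, ih.1 _ (by omega), ih.2]
          rw [pow_succ' (Polynomial.aeval x _), Module.End.mul_apply]
          simp only [map_zero, zero_sub, map_smul, smul_smul, ← neg_smul]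
          congr 1
          rw [Nat.factorial_succ]; push_cast; ring
    have h3 : (Polynomial.aeval x f ^ q.natDegree) (Polynomial.aeval d q v) =
        (q.leadingCoeff * ((-1) ^ q.natDegree * (q.natDegree.factorial : F))) •
            (Polynomial.aeval x (Polynomial.derivative f) ^ q.natDegree) v := by
      rw [Polynomial.aeval_eq_sum_range (p := q), LinearMap.sum_apply, map_sum, Finset.sum_range_succ,
        Finset.sum_eq_zero, zero_add]
      · rw [LinearMap.smul_apply, map_smul, (hkey _).2, smul_smul]
        rfl
      · intro i hi
        rw [LinearMap.smul_apply, map_smul, (hkey i).1 _ (Finset.mem_range.1 hi), smul_zero]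
    rw [hqv, map_zero] at h3
    have h4 : (Polynomial.aeval x (Polynomial.derivative f) ^ q.natDegree) v = 0 := by
      rcases smul_eq_zero.1 h3.symm with h5 | h5
      · exfalso
        revert h5
        have : (q.natDegree.factorial : F) ≠ 0 := Nat.cast_ne_zero.2 (Nat.factorial_ne_zero _)
        have := Polynomial.leadingCoeff_ne_zero.2 hq
        simp_all
      · exact h5
    obtain ⟨a, b, hab⟩ := (IsCoprime.pow_right (n := q.natDegree)
      (show IsCoprime f (Polynomial.derivative f) from hf.separable))
    have h6 := congrArg (fun g => Polynomial.aeval x g v) hab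
    simpa [map_mul, Module.End.mul_apply, hv, h4] using h6.symm
  induction p using WfDvdMonoid.induction_on_irreducible with
  | zero => exact absurd rfl hp
  | unit u hu =>
    intro v _ hv
    obtain ⟨w, hw⟩ := hu.exists_left_inv
    have h6 := congrArg (fun g => Polynomial.aeval x g v) hw
    simpa [map_mul, Module.End.mul_apply, hv] using h6.symm
  | mul a i ha hi ih =>
    intro v hv h0
    rw [map_mul, Module.End.mul_apply] at h0
    exact ih ha v hv (hirr i hi _ (htp a v hv) h0)

theorem domain_step {C M : Type} [CommRing C] [IsDomain C] [CharZero C] [AddCommGroup M] [Module C M]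
    (x d : Module.End C M) (h : d * x - x * d = 1) (p q : Polynomial C) (hp : p ≠ 0) (hq : q ≠ 0)
    (v : M) (hpv : Polynomial.aeval x p v = 0) (hqv : Polynomial.aeval d q v = 0) :
    ∃ c : C, c ≠ 0 ∧ c • v = 0 := by
  let F := FractionRing C
  let β := Module.End.baseChangeHom C F M
  have hβ : ∀ (T : Module.End C M) (m : M), β T (TensorProduct.mk C F M 1 m) =
      TensorProduct.mk C F M 1 (T m) := by
    intro T m
    exact LinearMap.baseChange_tmul ..
  have hpoly : ∀ (T : Module.End C M) (f : Polynomial C) (m : M),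
      Polynomial.aeval (β T) (f.map (algebraMap C F)) (TensorProduct.mk C F M 1 m) =
      TensorProduct.mk C F M 1 (Polynomial.aeval T f m) := by
    intro T f m
    rw [Polynomial.aeval_map_algebraMap, Polynomial.aeval_algHom_apply, hβ]
  have hinj := IsFractionRing.injective C F
  have h0 : TensorProduct.mk C F M 1 v = 0 := by
    have : CharZero F := charZero_of_injective_algebraMap hinj
    refine field_step (β x) (β d) ?_ (p.map (algebraMap C F))
      ((Polynomial.map_ne_zero_iff hinj).2 hp) _
      ⟨q.map (algebraMap C F), (Polynomial.map_ne_zero_iff hinj).2 hq, ?_⟩ ?_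
    · exact (map_mul β d x ▸ map_mul β x d ▸ (map_sub β (d * x) (x * d)).symm).trans (h.symm ▸ map_one β)
    · rw [hpoly, hqv, map_zero]
    · rw [hpoly, hpv, map_zero]
  obtain ⟨c, hc⟩ := (IsLocalizedModule.eq_zero_iff (nonZeroDivisors C) _).1 h0
  exact ⟨c, nonZeroDivisors.ne_zero c.2, hc⟩

theorem commute_chom {K A : Type} [Field K] [Ring A] [Algebra K A] {n : ℕ} (y : Fin n → A)
    (z : A) (hz : ∀ j, z * y j = y j * z)
    (φ : MvPolynomial (Fin n) K →ₐ[K] A) (hφ : ∀ i, φ (MvPolynomial.X i) = y i)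
    (p : MvPolynomial (Fin n) K) : z * φ p = φ p * z := by
  induction p using MvPolynomial.induction_on with
  | C a =>
    have : φ (MvPolynomial.C a) = algebraMap K A a := φ.commutes a
    rw [this, Algebra.commutes]
  | add p q hp hq => simp only [map_add, mul_add, add_mul, hp, hq]
  | mul_X p j hp => rw [map_mul, hφ, ← mul_assoc, hp, mul_assoc, hz, mul_assoc]

theorem tors_poly {K C' M : Type} [Field K] [AddCommGroup M] [Module K M] {n : ℕ}
    [CommRing C'] [Module C' M] (e : MvPolynomial (Fin n) K →+* C')
    (φ₀ : MvPolynomial (Fin n) K →ₐ[K] Module.End K M) (he : ∀ c (m : M), e c • m = φ₀ c m)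
    (y : Fin (n+1) → Module.End K M)
    (φ : MvPolynomial (Fin (n+1)) K →ₐ[K] Module.End K M)
    (hφ : ∀ i, φ (MvPolynomial.X i) = y i)
    (hφ₀ : ∀ i, φ₀ (MvPolynomial.X i) = y i.succ)
    (y0 : Module.End C' M) (hy0 : ∀ m, y0 m = y 0 m) (p : MvPolynomial (Fin (n+1)) K) :
    ∀ (v : M),
    Polynomial.aeval y0 ((MvPolynomial.finSuccEquiv K n p).map e) v = φ p v := by
  induction p using MvPolynomial.induction_on with
  | C a =>
    intro v
    have h1 : φ (MvPolynomial.C a) = algebraMap K _ a := φ.commutes a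
    have h2 : φ₀ (MvPolynomial.C a) = algebraMap K _ a := φ₀.commutes a
    have h3 : MvPolynomial.finSuccEquiv K n (MvPolynomial.C a) =
      Polynomial.C (MvPolynomial.C a) := (MvPolynomial.finSuccEquiv K n).commutes a
    rw [h1, h3, Polynomial.map_C, Polynomial.aeval_C, Module.algebraMap_end_apply, he, h2]
  | add p q hp hq =>
    intro v
    simp only [map_add, Polynomial.map_add, LinearMap.add_apply, hp, hq]
  | mul_X p j hp =>
    intro v
    rw [map_mul, map_mul, Polynomial.map_mul, map_mul, Module.End.mul_apply, Module.End.mul_apply,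
      hp, hφ]
    congr 1
    refine Fin.cases ?_ (fun i => ?_) j
    · rw [MvPolynomial.finSuccEquiv_X_zero, Polynomial.map_X, Polynomial.aeval_X, hy0]
    · rw [MvPolynomial.finSuccEquiv_X_succ, Polynomial.map_C, Polynomial.aeval_C,
        Module.algebraMap_end_apply, he, hφ₀]

theorem tors (K : Type) [Field K] [CharZero K] (M : Type) [AddCommGroup M] [Module K M] (n : ℕ) :
    ∀ (x d : Fin n → Module.End K M)
    (_ : ∀ i j, x i * x j = x j * x i) (_ : ∀ i j, d i * d j = d j * d i)
    (_ : ∀ i j, d i * x j - x j * d i = if i = j then 1 else 0) (v : M)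
    (_ : ∀ ε : Fin n → Bool, ∃ φ : MvPolynomial (Fin n) K →ₐ[K] Module.End K M,
      (∀ i, φ (MvPolynomial.X i) = if ε i then x i else d i) ∧ ∃ p, p ≠ 0 ∧ φ p v = 0),
    v = 0 := by
  induction n with
  | zero =>
    intro x d hxx hdd hdx v h
    obtain ⟨φ, -, p, hp, hpv⟩ := h (fun _ => true)
    obtain ⟨a, rfl⟩ := MvPolynomial.C_surjective (Fin 0) p
    have h1 : φ (MvPolynomial.C a) = algebraMap K _ a := φ.commutes a
    rw [h1, Module.algebraMap_end_apply] at hpv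
    rcases smul_eq_zero.1 hpv with h2 | h2
    · subst h2; simp at hp
    · exact h2
  | succ n ih =>
    intro x d hxx hdd hdx v h
    refine ih (fun i => x i.succ) (fun i => d i.succ) (fun i j => hxx _ _) (fun i j => hdd _ _)
      (fun i j => by rw [hdx]; simp) v ?_
    intro ε
    have hs : ∀ i : Fin n, d 0 * x i.succ = x i.succ * d 0 := by
      intro i
      have := hdx 0 i.succ
      rw [if_neg (Fin.succ_ne_zero i).symm] at this
      exact sub_eq_zero.1 this
    have hs' : ∀ i : Fin n, x 0 * d i.succ = d i.succ * x 0 := by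
      intro i
      have := hdx i.succ 0
      rw [if_neg (Fin.succ_ne_zero i)] at this
      exact (sub_eq_zero.1 this).symm
    have hr : ∀ i j, i ≠ j → d i * x j = x j * d i := by
      intro i j hij
      have := hdx i j
      rw [if_neg hij] at this
      exact sub_eq_zero.1 this
    let y : Fin n → Module.End K M := fun i => if ε i then x i.succ else d i.succ
    have hy : ∀ i j, y i * y j = y j * y i := by
      intro i j
      by_cases hij : i = j
      · rw [hij]
      have hij' : i.succ ≠ j.succ := fun h => hij (Fin.succ_injective _ h)
      simp only [y]
      split_ifs
      · exact hxx _ _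
      · exact (hr _ _ hij'.symm).symm
      · exact hr _ _ hij'
      · exact hdd _ _
    obtain ⟨φ₀, hφ₀⟩ := exists_chom K _ y hy
    refine ⟨φ₀, hφ₀, ?_⟩
    have hcx : ∀ c, x 0 * φ₀ c = φ₀ c * x 0 := by
      refine commute_chom y _ ?_ φ₀ hφ₀
      intro j
      simp only [y]
      split_ifs
      · exact hxx _ _
      · exact hs' j
    have hcd : ∀ c, d 0 * φ₀ c = φ₀ c * d 0 := by
      refine commute_chom y _ ?_ φ₀ hφ₀
      intro j
      simp only [y]
      split_ifs
      · exact hs j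
      · exact hdd _ _
    letI : Module (MvPolynomial (Fin n) K) M := Module.compHom M (φ₀ : _ →+* Module.End K M)
    have hsm : ∀ (c : MvPolynomial (Fin n) K) (m : M), c • m = φ₀ c m := fun c m => rfl
    let x0 : Module.End (MvPolynomial (Fin n) K) M :=
      { toFun := x 0, map_add' := map_add _, map_smul' := fun c m => by
          rw [hsm, RingHom.id_apply, hsm]
          exact congrArg (fun T : Module.End K M => T m) (hcx c) }
    let d0 : Module.End (MvPolynomial (Fin n) K) M :=
      { toFun := d 0, map_add' := map_add _, map_smul' := fun c m => by
          rw [hsm, RingHom.id_apply, hsm]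
          exact congrArg (fun T : Module.End K M => T m) (hcd c) }
    have hrel : d0 * x0 - x0 * d0 = 1 := by
      ext m
      have := congrArg (fun T : Module.End K M => T m) (hdx 0 0)
      change d 0 (x 0 m) - x 0 (d 0 m) = m
      simpa using this
    obtain ⟨φ, hφ, p, hp, hpv⟩ := h (Fin.cons true ε)
    obtain ⟨φ', hφ', q, hq, hqv⟩ := h (Fin.cons false ε)
    refine domain_step x0 d0 hrel (MvPolynomial.finSuccEquiv K n p)
      (MvPolynomial.finSuccEquiv K n q) (by simpa using hp) (by simpa using hq) v ?_ ?_
    · rw [← hpv, ← tors_poly (RingHom.id _) φ₀ hsm _ φ hφ (by intro i; rw [hφ₀]; simp [y]) x0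
        (by intro m; simp [x0]) p v, Polynomial.map_id]
    · rw [← hqv, ← tors_poly (RingHom.id _) φ₀ hsm _ φ' hφ' (by intro i; rw [hφ₀]; simp [y]) d0
        (by intro m; simp [d0]) q v, Polynomial.map_id]

/-- span of `φ p * w β` with `β ∈ S` -/
def TT {K A : Type} [Field K] [Ring A] [Algebra K A] {n : ℕ}
    (φ : MvPolynomial (Fin n) K →ₐ[K] A) (w : (Fin n → ℕ) → A) (S : Set (Fin n → ℕ)) :
    Submodule K A :=
  Submodule.span K {a | ∃ p, ∃ β ∈ S, a = φ p * w β}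

theorem TT_mono {K A : Type} [Field K] [Ring A] [Algebra K A] {n : ℕ}
    (φ : MvPolynomial (Fin n) K →ₐ[K] A) (w : (Fin n → ℕ) → A) {S S' : Set (Fin n → ℕ)}
    (h : S ⊆ S') : TT φ w S ≤ TT φ w S' :=
  Submodule.span_mono fun _ ⟨p, β, hβ, ha⟩ => ⟨p, β, h hβ, ha⟩

theorem TT_phi {K A : Type} [Field K] [Ring A] [Algebra K A] {n : ℕ}
    (φ : MvPolynomial (Fin n) K →ₐ[K] A) (w : (Fin n → ℕ) → A) {S : Set (Fin n → ℕ)}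
    (p : MvPolynomial (Fin n) K) {a : A} (ha : a ∈ TT φ w S) : φ p * a ∈ TT φ w S := by
  induction ha using Submodule.span_induction with
  | mem a h =>
    obtain ⟨q, β, hβ, rfl⟩ := h
    exact Submodule.subset_span ⟨p * q, β, hβ, by rw [map_mul, mul_assoc]⟩
  | zero => simp
  | add a b _ _ ha hb => rw [mul_add]; exact add_mem ha hb
  | smul c a _ ha => rw [mul_smul_comm]; exact Submodule.smul_mem _ _ ha

theorem TT_z {K A : Type} [Field K] [Ring A] [Algebra K A] {n : ℕ}
    (φ : MvPolynomial (Fin n) K →ₐ[K] A) (w : (Fin n → ℕ) → A) {S S' : Set (Fin n → ℕ)}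
    (y z : Fin n → A) (c : Fin n → K)
    (hz : ∀ i j, z i * y j - y j * z i = if i = j then algebraMap K A (c i) else 0)
    (hφ : ∀ i, φ (MvPolynomial.X i) = y i)
    (hw : ∀ i α, z i * w α = w (α + Pi.single i 1)) (i : Fin n)
    (hS : ∀ β ∈ S, β ∈ S' ∧ β + Pi.single i 1 ∈ S')
    {a : A} (ha : a ∈ TT φ w S) : z i * a ∈ TT φ w S' := by
  induction ha using Submodule.span_induction with
  | mem a h =>
    obtain ⟨q, β, hβ, rfl⟩ := h
    rw [← mul_assoc, comm_chom y (z i) i (c i) (hz i) φ hφ, add_mul, mul_assoc, hw]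
    exact add_mem (Submodule.subset_span ⟨_, _, (hS β hβ).2, rfl⟩)
      (Submodule.subset_span ⟨_, _, (hS β hβ).1, rfl⟩)
  | zero => simp
  | add a b _ _ ha hb => rw [mul_add]; exact add_mem ha hb
  | smul c a _ ha => rw [mul_smul_comm]; exact Submodule.smul_mem _ _ ha

theorem gen_stable {K A : Type} [Field K] [Ring A] [Algebra K A] (s : Set A)
    (hs : Algebra.adjoin K s = ⊤) (N : Submodule K A) (h : ∀ g ∈ s, ∀ a ∈ N, g * a ∈ N) (b : A) :
    ∀ a ∈ N, b * a ∈ N := by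
  have hb : b ∈ Algebra.adjoin K s := by rw [hs]; trivial
  induction hb using Algebra.adjoin_induction with
  | mem g hg => exact h g hg
  | algebraMap r => intro a ha; rw [← Algebra.smul_def]; exact N.smul_mem r ha
  | add x y _ _ hx hy => intro a ha; rw [add_mul]; exact add_mem (hx a ha) (hy a ha)
  | mul x y _ _ hx hy => intro a ha; rw [mul_assoc]; exact hx _ (hy a ha)

theorem TT_left {K A : Type} [Field K] [Ring A] [Algebra K A] {n : ℕ}
    (φ : MvPolynomial (Fin n) K →ₐ[K] A) (w : (Fin n → ℕ) → A) {S : Set (Fin n → ℕ)}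
    (y z : Fin n → A) (c : Fin n → K)
    (hz : ∀ i j, z i * y j - y j * z i = if i = j then algebraMap K A (c i) else 0)
    (hφ : ∀ i, φ (MvPolynomial.X i) = y i)
    (hw : ∀ i α, z i * w α = w (α + Pi.single i 1)) (hS : IsUpperSet S)
    (hgen : Algebra.adjoin K (Set.range y ∪ Set.range z) = ⊤) (b : A)
    {a : A} (ha : a ∈ TT φ w S) : b * a ∈ TT φ w S := by
  refine gen_stable _ hgen _ ?_ b a ha
  rintro _ (⟨i, rfl⟩ | ⟨i, rfl⟩) a ha
  · rw [← hφ]; exact TT_phi φ w _ ha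
  · exact TT_z φ w y z c hz hφ hw i
      (fun β hβ => ⟨hβ, hS (le_add_of_nonneg_right zero_le) hβ⟩) ha

theorem isUpperSet_of_single {n : ℕ} (S : Set (Fin n → ℕ))
    (h : ∀ i, ∀ α ∈ S, α + Pi.single i 1 ∈ S) : IsUpperSet S := by
  have h1 : ∀ i k, ∀ α ∈ S, α + Pi.single i k ∈ S := by
    intro i k
    induction k with
    | zero => intro α hα; simpa using hα
    | succ k ih =>
      intro α hα
      have := h i _ (ih α hα)
      rwa [add_assoc, ← Pi.single_add] at this
  intro α γ hle hα
  have h2 : ∀ s : Finset (Fin n), α + ∑ i ∈ s, Pi.single i (γ i - α i) ∈ S := by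
    intro s
    induction s using Finset.induction_on with
    | empty => simpa using hα
    | insert a s ha ih =>
      rw [Finset.sum_insert ha, add_comm (Pi.single _ _), ← add_assoc]
      exact h1 _ _ _ ih
  have h3 := h2 Finset.univ
  have h4 : ∑ i, Pi.single i (γ i - α i) = γ - α := Finset.univ_sum_single (γ - α)
  rw [h4, add_tsub_cancel_of_le hle] at h3
  exact h3

/-- the set of leading exponents -/
def EE {K A : Type} [Field K] [Ring A] [Algebra K A] {n : ℕ}
    (φ : MvPolynomial (Fin n) K →ₐ[K] A) (w : (Fin n → ℕ) → A) (I : Submodule A A) :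
    Set (Fin n → ℕ) :=
  {α | ∃ a ∈ I, ∃ p, p ≠ 0 ∧ a - φ p * w α ∈ TT φ w {β | toLex β < toLex α}}

theorem lt_add_single {n : ℕ} (α : Fin n → ℕ) (i : Fin n) :
    toLex α < toLex (α + Pi.single i 1) := by
  apply Pi.toLex_strictMono
  refine lt_of_le_of_ne (le_add_of_nonneg_right zero_le) ?_
  intro h
  have := congrFun h i
  simp at this

theorem EE_upper {K A : Type} [Field K] [Ring A] [Algebra K A] {n : ℕ}
    (φ : MvPolynomial (Fin n) K →ₐ[K] A) (w : (Fin n → ℕ) → A)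
    (y z : Fin n → A) (c : Fin n → K)
    (hz : ∀ i j, z i * y j - y j * z i = if i = j then algebraMap K A (c i) else 0)
    (hφ : ∀ i, φ (MvPolynomial.X i) = y i)
    (hw : ∀ i α, z i * w α = w (α + Pi.single i 1)) (I : Submodule A A) :
    IsUpperSet (EE φ w I) := by
  apply isUpperSet_of_single
  rintro i α ⟨a, ha, p, hp, hap⟩
  refine ⟨z i * a, I.smul_mem (z i) ha, p, hp, ?_⟩
  have h1 : z i * a - φ p * w (α + Pi.single i 1) = z i * (a - φ p * w α) +
      φ (MvPolynomial.C (c i) * MvPolynomial.pderiv i p) * w α := by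
    rw [mul_sub, ← mul_assoc, comm_chom y (z i) i (c i) (hz i) φ hφ p, add_mul, mul_assoc, hw]
    abel
  rw [h1]
  refine add_mem (TT_z φ w y z c hz hφ hw i ?_ hap)
    (Submodule.subset_span ⟨_, _, lt_add_single α i, rfl⟩)
  intro β hβ
  have hβ' : toLex β < toLex α := hβ
  refine ⟨hβ'.trans (lt_add_single α i), ?_⟩
  have := add_lt_add_left hβ' (toLex (Pi.single i 1))
  first
  | exact this
  | exact add_lt_add_right hβ' (toLex (Pi.single i 1))

theorem TT_le_split {K A : Type} [Field K] [Ring A] [Algebra K A] {n : ℕ}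
    (φ : MvPolynomial (Fin n) K →ₐ[K] A) (w : (Fin n → ℕ) → A) (α : Fin n → ℕ) {a : A}
    (ha : a ∈ TT φ w {β | toLex β ≤ toLex α}) :
    ∃ p, a - φ p * w α ∈ TT φ w {β | toLex β < toLex α} := by
  induction ha using Submodule.span_induction with
  | mem a h =>
    obtain ⟨q, β, hβ, rfl⟩ := h
    rcases (show toLex β ≤ toLex α from hβ).lt_or_eq with h1 | h1
    · refine ⟨0, ?_⟩
      rw [map_zero, zero_mul, sub_zero]
      exact Submodule.subset_span ⟨q, β, h1, rfl⟩
    · have : β = α := toLex.injective h1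
      exact ⟨q, by rw [this, sub_self]; exact zero_mem _⟩
  | zero => exact ⟨0, by simp⟩
  | add a b _ _ ha hb =>
    obtain ⟨p, hp⟩ := ha
    obtain ⟨q, hq⟩ := hb
    refine ⟨p + q, ?_⟩
    have := add_mem hp hq
    rw [map_add, add_mul]
    convert this using 1
    abel
  | smul c a _ ha =>
    obtain ⟨p, hp⟩ := ha
    refine ⟨c • p, ?_⟩
    have := Submodule.smul_mem _ c hp
    rwa [smul_sub, ← smul_mul_assoc, ← map_smul] at this

theorem TT_lt_split {K A : Type} [Field K] [Ring A] [Algebra K A] {n : ℕ}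
    (φ : MvPolynomial (Fin n) K →ₐ[K] A) (w : (Fin n → ℕ) → A) (S : Set (Fin n → ℕ)) {a : A}
    (ha : a ∈ TT φ w S) :
    a = 0 ∨ ∃ β ∈ S, a ∈ TT φ w {γ | toLex γ ≤ toLex β} := by
  induction ha using Submodule.span_induction with
  | mem a h =>
    obtain ⟨q, β, hβ, rfl⟩ := h
    exact Or.inr ⟨β, hβ, Submodule.subset_span ⟨q, β, le_refl (toLex β), rfl⟩⟩
  | zero => exact Or.inl rfl
  | add a b _ _ ha hb =>
    rcases ha with rfl | ⟨β, hβ, ha⟩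
    · rwa [zero_add]
    rcases hb with rfl | ⟨γ, hγ, hb⟩
    · exact Or.inr ⟨β, hβ, by rwa [add_zero]⟩
    rcases le_total (toLex β) (toLex γ) with h | h
    · exact Or.inr ⟨γ, hγ, add_mem (TT_mono φ w (fun δ hδ => le_trans hδ h) ha) hb⟩
    · exact Or.inr ⟨β, hβ, add_mem ha (TT_mono φ w (fun δ hδ => le_trans hδ h) hb)⟩
  | smul c a _ ha =>
    rcases ha with rfl | ⟨β, hβ, ha⟩
    · exact Or.inl (smul_zero _)
    · exact Or.inr ⟨β, hβ, Submodule.smul_mem _ _ ha⟩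

theorem division {K A : Type} [Field K] [Ring A] [Algebra K A] {n : ℕ}
    (φ : MvPolynomial (Fin n) K →ₐ[K] A) (w : (Fin n → ℕ) → A)
    (I J : Submodule A A) (hIJ : I ≤ J) (hE : EE φ w J ⊆ EE φ w I) (α : Lex (Fin n → ℕ)) :
    ∀ j ∈ J, j ∈ TT φ w {β | toLex β ≤ α} → ∃ r, r ≠ 0 ∧ φ r * j ∈ I := by
  induction α using WellFoundedLT.induction with
  | ind α ih =>
    have hlow : ∀ j ∈ J, j ∈ TT φ w {β | toLex β < α} → ∃ r, r ≠ 0 ∧ φ r * j ∈ I := by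
      intro j hj hjT
      rcases TT_lt_split φ w _ hjT with rfl | ⟨β, hβ, h⟩
      · exact ⟨1, one_ne_zero, by simp⟩
      · exact ih (toLex β) hβ j hj h
    intro j hj hjT
    obtain ⟨p, hp⟩ := TT_le_split φ w (ofLex α) hjT
    by_cases hp0 : p = 0
    · subst hp0
      refine hlow j hj ?_
      simpa using hp
    · obtain ⟨i, hi, q, hq, hiq⟩ := hE (show ofLex α ∈ EE φ w J from ⟨j, hj, p, hp0, hp⟩)
      have h1 : φ q * j - φ p * i = φ q * (j - φ p * w (ofLex α)) -
          φ p * (i - φ q * w (ofLex α)) := by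
        have : φ q * φ p = φ p * φ q := by rw [← map_mul, mul_comm, map_mul]
        rw [mul_sub, mul_sub, ← mul_assoc, ← mul_assoc, this]
        abel
      obtain ⟨r, hr, hrI⟩ := hlow (φ q * j - φ p * i)
        (sub_mem (J.smul_mem (φ q) hj) (J.smul_mem (φ p) (hIJ hi)))
        (by rw [h1]; exact sub_mem (TT_phi φ w q hp) (TT_phi φ w p hiq))
      refine ⟨r * q, mul_ne_zero hr hq, ?_⟩
      have h2 : φ (r * q) * j = φ r * (φ q * j - φ p * i) + φ r * (φ p * i) := by
        rw [map_mul, mul_sub, mul_assoc]; abel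
      rw [h2]
      exact add_mem hrI (I.smul_mem _ (I.smul_mem _ hi))

theorem exists_w (K : Type) {A : Type} [Field K] [Ring A] [Algebra K A] {n : ℕ} (z : Fin n → A)
    (hz : ∀ i j, z i * z j = z j * z i) :
    ∃ w : (Fin n → ℕ) → A, w 0 = 1 ∧ ∀ i α, z i * w α = w (α + Pi.single i 1) := by
  obtain ⟨ψ, hψ⟩ := exists_chom K A z hz
  refine ⟨fun α => ψ (MvPolynomial.monomial (Finsupp.equivFunOnFinite.symm α) 1), ?_, ?_⟩
  · have : Finsupp.equivFunOnFinite.symm (0 : Fin n → ℕ) = 0 := by ext; simp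
    simp only [this]
    exact map_one ψ
  · intro i α
    have : Finsupp.equivFunOnFinite.symm (α + Pi.single i 1) =
        Finsupp.single i 1 + Finsupp.equivFunOnFinite.symm α := by
      ext j; simp [Finsupp.single_apply, Pi.single_apply, add_comm, eq_comm]
    beta_reduce
    rw [← hψ, ← map_mul, this, MvPolynomial.X, MvPolynomial.monomial_mul, one_mul]

theorem weyl_upper (K A : Type) [Field K] [CharZero K] [Ring A] [Algebra K A]
    (n : ℕ) (X D : Fin n → A) (h : IsWeylAlgebra K A n X D) : DevLE n (Submodule A A) := by
  let y : (Fin n → Bool) → Fin n → A := fun ε i => if ε i then X i else D i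
  let z : (Fin n → Bool) → Fin n → A := fun ε i => if ε i then D i else X i
  let c : (Fin n → Bool) → Fin n → K := fun ε i => if ε i then 1 else -1
  have hr : ∀ i j, i ≠ j → D i * X j = X j * D i := by
    intro i j hij
    have := h.rel i j
    rw [if_neg hij] at this
    exact sub_eq_zero.1 this
  have hrr : ∀ i, D i * X i = X i * D i + 1 := by
    intro i
    have := h.rel i i
    rw [if_pos rfl] at this
    rw [← this]; abel
  have hy : ∀ ε i j, y ε i * y ε j = y ε j * y ε i := by
    intro ε i j
    by_cases hij : i = j
    · rw [hij]
    simp only [y]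
    split_ifs
    · exact h.comm_XX _ _
    · exact (hr _ _ (Ne.symm hij)).symm
    · exact hr _ _ hij
    · exact h.comm_DD _ _
  have hz : ∀ ε i j, z ε i * z ε j = z ε j * z ε i := by
    intro ε i j
    by_cases hij : i = j
    · rw [hij]
    simp only [z]
    split_ifs
    · exact h.comm_DD _ _
    · exact hr _ _ hij
    · exact (hr _ _ (Ne.symm hij)).symm
    · exact h.comm_XX _ _
  have hzy : ∀ ε i j, z ε i * y ε j - y ε j * z ε i =
      if i = j then algebraMap K A (c ε i) else 0 := by
    intro ε i j
    by_cases hij : i = j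
    · subst hij
      simp only [y, z, c]
      split_ifs
      · simp [hrr]
      · simp [hrr]
    · rw [if_neg hij, sub_eq_zero]
      simp only [y, z]
      split_ifs
      · exact hr _ _ hij
      · exact h.comm_DD _ _
      · exact h.comm_XX _ _
      · exact (hr _ _ (Ne.symm hij)).symm
  have hgen : ∀ ε, Algebra.adjoin K (Set.range (y ε) ∪ Set.range (z ε)) = ⊤ := by
    intro ε
    have : Set.range (y ε) ∪ Set.range (z ε) = Set.range X ∪ Set.range D := by
      apply Set.Subset.antisymm
      · rintro _ (⟨i, rfl⟩ | ⟨i, rfl⟩)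
        · simp only [y]
          split_ifs
          · exact Or.inl ⟨i, rfl⟩
          · exact Or.inr ⟨i, rfl⟩
        · simp only [z]
          split_ifs
          · exact Or.inr ⟨i, rfl⟩
          · exact Or.inl ⟨i, rfl⟩
      · rintro _ (⟨i, rfl⟩ | ⟨i, rfl⟩)
        · by_cases hi : ε i
          · exact Or.inl ⟨i, by simp [y, hi]⟩
          · exact Or.inr ⟨i, by simp [z, hi]⟩
        · by_cases hi : ε i
          · exact Or.inr ⟨i, by simp [z, hi]⟩
          · exact Or.inl ⟨i, by simp [y, hi]⟩
    rw [this, h.gen]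
  choose φ hφ using fun ε => exists_chom K A (y ε) (hy ε)
  choose w hw0 hw using fun ε => exists_w K (z ε) (hz ε)
  refine devLE_strictMono n (fun I : Submodule A A => fun ε : Fin n → Bool =>
    (⟨EE (φ ε) (w ε) I, EE_upper (φ ε) (w ε) (y ε) (z ε) (c ε) (hzy ε) (hφ ε) (hw ε) I⟩ :
      USet (Fin n → ℕ))) ?_ (devLE_pi n _ fun _ => devLE_uset n)
  intro I J hIJ
  refine lt_of_le_of_ne ?_ ?_
  · rintro ε α ⟨a, ha, h1⟩
    exact ⟨a, hIJ.le ha, h1⟩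
  · intro he
    obtain ⟨j, hjJ, hjI⟩ := SetLike.exists_of_lt hIJ
    apply hjI
    rw [← Submodule.Quotient.mk_eq_zero]
    let L : A →ₐ[K] Module.End K (A ⧸ I) := Algebra.lsmul K K (A ⧸ I)
    refine tors K (A ⧸ I) n (fun i => L (X i)) (fun i => L (D i)) ?_ ?_ ?_ _ ?_
    · intro i k; rw [← map_mul, h.comm_XX, map_mul]
    · intro i k; rw [← map_mul, h.comm_DD, map_mul]
    · intro i k
      have h1 : L (D i * X k - X k * D i) = L (if i = k then 1 else 0) := by rw [h.rel]
      split_ifs with hik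
      · rw [if_pos hik] at h1
        exact (map_mul L (D i) (X k) ▸ map_mul L (X k) (D i) ▸
          (map_sub L (D i * X k) (X k * D i)).symm).trans (h1.trans (map_one L))
      · rw [if_neg hik] at h1
        exact (map_mul L (D i) (X k) ▸ map_mul L (X k) (D i) ▸
          (map_sub L (D i * X k) (X k * D i)).symm).trans (h1.trans (map_zero L))
    · intro ε
      refine ⟨L.comp (φ ε), ?_, ?_⟩
      · intro i
        rw [AlgHom.comp_apply, hφ]
        simp only [y]
        split_ifs <;> rfl
      · have hjT : j ∈ TT (φ ε) (w ε) Set.univ := by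
          rw [← mul_one j]
          refine TT_left (φ ε) (w ε) (y ε) (z ε) (c ε) (hzy ε) (hφ ε) (hw ε) isUpperSet_univ
            (hgen ε) j ?_
          exact Submodule.subset_span ⟨1, 0, trivial, by rw [map_one, hw0, one_mul]⟩
        have hEE : EE (φ ε) (w ε) J ⊆ EE (φ ε) (w ε) I :=
          (congrArg Subtype.val (congrFun he ε)).ge
        have : ∃ r, r ≠ 0 ∧ φ ε r * j ∈ I := by
          rcases TT_lt_split _ _ _ hjT with h0 | ⟨β, -, hβ⟩
          · exact absurd (h0 ▸ zero_mem I) hjI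
          · exact division (φ ε) (w ε) I J hIJ.le hEE (toLex β) j hjJ hβ
        obtain ⟨r, hr, hrI⟩ := this
        refine ⟨r, hr, ?_⟩
        exact (Submodule.Quotient.mk_eq_zero I).2 hrI

theorem weyl_exists_const {C : Type} [CommRing C] [IsDomain C] [CharZero C] {n : ℕ}
    (N : Set (MvPolynomial (Fin n) C))
    (hN : ∀ i, ∀ f ∈ N, MvPolynomial.pderiv i f ∈ N) :
    ∀ (d : ℕ) (f : MvPolynomial (Fin n) C), f.totalDegree ≤ d → f ∈ N → f ≠ 0 →
      ∃ c : C, c ≠ 0 ∧ MvPolynomial.C c ∈ N := by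
  intro d
  induction d with
  | zero =>
    intro f hd hf h0
    have := MvPolynomial.totalDegree_eq_zero_iff_eq_C.1 (Nat.le_zero.1 hd)
    rw [this] at hf h0
    exact ⟨_, fun h => h0 (by rw [h, map_zero]), hf⟩
  | succ d ih =>
    intro f hd hf h0
    by_cases hc : ∃ i, MvPolynomial.pderiv i f ≠ 0
    · obtain ⟨i, hi⟩ := hc
      refine ih (MvPolynomial.pderiv i f) ?_ (hN i f hf) hi
      refine Finset.sup_le fun s hs => ?_
      rw [MvPolynomial.mem_support_iff, MvPolynomial.coeff_pderiv] at hs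
      have h1 : s + Finsupp.single i 1 ∈ f.support := by
        rw [MvPolynomial.mem_support_iff]
        exact left_ne_zero_of_mul hs
      have h2 := (MvPolynomial.le_totalDegree h1).trans hd
      have h3 : ((s + Finsupp.single i 1).sum fun _ e => e) = (s.sum fun _ e => e) + 1 := by
        rw [Finsupp.sum_add_index' (fun _ => rfl) (fun _ _ _ => rfl)]
        simp
      omega
    · push Not at hc
      refine ih f ?_ hf h0
      refine Finset.sup_le fun s hs => ?_
      by_cases hs0 : s = 0
      · subst hs0; simp
      · exfalso
        obtain ⟨i, hi⟩ := Finsupp.ne_iff.1 hs0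
        have h1 := congrArg (MvPolynomial.coeff (s - Finsupp.single i 1)) (hc i)
        have h2 : s - Finsupp.single i 1 + Finsupp.single i 1 = s := by
          apply tsub_add_cancel_of_le
          rw [Finsupp.single_le_iff]
          exact Nat.one_le_iff_ne_zero.2 hi
        rw [MvPolynomial.coeff_pderiv, h2, MvPolynomial.coeff_zero] at h1
        rcases mul_eq_zero.1 h1 with h3 | h3
        · exact (MvPolynomial.mem_support_iff.1 hs) h3
        · exact Nat.cast_add_one_ne_zero _ h3

theorem weyl_lower (K A : Type) [Field K] [CharZero K] [Ring A] [Algebra K A]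
    (n : ℕ) (X D : Fin n → A) (h : IsWeylAlgebra K A n X D) (m : ℕ)
    (hm : DevLE m (Submodule A A)) : n ≤ m := by
  have := h.nontrivial
  obtain ⟨φ, hφ⟩ := exists_chom K A D h.comm_DD
  obtain ⟨ψ, hψ⟩ := exists_chom K A X h.comm_XX
  have hXD : ∀ i j, X i * D j - D j * X i = if i = j then algebraMap K A (-1) else 0 := by
    intro i j
    have := h.rel j i
    rw [← neg_sub, this]
    by_cases hij : i = j
    · simp [hij]
    · simp [hij, Ne.symm hij]
  have hDX : ∀ i j, D i * X j - X j * D i = if i = j then algebraMap K A 1 else 0 := by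
    intro i j
    rw [h.rel, map_one]
  have hφinj : ∀ p, φ p = 0 → p = 0 := by
    intro p hp
    by_contra hp0
    obtain ⟨k, hk, hk0⟩ := weyl_exists_const {p | φ p = 0} (fun i f hf => by
      have hf' : φ f = 0 := hf
      have h1 := comm_chom D (X i) i (-1) (hXD i) φ hφ f
      rw [hf', mul_zero, zero_mul, zero_add, map_mul] at h1
      have h2 : φ (MvPolynomial.C (-1)) = -1 := by simp
      rw [h2, neg_one_mul] at h1
      exact neg_eq_zero.1 h1.symm) p.totalDegree p le_rfl hp hp0
    have h2 : φ (MvPolynomial.C k) = algebraMap K A k := φ.commutes k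
    have h3 : φ (MvPolynomial.C k) = 0 := hk0
    rw [h2] at h3
    exact hk ((map_eq_zero (algebraMap K A)).1 h3)
  letI : Module (MvPolynomial (Fin n) K) A := Module.compHom A (φ : _ →+* A)
  have hsm : ∀ (c : MvPolynomial (Fin n) K) (a : A), c • a = φ c * a := fun c a => rfl
  let Φ : MvPolynomial (Fin n) (MvPolynomial (Fin n) K) →ₗ[MvPolynomial (Fin n) K] A :=
    (MvPolynomial.basisMonomials (Fin n) (MvPolynomial (Fin n) K)).constr ℕ
      (fun s => ψ (MvPolynomial.monomial s 1))
  have hΦ1 : ∀ s, Φ (MvPolynomial.monomial s 1) = ψ (MvPolynomial.monomial s 1) := by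
    intro s
    have := (MvPolynomial.basisMonomials (Fin n) (MvPolynomial (Fin n) K)).constr_basis ℕ
      (fun s => ψ (MvPolynomial.monomial s 1)) s
    rwa [MvPolynomial.coe_basisMonomials] at this
  have hΦ : ∀ s c, Φ (MvPolynomial.monomial s c) = φ c * ψ (MvPolynomial.monomial s 1) := by
    intro s c
    have : MvPolynomial.monomial s c = c • MvPolynomial.monomial s (1 : MvPolynomial (Fin n) K) := by
      rw [MvPolynomial.smul_monomial, smul_eq_mul, mul_one]
    rw [this, map_smul, hΦ1, hsm]
  have hder : ∀ i f, D i * Φ f = Φ f * D i + Φ (MvPolynomial.pderiv i f) := by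
    intro i f
    induction f using MvPolynomial.induction_on' with
    | monomial s c =>
      have h1 := comm_chom X (D i) i 1 (hDX i) ψ hψ (MvPolynomial.monomial s 1)
      have h2 := commute_chom D (D i) (fun j => h.comm_DD i j) φ hφ c
      have h3 : MvPolynomial.monomial (s - Finsupp.single i 1) (1 * (s i : K)) =
          (s i : K) • MvPolynomial.monomial (s - Finsupp.single i 1) (1 : K) := by
        rw [MvPolynomial.smul_monomial, smul_eq_mul, mul_one, one_mul]
      rw [hΦ, ← mul_assoc, h2, mul_assoc, h1, MvPolynomial.C_1, one_mul, mul_add, ← mul_assoc,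
        MvPolynomial.pderiv_monomial, MvPolynomial.pderiv_monomial, hΦ, h3, map_smul, map_mul,
        map_natCast, Algebra.smul_def, map_natCast, mul_assoc (φ c) ((s i : ℕ) : A)]
    | add f g hf hg =>
      simp only [map_add, mul_add, add_mul, hf, hg]
      abel
  have hΦinj : ∀ f, Φ f = 0 → f = 0 := by
    intro f hf
    by_contra hf0
    obtain ⟨c, hc, hc0⟩ := weyl_exists_const {f | Φ f = 0} (fun i f hf => by
      have hf' : Φ f = 0 := hf
      have h1 := hder i f
      rw [hf', mul_zero, zero_mul, zero_add] at h1
      exact h1.symm) f.totalDegree f le_rfl hf hf0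
    have h3 : Φ (MvPolynomial.C c) = 0 := hc0
    rw [MvPolynomial.C_apply, hΦ] at h3
    have h4 : ψ (MvPolynomial.monomial 0 1) = 1 := map_one ψ
    rw [h4, mul_one] at h3
    exact hc (hφinj c h3)
  let w : (Fin n → ℕ) → A := fun α =>
    ψ (MvPolynomial.monomial (Finsupp.equivFunOnFinite.symm α) 1)
  have hw : ∀ i α, X i * w α = w (α + Pi.single i 1) := by
    intro i α
    have : Finsupp.equivFunOnFinite.symm (α + Pi.single i 1) =
        Finsupp.single i 1 + Finsupp.equivFunOnFinite.symm α := by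
      ext j; simp [Finsupp.single_apply, Pi.single_apply, add_comm, eq_comm]
    simp only [w]
    rw [← hψ, ← map_mul, this, MvPolynomial.X, MvPolynomial.monomial_mul, one_mul]
  have hTT : ∀ (S : Set (Fin n → ℕ)) (a : A), a ∈ TT φ w S →
      ∃ f, Φ f = a ∧ ∀ s : Fin n →₀ ℕ, ⇑s ∉ S → MvPolynomial.coeff s f = 0 := by
    intro S a ha
    induction ha using Submodule.span_induction with
    | mem a h =>
      obtain ⟨q, β, hβ, rfl⟩ := h
      refine ⟨MvPolynomial.monomial (Finsupp.equivFunOnFinite.symm β) q, hΦ _ _, ?_⟩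
      intro s hs
      rw [MvPolynomial.coeff_monomial, if_neg]
      rintro rfl
      exact hs (by simpa using hβ)
    | zero => exact ⟨0, map_zero _, by simp⟩
    | add a b _ _ ha hb =>
      obtain ⟨f, rfl, hf⟩ := ha
      obtain ⟨g, rfl, hg⟩ := hb
      exact ⟨f + g, map_add _ _ _, fun s hs => by rw [MvPolynomial.coeff_add, hf s hs, hg s hs, add_zero]⟩
    | smul c a _ ha =>
      obtain ⟨f, rfl, hf⟩ := ha
      refine ⟨(MvPolynomial.C c : MvPolynomial (Fin n) K) • f, ?_, fun s hs => by
        rw [MvPolynomial.coeff_smul, hf s hs, smul_zero]⟩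
      have h2 : φ (MvPolynomial.C c) = algebraMap K A c := φ.commutes c
      rw [map_smul, hsm, h2, ← Algebra.smul_def]
  refine le_of_devLE_uset n m (devLE_strictMono m
    (fun U : USet (Fin n → ℕ) => Submodule.span A (w '' U.1)) ?_ hm)
  intro U V hUV
  refine lt_of_le_of_ne (Submodule.span_mono (Set.image_mono hUV.le)) ?_
  intro he
  apply hUV.not_ge
  intro β hβ
  have h1 : w β ∈ Submodule.span A (w '' U.1) := by
    have he' : Submodule.span A (w '' U.1) = Submodule.span A (w '' V.1) := he
    rw [he']
    exact Submodule.subset_span ⟨β, hβ, rfl⟩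
  have h2 : w β ∈ TT φ w U.1 := by
    generalize w β = b at h1
    induction h1 using Submodule.span_induction with
    | mem a h =>
      obtain ⟨γ, hγ, rfl⟩ := h
      exact Submodule.subset_span ⟨1, γ, hγ, by rw [map_one, one_mul]⟩
    | zero => exact zero_mem _
    | add a b _ _ ha hb => exact add_mem ha hb
    | smul c a _ ha =>
      exact TT_left φ w D X (fun _ => -1) hXD hφ hw U.2
        (by rw [Set.union_comm]; exact h.gen) c ha
  obtain ⟨f, hf, hfs⟩ := hTT _ _ h2
  by_contra hβU
  have h3 : f - MvPolynomial.monomial (Finsupp.equivFunOnFinite.symm β) 1 = 0 := by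
    apply hΦinj
    rw [map_sub, hf, hΦ1, sub_self]
  have h4 := hfs (Finsupp.equivFunOnFinite.symm β) (by simpa using hβU)
  rw [sub_eq_zero.1 h3, MvPolynomial.coeff_monomial, if_pos rfl] at h4
  exact one_ne_zero h4

/-- **Rentschler–Gabriel.** If `char K = 0` then the left Krull dimension (in the sense
of Rentschler and Gabriel, i.e. the deviation of the poset of left ideals) of the `n`-th
Weyl algebra `A_n` is `n`. -/
theorem kdim_weyl_eq
    (K A : Type) [Field K] [CharZero K] [Ring A] [Algebra K A]
    (n : ℕ) (X D : Fin n → A) (h : IsWeylAlgebra K A n X D) :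
    kdimE A A = (n : EReal) := by

  have := h.nontrivial
  unfold kdimE
  rw [if_neg (not_subsingleton A)]
  refine le_antisymm (sInf_le ⟨n, rfl, weyl_upper K A n X D h⟩) (le_sInf ?_)
  rintro x ⟨m, rfl, hm⟩
  exact_mod_cast weyl_lower K A n X D h m hm

end
end

section
/- Let K be a field of characteristic zero and let B be a finitely generated regular commutative K-algebra which is a domain of finite Krull dimension, with ring of differential operators Δ = D(B) filtered by a standard finite-dimensional filtration {Δ_k}, and let {Δ^e_i} be the induced standard filtration of the enveloping algebra Δ^e = Δ ⊗ Δ^op. Then there exist natural numbers a and b such that for every k and every 0 ≠ d ∈ Δ_k there exists an element w ∈ Δ^e_{ak+b} satisfying w·d = 1 (where Δ^e acts on Δ by (x ⊗ y)·d = x d y). -/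
/- Common definitions: degree of a function, standard finite-dimensional filtrations,
Gelfand-Kirillov dimension, return functions and filter dimensions (V. Bavula,
"Filter dimension"), and the Rentschler–Gabriel (left) Krull dimension via deviation. -/

open Filter

noncomputable section

/-- The order filtration `{D_i(B)}` on differential operators: `D_0(B) = End_B(B) ≅ B`
(multiplication operators) and `D_{i+1}(B) = { u ∈ End_K(B) | [u, r] ∈ D_i(B) ∀ r ∈ B }`. -/
def diffOpsLE (K B : Type) [Field K] [CommRing B] [Algebra K B] :
    ℕ → Submodule K (Module.End K B)
  | 0 => LinearMap.range (Algebra.lmul K B).toLinearMap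
  | n + 1 => ⨅ r : B, Submodule.comap
      (LinearMap.mulRight K ((Algebra.lmul K B) r) - LinearMap.mulLeft K ((Algebra.lmul K B) r))
      (diffOpsLE K B n)

/-- The ring `D(B) = ⋃_i D_i(B)` of `K`-linear differential operators on `B` (the union
is closed under the operations, so it coincides with the subalgebra it generates). -/
def diffOps (K B : Type) [Field K] [CommRing B] [Algebra K B] :
    Subalgebra K (Module.End K B) :=
  Algebra.adjoin K (⋃ i, (diffOpsLE K B i : Set (Module.End K B)))

section smoothpart
open KaehlerDifferential

theorem dsimple_euler {K B : Type} [Field K] [CharZero K] [CommRing B] [Algebra K B]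
    [Algebra.Smooth K B] (m : Ideal B) [m.IsMaximal] :
    ∃ F : Ω[B⁄K] →ₗ[B] B, (∀ w, F w ∈ m) ∧ ∀ y ∈ m, F (D K B y) - y ∈ m ^ 2 := by
  let _ := Ideal.Quotient.field m
  have hle : m ^ 2 ≤ m := Ideal.pow_le_self (by norm_num)
  let g : B ⧸ (m ^ 2) →ₐ[K] B ⧸ m := Ideal.Quotient.factorₐ K hle
  have hgmk : ∀ b, g (Ideal.Quotient.mk _ b) = Ideal.Quotient.mk m b := fun b => rfl
  have hg : Function.Surjective g := Ideal.Quotient.factor_surjective hle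
  have hker : ∀ x y : B ⧸ (m ^ 2), g x = 0 → g y = 0 → x * y = 0 := by
    intro x y hx hy
    obtain ⟨x, rfl⟩ := Ideal.Quotient.mk_surjective x
    obtain ⟨y, rfl⟩ := Ideal.Quotient.mk_surjective y
    rw [hgmk, Ideal.Quotient.eq_zero_iff_mem] at hx hy
    rw [← map_mul, Ideal.Quotient.eq_zero_iff_mem, pow_two]
    exact Ideal.mul_mem_mul hx hy
  have hnil : IsNilpotent (RingHom.ker (g : B ⧸ (m ^ 2) →+* B ⧸ m)) := by
    refine ⟨2, ?_⟩
    refine (pow_two (RingHom.ker (g : B ⧸ (m ^ 2) →+* B ⧸ m))).trans ?_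
    rw [Ideal.zero_eq_bot, eq_bot_iff, Ideal.mul_le]
    intro x hx y hy
    exact hker x y hx hy
  let σ : B ⧸ m →ₐ[K] B ⧸ (m ^ 2) :=
    Algebra.FormallySmooth.liftOfSurjective (AlgHom.id K _) g hg hnil
  have hσ : ∀ x, g (σ x) = x := fun x =>
    Algebra.FormallySmooth.liftOfSurjective_apply (AlgHom.id K _) g hg hnil x
  let q : B →ₐ[K] B ⧸ (m ^ 2) := Ideal.Quotient.mkₐ K _
  let τ : B →ₐ[K] B ⧸ (m ^ 2) := σ.comp (Ideal.Quotient.mkₐ K m)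
  have hgτ : ∀ b, g (q b - τ b) = 0 := by
    intro b
    rw [map_sub]
    change Ideal.Quotient.mk m b - g (σ (Ideal.Quotient.mk m b)) = 0
    rw [hσ, sub_self]
  have hsm : ∀ (a : B) (x : B ⧸ (m ^ 2)), a • x = q a * x := fun a x => Algebra.smul_def a x
  let d : Derivation K B (B ⧸ (m ^ 2)) := Derivation.mk' (q.toLinearMap - τ.toLinearMap) (by
    intro a b
    simp only [LinearMap.sub_apply, AlgHom.toLinearMap_apply, map_mul, hsm]
    have := hker _ _ (hgτ a) (hgτ b)
    linear_combination - this)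
  obtain ⟨F, hF⟩ := Module.projective_lifting_property (Ideal.Quotient.mkₐ B (m ^ 2)).toLinearMap
    d.liftKaehlerDifferential Ideal.Quotient.mk_surjective
  have hFD : ∀ b, Ideal.Quotient.mk (m ^ 2) (F (D K B b)) = q b - τ b := by
    intro b
    have := LinearMap.congr_fun hF (D K B b)
    rw [Derivation.liftKaehlerDifferential_comp_D] at this
    exact this
  refine ⟨F, ?_, ?_⟩
  · intro w
    have hw : w ∈ Submodule.span B (Set.range (D K B)) := by
      rw [KaehlerDifferential.span_range_derivation]; trivial
    induction hw using Submodule.span_induction with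
    | mem x h =>
      obtain ⟨b, rfl⟩ := h
      have := hgτ b
      rw [← hFD, hgmk, Ideal.Quotient.eq_zero_iff_mem] at this
      exact this
    | zero => simp
    | add x y _ _ hx hy => rw [map_add]; exact m.add_mem hx hy
    | smul a x _ hx => rw [map_smul]; exact m.mul_mem_left _ hx
  · intro y hy
    rw [← Ideal.Quotient.eq_zero_iff_mem, map_sub, hFD]
    have : τ y = 0 := by
      change σ (Ideal.Quotient.mk m y) = 0
      rw [Ideal.Quotient.eq_zero_iff_mem.mpr hy, map_zero]
    rw [this]
    change (Ideal.Quotient.mk _ y) - 0 - Ideal.Quotient.mk _ y = 0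
    ring

theorem dsimple {K B : Type} [Field K] [CharZero K] [CommRing B] [Algebra K B] [IsDomain B]
    [Algebra.Smooth K B] (I : Ideal B) (hI : I ≠ ⊥)
    (hd : ∀ δ : Derivation K B B, ∀ f ∈ I, δ f ∈ I) : I = ⊤ := by
  by_contra hne
  obtain ⟨m, hm, hIm⟩ := Ideal.exists_le_maximal I hne
  obtain ⟨F, hF1, hF2⟩ := dsimple_euler (K := K) m
  have : IsNoetherianRing B := Algebra.FiniteType.isNoetherianRing K B
  obtain ⟨s, hs⟩ := Module.projective_def.mp
    (inferInstance : Module.Projective B Ω[B⁄K])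
  let E : Derivation K B B := F.compDer (D K B)
  have hE : ∀ y ∈ m, E y - y ∈ m ^ 2 := hF2
  have hEm : ∀ y, E y ∈ m := fun y => hF1 _
  -- Euler property
  have euler : ∀ n : ℕ, ∀ f ∈ m ^ n, E f - (n : B) * f ∈ m ^ (n + 1) := by
    intro n
    induction n with
    | zero => intro f _; simpa using hEm f
    | succ n ih =>
      intro f hf
      rw [pow_succ] at hf
      induction hf using Submodule.mul_induction_on' with
      | mem_mul_mem x hx y hy =>
        have h1 := ih x hx
        have h2 := hE y hy
        have e : E (x * y) - ((n + 1 : ℕ) : B) * (x * y)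
            = (E x - n * x) * y + x * (E y - y) := by
          rw [Derivation.leibniz]; push_cast; simp only [smul_eq_mul]; ring
        rw [e]
        refine Ideal.add_mem _ ?_ ?_
        · rw [pow_succ]; exact Ideal.mul_mem_mul h1 hy
        · rw [add_assoc, pow_add]; exact Ideal.mul_mem_mul hx h2
      | add x _ y _ hx hy =>
        have e : E (x + y) - ((n + 1 : ℕ) : B) * (x + y)
            = (E x - ((n + 1 : ℕ) : B) * x) + (E y - ((n + 1 : ℕ) : B) * y) := by
          rw [map_add]; ring
        rw [e]; exact Ideal.add_mem _ hx hy
  have hEI : ∀ n, I ≤ m ^ n → ∀ f ∈ I, E f ∈ m ^ (n + 1) := by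
    intro n hn f hf
    have e : E f = (s (D K B f)).sum (fun i c => c * F i) := by
      have := hs (D K B f)
      change F (D K B f) = _
      conv_lhs => rw [← this]
      rw [Finsupp.linearCombination_apply, Finsupp.sum, Finsupp.sum, map_sum]
      simp
    rw [e]
    refine Ideal.sum_mem _ fun i _ => ?_
    rw [pow_succ]
    refine Ideal.mul_mem_mul (hn ?_) (hF1 i)
    exact hd (((Finsupp.lapply i).comp s).compDer (D K B)) f hf
  have key : ∀ n, I ≤ m ^ n := by
    intro n
    induction n with
    | zero => simp
    | succ n ih =>
      rcases Nat.eq_zero_or_pos n with rfl | hn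
      · simpa using hIm
      intro f hf
      have h3 : (n : B) * f ∈ m ^ (n + 1) := by
        have := Ideal.sub_mem _ (hEI n ih f hf) (euler n f (ih hf))
        simpa using this
      have h4 : f = algebraMap K B ((n : K)⁻¹) * ((n : B) * f) := by
        have : (n : B) = algebraMap K B n := by simp
        rw [this, ← mul_assoc, ← map_mul, inv_mul_cancel₀ (by exact_mod_cast hn.ne'), map_one,
          one_mul]
      rw [h4]
      exact Ideal.mul_mem_left _ _ h3
  apply hI
  rw [eq_bot_iff, ← Ideal.iInf_pow_eq_bot_of_isDomain m hm.ne_top]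
  exact le_iInf key

end smoothpart

section derpart
open KaehlerDifferential TensorProduct

/-- extension of the partial derivative to the fraction field -/
theorem exists_der_frac {K B : Type} [Field K] [CharZero K] [CommRing B] [Algebra K B] [IsDomain B]
    (n : ℕ) (φ : MvPolynomial (Fin n) K →ₐ[K] B) (hinj : Function.Injective φ)
    (hfin : φ.Finite) (i : Fin n) :
    ∃ d : Derivation K B (FractionRing B),
      ∀ p, d (φ p) = algebraMap B (FractionRing B) (φ (MvPolynomial.pderiv i p)) := by
  let P := MvPolynomial (Fin n) K
  let _ : Algebra P B := φ.toRingHom.toAlgebra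
  have hst : IsScalarTower K P B := IsScalarTower.of_algebraMap_eq' φ.comp_algebraMap.symm
  have : Module.Finite P B := hfin
  have hinj' : Function.Injective (algebraMap P B) := hinj
  let Q := FractionRing P
  let L := FractionRing B
  have : FaithfulSMul P B := (faithfulSMul_iff_algebraMap_injective P B).mpr hinj'
  have : FaithfulSMul P L := by
    rw [faithfulSMul_iff_algebraMap_injective, IsScalarTower.algebraMap_eq P B L]
    exact (IsFractionRing.injective B L).comp hinj'
  let _ : Algebra Q L := FractionRing.liftAlgebra P L
  have : IsScalarTower P Q L := FractionRing.isScalarTower_liftAlgebra P L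
  have : CharZero P := charZero_of_injective_algebraMap (algebraMap K P).injective
  have : CharZero Q := charZero_of_injective_algebraMap (IsFractionRing.injective P Q)
  have : Algebra.IsAlgebraic Q L := isAlgebraic_of_isFractionRing P B Q L
  have : Algebra.IsSeparable Q L := inferInstance
  have : Algebra.FormallyEtale Q L := Algebra.FormallyEtale.of_isSeparable Q L
  have : Algebra.FormallyEtale P Q := Algebra.FormallyEtale.of_isLocalization (nonZeroDivisors P)
  have : Algebra.FormallyEtale P L := Algebra.FormallyEtale.comp P Q L
  have : IsScalarTower K P L := IsScalarTower.of_algebraMap_eq fun x => by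
    rw [IsScalarTower.algebraMap_apply P B L, ← IsScalarTower.algebraMap_apply K P B,
      ← IsScalarTower.algebraMap_apply K B L]
  let d0 : Derivation K P L :=
    (Algebra.linearMap P L).compDer (MvPolynomial.pderiv i : Derivation K P P)
  let ℓ : L ⊗[P] Ω[P⁄K] →ₗ[L] L :=
    TensorProduct.AlgebraTensorModule.lift
      ((LinearMap.toSpanSingleton L (Ω[P⁄K] →ₗ[P] L) d0.liftKaehlerDifferential))
  let d1 : Derivation K L L :=
    (ℓ ∘ₗ (tensorKaehlerEquivOfFormallyEtale K P L).symm.toLinearMap).compDer (D K L)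
  have hd1 : ∀ p : P, d1 (algebraMap P L p) = d0 p := by
    intro p
    change ℓ ((tensorKaehlerEquivOfFormallyEtale K P L).symm (D K L (algebraMap P L p))) = _
    rw [tensorKaehlerEquivOfFormallyEtale_symm_D_algebraMap]
    simp [ℓ]
  let d2 : Derivation K B L := d1.compAlgebraMap B
  refine ⟨d2, fun p => ?_⟩
  change d1 (algebraMap B L (algebraMap P B p)) = _
  rw [← IsScalarTower.algebraMap_apply P B L, hd1]
  change algebraMap P L _ = _
  rw [IsScalarTower.algebraMap_apply P B L]
  rfl

theorem exists_ders {K B : Type} [Field K] [CharZero K] [CommRing B] [Algebra K B] [IsDomain B]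
    [Algebra.FiniteType K B]
    (n : ℕ) (φ : MvPolynomial (Fin n) K →ₐ[K] B) (hinj : Function.Injective φ)
    (hfin : φ.Finite) :
    ∃ c : B, c ≠ 0 ∧ ∃ δ : Fin n → Derivation K B B, ∀ i p,
      δ i (φ p) = c * φ (MvPolynomial.pderiv i p) := by
  classical
  choose d hd using exists_der_frac n φ hinj hfin
  let L := FractionRing B
  obtain ⟨S, hS⟩ := (inferInstance : Algebra.FiniteType K B).out
  obtain ⟨⟨c, hc⟩, hcS⟩ := IsLocalization.exist_integer_multiples_of_finset (nonZeroDivisors B)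
    ((Finset.univ ×ˢ S).image (fun x : Fin n × B => d x.1 x.2))
  have hint : ∀ i b, ∃ b' : B, algebraMap B L b' = c • d i b := by
    intro i b
    have hb : b ∈ Algebra.adjoin K (S : Set B) := by rw [hS]; trivial
    induction hb using Algebra.adjoin_induction with
    | mem x hx =>
      obtain ⟨b', hb'⟩ := hcS (d i x) (Finset.mem_image.mpr ⟨(i, x), by simpa using hx, rfl⟩)
      exact ⟨b', hb'⟩
    | algebraMap r => exact ⟨0, by simp⟩
    | add x y _ _ hx hy =>
      obtain ⟨a, ha⟩ := hx
      obtain ⟨b, hb⟩ := hy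
      exact ⟨a + b, by rw [map_add, ha, hb, map_add, smul_add]⟩
    | mul x y _ _ hx hy =>
      obtain ⟨a, ha⟩ := hx
      obtain ⟨b, hb⟩ := hy
      refine ⟨x * b + y * a, ?_⟩
      rw [map_add, map_mul, map_mul, ha, hb, Derivation.leibniz, smul_add, smul_comm c x,
        smul_comm c y, Algebra.smul_def x, Algebra.smul_def y]
  choose e he using hint
  have hLinj : Function.Injective (algebraMap B L) := IsFractionRing.injective B L
  let δ : Fin n → Derivation K B B := fun i => Derivation.mk'
    { toFun := e i
      map_add' := fun x y => hLinj (by rw [map_add, he, he, he, map_add, smul_add])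
      map_smul' := fun r x => hLinj (by
        rw [RingHom.id_apply, he, Derivation.map_smul, Algebra.smul_def r (e i x), map_mul, he,
          ← IsScalarTower.algebraMap_apply K B L, ← Algebra.smul_def, smul_comm]) }
    (by
      intro a b
      apply hLinj
      simp only [LinearMap.coe_mk, AddHom.coe_mk, smul_eq_mul, map_add, map_mul, he]
      rw [Derivation.leibniz, smul_add, smul_comm c a, smul_comm c b, Algebra.smul_def a,
        Algebra.smul_def b])
  refine ⟨c, nonZeroDivisors.ne_zero hc, δ, fun i p => hLinj ?_⟩
  change algebraMap B L (e i (φ p)) = _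
  rw [he, hd, map_mul, Algebra.smul_def]

end derpart

section epart

theorem one_le_of_mem {K A : Type} [Field K] [Ring A] [Algebra K A] {W : Submodule K A}
    (h1 : (1 : A) ∈ W) : (1 : Submodule K A) ≤ W := by
  rw [Submodule.one_le]; exact h1

theorem pow_mono_of_one {K A : Type} [Field K] [Ring A] [Algebra K A] {W : Submodule K A}
    (h1 : (1 : A) ∈ W) {i j : ℕ} (h : i ≤ j) : W ^ i ≤ W ^ j :=
  pow_le_pow_right₀ (one_le_of_mem h1) h

theorem mem_pow_of_totalDegree {K B : Type} [Field K] [CommRing B] [Algebra K B]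
    {n : ℕ} (φ : MvPolynomial (Fin n) K →ₐ[K] B) (W : Submodule K B) (h1 : (1 : B) ∈ W)
    (hX : ∀ i, φ (MvPolynomial.X i) ∈ W) (p : MvPolynomial (Fin n) K) (D : ℕ)
    (hp : p.totalDegree ≤ D) : φ p ∈ W ^ D := by
  rw [p.as_sum, map_sum]
  refine Submodule.sum_mem _ fun m hm => ?_
  have hmD : (m.sum fun _ e => e) ≤ D := (MvPolynomial.le_totalDegree hm).trans hp
  refine pow_mono_of_one h1 hmD ?_
  rw [MvPolynomial.monomial_eq, ← MvPolynomial.algebraMap_eq, map_mul, AlgHom.commutes,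
    ← Algebra.smul_def]
  refine Submodule.smul_mem _ _ ?_
  rw [Finsupp.prod, Finsupp.sum, map_prod]
  generalize m.support = s
  classical
  induction s using Finset.induction_on with
  | empty =>
    rw [Finset.prod_empty, Finset.sum_empty, pow_zero]; exact Submodule.one_le.mp le_rfl
  | insert a s ha ih =>
    rw [Finset.prod_insert ha, Finset.sum_insert ha, pow_add, map_pow]
    exact Submodule.mul_mem_mul (Submodule.pow_mem_pow _ (hX a) _) ih

/-- all coefficients of total degree at most `D` -/
def CoeffLE {K : Type} [Field K] {n : ℕ} (D : ℕ) (q : Polynomial (MvPolynomial (Fin n) K)) :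
    Prop := ∀ l, (q.coeff l).totalDegree ≤ D

theorem CoeffLE.mul {K : Type} [Field K] {n D E : ℕ} {q r : Polynomial (MvPolynomial (Fin n) K)}
    (hq : CoeffLE D q) (hr : CoeffLE E r) : CoeffLE (D + E) (q * r) := by
  intro l
  rw [Polynomial.coeff_mul]
  refine MvPolynomial.totalDegree_finsetSum_le fun x _ => ?_
  exact (MvPolynomial.totalDegree_mul _ _).trans (add_le_add (hq _) (hr _))

theorem CoeffLE.sum {K : Type} [Field K] {n D : ℕ} {ι : Type} (s : Finset ι)
    (q : ι → Polynomial (MvPolynomial (Fin n) K))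
    (hq : ∀ i ∈ s, CoeffLE D (q i)) : CoeffLE D (∑ i ∈ s, q i) := by
  intro l
  rw [Polynomial.finsetSum_coeff]
  exact MvPolynomial.totalDegree_finsetSum_le fun x hx => hq x hx l

theorem CoeffLE.neg {K : Type} [Field K] {n D : ℕ}
    {q : Polynomial (MvPolynomial (Fin n) K)}
    (hq : CoeffLE D q) : CoeffLE D (-q) := by
  intro l
  rw [Polynomial.coeff_neg, MvPolynomial.totalDegree_neg]
  exact hq l

theorem CoeffLE.prod {K : Type} [Field K] {n D : ℕ} {ι : Type} (s : Finset ι)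
    (q : ι → Polynomial (MvPolynomial (Fin n) K))
    (hq : ∀ i ∈ s, CoeffLE D (q i)) : CoeffLE (s.card * D) (∏ i ∈ s, q i) := by
  classical
  induction s using Finset.induction_on with
  | empty =>
    intro l
    rw [Finset.prod_empty, Polynomial.coeff_one]
    split_ifs <;> simp
  | insert a s ha ih =>
    rw [Finset.prod_insert ha, Finset.card_insert_of_notMem ha, add_mul, one_mul, add_comm]
    exact CoeffLE.mul (hq a (by simp)) (ih fun i hi => hq i (by simp [hi]))

theorem coeffLE_charpoly {K : Type} [Field K] {n D : ℕ} {ι : Type} [Fintype ι] [DecidableEq ι]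
    (M : Matrix ι ι (MvPolynomial (Fin n) K)) (hM : ∀ i j, (M i j).totalDegree ≤ D) :
    CoeffLE (Fintype.card ι * D) M.charpoly := by
  have hent : ∀ i j, CoeffLE D (M.charmatrix i j) := by
    intro i j l
    rw [Matrix.charmatrix_apply, Polynomial.coeff_sub, Polynomial.coeff_C]
    refine (MvPolynomial.totalDegree_sub _ _).trans (max_le ?_ ?_)
    · rw [Matrix.diagonal_apply]
      split_ifs
      · rw [Polynomial.coeff_X]; split_ifs <;> simp
      · simp
    · split_ifs
      · exact hM i j
      · simp
  rw [Matrix.charpoly, Matrix.det_apply]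
  refine CoeffLE.sum _ _ fun σ _ => ?_
  have := CoeffLE.prod Finset.univ (fun i => M.charmatrix (σ i) i) fun i _ => hent _ _
  rcases Int.units_eq_one_or (Equiv.Perm.sign σ) with h | h
  · rw [h, one_smul]; exact this
  · rw [h, Units.neg_smul, one_smul]; exact this.neg

theorem exists_mult {K B : Type} [Field K] [CommRing B] [Algebra K B] [IsDomain B]
    (n : ℕ) (φ : MvPolynomial (Fin n) K →ₐ[K] B)
    (hfin : φ.Finite) :
    ∃ S : Finset B, (1 : B) ∈ S ∧ Algebra.adjoin K (S : Set B) = ⊤ ∧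
      ∃ C : ℕ, ∀ t, ∀ f ∈ (Submodule.span K (S : Set B)) ^ t, f ≠ 0 →
        ∃ p : MvPolynomial (Fin n) K, p ≠ 0 ∧ p.totalDegree ≤ C * t ∧
          ∃ h ∈ (Submodule.span K (S : Set B)) ^ (C * t), φ p = h * f := by
  classical
  let P := MvPolynomial (Fin n) K
  let _ : Algebra P B := φ.toRingHom.toAlgebra
  have hst : IsScalarTower K P B := IsScalarTower.of_algebraMap_eq' φ.comp_algebraMap.symm
  have : Module.Finite P B := hfin
  have hsm : ∀ (p : P) (b : B), p • b = φ p * b := fun p b => rfl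
  obtain ⟨r, e, he⟩ := Module.Finite.exists_fin (R := P) (M := B)
  let S : Finset B := {1} ∪ Finset.univ.image (fun i => φ (MvPolynomial.X i)) ∪ Finset.univ.image e
  have h1S : (1 : B) ∈ S := by simp [S]
  let W := Submodule.span K (S : Set B)
  have h1 : (1 : B) ∈ W := Submodule.subset_span h1S
  have hX : ∀ i, φ (MvPolynomial.X i) ∈ W := fun i => Submodule.subset_span (by simp [S])
  refine ⟨S, h1S, ?_, ?_⟩
  · have hφ : ∀ p : P, φ p ∈ Algebra.adjoin K (S : Set B) := by
      intro p
      induction p using MvPolynomial.induction_on with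
      | C a =>
        rw [← MvPolynomial.algebraMap_eq, AlgHom.commutes]; exact Subalgebra.algebraMap_mem _ _
      | add p q hp hq => rw [map_add]; exact Subalgebra.add_mem _ hp hq
      | mul_X p i hp =>
        rw [map_mul]
        exact Subalgebra.mul_mem _ hp (Algebra.subset_adjoin (by simp [S]))
    rw [eq_top_iff]
    intro b _
    have hb : b ∈ Submodule.span P (Set.range e) := by rw [he]; trivial
    induction hb using Submodule.span_induction with
    | mem x hx =>
      obtain ⟨i, rfl⟩ := hx
      exact Algebra.subset_adjoin (by simp [S])
    | zero => exact Subalgebra.zero_mem _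
    | add x y _ _ hx hy => exact Subalgebra.add_mem _ (hx trivial) (hy trivial)
    | smul p x _ hx =>
      rw [hsm]
      refine Subalgebra.mul_mem _ ?_ (hx trivial)
      exact hφ p
  -- matrices of bounded degree
  let lm : B → Module.End P B := fun b => Algebra.lmul P B b
  have hex : ∀ b : B, ∃ M : Matrix (Fin r) (Fin r) P, M.Represents e (lm b) := by
    intro b
    obtain ⟨M, hM⟩ := Matrix.isRepresentation.toEnd_surjective P e he (lm b)
    exact ⟨M.1, hM ▸ Matrix.isRepresentation.toEnd_represents P e he M⟩
  choose M hM using hex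
  let s : ℕ := S.sup fun b => Finset.univ.sup fun i => Finset.univ.sup fun j =>
    (M b i j).totalDegree
  have hs : ∀ b ∈ S, ∀ i j, (M b i j).totalDegree ≤ s := by
    intro b hb i j
    refine le_trans ?_ (Finset.le_sup (f := fun b => Finset.univ.sup fun i => Finset.univ.sup
      fun j => (M b i j).totalDegree) hb)
    refine le_trans ?_ (Finset.le_sup (f := fun i => Finset.univ.sup
      fun j => (M b i j).totalDegree) (Finset.mem_univ i))
    exact Finset.le_sup (f := fun j => (M b i j).totalDegree) (Finset.mem_univ j)
  have hW : ∀ b ∈ W, ∃ A : Matrix (Fin r) (Fin r) P, A.Represents e (lm b) ∧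
      ∀ i j, (A i j).totalDegree ≤ s := by
    intro b hb
    induction hb using Submodule.span_induction with
    | mem x hx => exact ⟨M x, hM x, hs x hx⟩
    | zero => exact ⟨0, by simpa [lm] using Matrix.Represents.zero, by simp⟩
    | add x y _ _ hx hy =>
      obtain ⟨A, hA, hA'⟩ := hx
      obtain ⟨A2, hA2, hA2'⟩ := hy
      refine ⟨A + A2, by simpa [lm] using hA.add hA2, fun i j => ?_⟩
      exact (MvPolynomial.totalDegree_add _ _).trans (max_le (hA' i j) (hA2' i j))
    | smul a x _ hx =>
      obtain ⟨A, hA, hA'⟩ := hx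
      refine ⟨(MvPolynomial.C a : P) • A, ?_, fun i j => ?_⟩
      · have := hA.smul (MvPolynomial.C a : P)
        convert this using 1
        ext y
        change (a • x) * y = (MvPolynomial.C a : P) • (x * y)
        rw [hsm, ← MvPolynomial.algebraMap_eq, AlgHom.commutes, Algebra.smul_def, mul_assoc]
      · refine (MvPolynomial.totalDegree_mul _ _).trans ?_
        simpa using hA' i j
  have hWt : ∀ t, ∀ b ∈ W ^ t, ∃ A : Matrix (Fin r) (Fin r) P, A.Represents e (lm b) ∧
      ∀ i j, (A i j).totalDegree ≤ s * t := by
    intro t b hb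
    induction hb using Submodule.pow_induction_on_left' with
    | algebraMap a =>
      refine ⟨algebraMap P _ (MvPolynomial.C a), ?_, fun i j => ?_⟩
      · have := Matrix.Represents.algebraMap (b := e) (MvPolynomial.C a : P)
        convert this using 1
        ext y
        change algebraMap K B a * y = (MvPolynomial.C a : P) • y
        rw [hsm, ← MvPolynomial.algebraMap_eq, AlgHom.commutes]
      · rw [Matrix.algebraMap_matrix_apply]
        split_ifs
        · exact (MvPolynomial.totalDegree_C a).le.trans (Nat.zero_le _)
        · simp
    | add x y i _ _ hx hy =>
      obtain ⟨A, hA, hA'⟩ := hx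
      obtain ⟨A2, hA2, hA2'⟩ := hy
      refine ⟨A + A2, by simpa [lm] using hA.add hA2, fun i j => ?_⟩
      exact (MvPolynomial.totalDegree_add _ _).trans (max_le (hA' i j) (hA2' i j))
    | mem_mul m hm i x _ hx =>
      obtain ⟨A, hA, hA'⟩ := hW m hm
      obtain ⟨A2, hA2, hA2'⟩ := hx
      have hmx : lm (m * x) = lm m * lm x := map_mul (Algebra.lmul P B) _ _
      refine ⟨A * A2, hmx ▸ hA.mul hA2, fun i' j' => ?_⟩
      rw [Matrix.mul_apply]
      refine MvPolynomial.totalDegree_finsetSum_le fun k _ => ?_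
      refine (MvPolynomial.totalDegree_mul _ _).trans ?_
      have := hA' i' k
      have := hA2' k j'
      rw [Nat.succ_eq_add_one, mul_add, mul_one]; omega
  refine ⟨r * s + r, fun t f hf hf0 => ?_⟩
  obtain ⟨A, hA, hA'⟩ := hWt t f hf
  have hch := coeffLE_charpoly A hA'
  rw [Fintype.card_fin] at hch
  have hq0 : Polynomial.aeval f A.charpoly = 0 := by
    have h2 : Polynomial.aeval (lm f) A.charpoly = 0 := by
      let A0 : Matrix.isRepresentation P e := ⟨A, _, hA⟩
      rw [← Matrix.isRepresentation.eq_toEnd_of_represents P e he A0 hA,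
        Polynomial.aeval_algHom_apply,
        ← map_zero (Matrix.isRepresentation.toEnd P e he)]
      congr 1
      ext1
      rw [Polynomial.aeval_subalgebra_coe, Matrix.aeval_self_charpoly, Subalgebra.coe_zero]
    have h3 : Polynomial.aeval (lm f) A.charpoly = lm (Polynomial.aeval f A.charpoly) :=
      Polynomial.aeval_algHom_apply (Algebra.lmul P B) f _
    rw [h3] at h2
    have := LinearMap.congr_fun h2 1
    simpa [lm] using this
  -- strip off powers of X
  have hne : A.charpoly ≠ 0 := A.charpoly_monic.ne_zero
  obtain ⟨q, hqX, hqn⟩ : ∃ q, A.charpoly = q * Polynomial.X ^ A.charpoly.natTrailingDegree ∧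
      q.coeff 0 ≠ 0 := by
    have hdvd : Polynomial.X ^ A.charpoly.natTrailingDegree ∣ A.charpoly :=
      Polynomial.X_pow_dvd_iff.mpr fun d hd =>
        Polynomial.coeff_eq_zero_of_lt_natTrailingDegree hd
    obtain ⟨q, hq⟩ := hdvd
    refine ⟨q, by rw [mul_comm]; exact hq, ?_⟩
    have h5 : A.charpoly.coeff A.charpoly.natTrailingDegree ≠ 0 := by
      have := Polynomial.trailingCoeff_nonzero_iff_nonzero.mpr hne
      exact this
    rw [hq] at h5
    have h6 := Polynomial.coeff_X_pow_mul q A.charpoly.natTrailingDegree 0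
    rw [← hq, zero_add] at h6
    rw [← h6, ]
    rw [← hq] at h5
    exact h5
  set k0 := A.charpoly.natTrailingDegree with hk0
  have hqc : ∀ l, q.coeff l = A.charpoly.coeff (l + k0) := by
    intro l
    rw [hqX, Polynomial.coeff_mul_X_pow]
  have hqdeg : q.natDegree ≤ r := by
    rw [Polynomial.natDegree_le_iff_coeff_eq_zero]
    intro N hN
    rw [hqc]
    apply Polynomial.coeff_eq_zero_of_natDegree_lt
    rw [A.charpoly_natDegree_eq_dim, Fintype.card_fin]
    omega
  have hqf : Polynomial.aeval f q = 0 := by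
    rw [hqX, map_mul, map_pow, Polynomial.aeval_X] at hq0
    exact (mul_eq_zero.mp hq0).resolve_right (pow_ne_zero _ hf0)
  refine ⟨q.coeff 0, hqn, ?_, - Polynomial.aeval f q.divX, ?_, ?_⟩
  · rw [hqc]
    refine (hch _).trans ?_
    rw [add_mul, mul_assoc]; exact Nat.le_add_right _ _
  · refine Submodule.neg_mem _ ?_
    rw [Polynomial.aeval_eq_sum_range]
    refine Submodule.sum_mem _ fun l hl => ?_
    rw [hsm, Polynomial.coeff_divX, hqc, add_mul, pow_add, mul_assoc]
    have hlr : l ≤ r := by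
      have := Finset.mem_range.mp hl
      have := Polynomial.natDegree_divX_le (p := q)
      omega
    refine Submodule.mul_mem_mul (mem_pow_of_totalDegree φ W h1 hX _ _ (hch _)) ?_
    refine pow_mono_of_one h1 (Nat.mul_le_mul_right t hlr) ?_
    rw [mul_comm, pow_mul]
    exact Submodule.pow_mem_pow _ hf _
  · have h7 := Polynomial.divX_mul_X_add q
    rw [← h7, map_add, map_mul, Polynomial.aeval_X, Polynomial.aeval_C] at hqf
    have : algebraMap P B (q.coeff 0) = φ (q.coeff 0) := rfl
    rw [this] at hqf
    linear_combination hqf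

end epart

/-- the elements of `A` reachable from `d` at cost at most `n` -/
def Reach {K A : Type} [Field K] [Ring A] [Algebra K A] (V : Submodule K A) (d : A) (n : ℕ) :
    Submodule K A :=
  Submodule.span K {z : A | ∃ j l : ℕ, j + l ≤ n ∧
          ∃ x ∈ (V ^ j : Submodule K A), ∃ y ∈ (V ^ l : Submodule K A), z = x * d * y}

section reach
variable {K A : Type} [Field K] [Ring A] [Algebra K A] {V : Submodule K A}

theorem one_mem_pow0 (V : Submodule K A) : (1 : A) ∈ V ^ 0 := by
  rw [pow_zero]; exact Submodule.one_le.mp le_rfl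

theorem reach_self (d : A) (n : ℕ) : d ∈ Reach V d n :=
  Submodule.subset_span ⟨0, 0, Nat.zero_le _, 1, one_mem_pow0 V, 1, one_mem_pow0 V, by simp⟩

theorem reach_mono (d : A) {n m : ℕ} (h : n ≤ m) : Reach V d n ≤ Reach V d m := by
  refine Submodule.span_mono ?_
  rintro z ⟨j, l, hjl, hz⟩
  exact ⟨j, l, hjl.trans h, hz⟩

theorem reach_sandwich {d u x y : A} {n j l : ℕ} (hu : u ∈ Reach V d n) (hx : x ∈ V ^ j)
    (hy : y ∈ V ^ l) : x * u * y ∈ Reach V d (n + (j + l)) := by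
  induction hu using Submodule.span_induction with
  | mem z hz =>
    obtain ⟨j', l', h, a, ha, b, hb, rfl⟩ := hz
    refine Submodule.subset_span ⟨j + j', l' + l, by omega, x * a, ?_, b * y, ?_, ?_⟩
    · rw [pow_add]; exact Submodule.mul_mem_mul hx ha
    · rw [pow_add]; exact Submodule.mul_mem_mul hb hy
    · simp only [mul_assoc]
  | zero => simp
  | add a b _ _ ha hb => rw [mul_add, add_mul]; exact Submodule.add_mem _ ha hb
  | smul a b _ hb =>
    rw [mul_smul_comm, smul_mul_assoc]; exact Submodule.smul_mem _ _ hb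

theorem reach_mul_left {d u z : A} {n s : ℕ} (hu : u ∈ Reach V d n) (hz : z ∈ V ^ s) :
    z * u ∈ Reach V d (n + s) := by
  simpa using reach_sandwich hu hz (one_mem_pow0 V)

theorem reach_mul_right {d u z : A} {n s : ℕ} (hu : u ∈ Reach V d n) (hz : z ∈ V ^ s) :
    u * z ∈ Reach V d (n + s) := by
  simpa using reach_sandwich hu (one_mem_pow0 V) hz

theorem reach_trans {d u v : A} {n m : ℕ} (hu : u ∈ Reach V d n) (hv : v ∈ Reach V u m) :
    v ∈ Reach V d (n + m) := by
  induction hv using Submodule.span_induction with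
  | mem z hz =>
    obtain ⟨j, l, h, x, hx, y, hy, rfl⟩ := hz
    exact reach_mono d (by omega) (reach_sandwich hu hx hy)
  | zero => exact Submodule.zero_mem _
  | add a b _ _ ha hb => exact Submodule.add_mem _ ha hb
  | smul a b _ hb => exact Submodule.smul_mem _ _ hb

theorem reach_le_pow (h1 : (1 : A) ∈ V) {d : A} {k n : ℕ} (hd : d ∈ V ^ k) :
    Reach V d n ≤ V ^ (n + k) := by
  refine Submodule.span_le.mpr ?_
  rintro z ⟨j, l, h, x, hx, y, hy, rfl⟩
  have : x * d * y ∈ V ^ (j + k + l) := by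
    rw [pow_add, pow_add]
    exact Submodule.mul_mem_mul (Submodule.mul_mem_mul hx hd) hy
  exact pow_mono_of_one h1 (by omega) this

theorem exists_mem_pow (h1 : (1 : A) ∈ V) (hgen : Algebra.adjoin K (V : Set A) = ⊤) (z : A) :
    ∃ s, z ∈ V ^ s := by
  have hz : z ∈ Algebra.adjoin K (V : Set A) := by rw [hgen]; trivial
  induction hz using Algebra.adjoin_induction with
  | mem x hx => exact ⟨1, by simpa using hx⟩
  | algebraMap r => exact ⟨0, by rw [pow_zero]; exact Submodule.algebraMap_mem r⟩
  | add x y _ _ hx hy =>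
    obtain ⟨s, hs⟩ := hx
    obtain ⟨t, ht⟩ := hy
    exact ⟨max s t, Submodule.add_mem _ (pow_mono_of_one h1 (le_max_left _ _) hs)
      (pow_mono_of_one h1 (le_max_right _ _) ht)⟩
  | mul x y _ _ hx hy =>
    obtain ⟨s, hs⟩ := hx
    obtain ⟨t, ht⟩ := hy
    exact ⟨s + t, by rw [pow_add]; exact Submodule.mul_mem_mul hs ht⟩

end reach

section good
variable {K A B : Type} [Field K] [CharZero K] [Ring A] [Algebra K A] [CommRing B] [Algebra K B]
  {V : Submodule K A} (ι : B →ₐ[K] A)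

theorem reach_bmul {d : A} {a b : B} {n s : ℕ} (hb : ι b ∈ Reach V d n) (ha : ι a ∈ V ^ s) :
    ι (a * b) ∈ Reach V d (n + s) := by
  rw [map_mul]; exact reach_mul_left hb ha

theorem reach_der {d z : A} {δ : Derivation K B B} (hz : ∀ b, z * ι b = ι b * z + ι (δ b))
    {b : B} {n s : ℕ} (hb : ι b ∈ Reach V d n) (hzs : z ∈ V ^ s) :
    ι (δ b) ∈ Reach V d (n + s) := by
  have : ι (δ b) = z * ι b - ι b * z := by rw [hz]; abel
  rw [this]
  exact Submodule.sub_mem _ (reach_mul_left hb hzs) (reach_mul_right hb hzs)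

theorem map_pow_cost {a : B} {s : ℕ} (ha : ι a ∈ V ^ s) (i : ℕ) : ι (a ^ i) ∈ V ^ (s * i) := by
  rw [map_pow, pow_mul]; exact Submodule.pow_mem_pow _ ha _

theorem nat_cancel {R : Submodule K A} {b : B} {n : ℕ} (hn : n ≠ 0) (h : ι ((n : B) * b) ∈ R) :
    ι b ∈ R := by
  have : ι b = (n : K)⁻¹ • ι ((n : B) * b) := by
    rw [← map_smul, Algebra.smul_def, ← mul_assoc, ← map_natCast (algebraMap K B), ← map_mul,
      inv_mul_cancel₀ (by exact_mod_cast hn), map_one, one_mul]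
  rw [this]; exact Submodule.smul_mem _ _ h

/-- `g` is good: a linear power of it is reachable at linear cost from all `f` -/
def Good (V : Submodule K A) (ι : B →ₐ[K] A) (W : Submodule K B) (g : B) : Prop :=
  ∃ N C : ℕ, ∀ t, ∀ f ∈ W ^ t, f ≠ 0 → ι (g ^ (N * (t + 1))) ∈ Reach V (ι f) (C * (t + 1))

variable {ι} {W : Submodule K B}

theorem good_smul (hex : ∀ z : A, ∃ s, z ∈ V ^ s) {g : B} (a : B) (hg : Good V ι W g) : Good V ι W (a * g) := by
  obtain ⟨N, C, h⟩ := hg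
  obtain ⟨s, hs⟩ := hex (ι a)
  refine ⟨N, C + s * N, fun t f hf hf0 => ?_⟩
  rw [mul_pow]
  have := reach_bmul ι (h t f hf hf0) (map_pow_cost ι hs (N * (t + 1)))
  refine reach_mono _ (le_of_eq ?_) this
  ring

theorem good_raise (hex : ∀ z : A, ∃ s, z ∈ V ^ s) {g : B} (hg : Good V ι W g) : ∃ N₀, ∀ N ≥ N₀, ∃ C, ∀ t, ∀ f ∈ W ^ t, f ≠ 0 →
    ι (g ^ (N * (t + 1))) ∈ Reach V (ι f) (C * (t + 1)) := by
  obtain ⟨N, C, h⟩ := hg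
  obtain ⟨s, hs⟩ := hex (ι g)
  refine ⟨N, fun N' hN => ?_⟩
  obtain ⟨e, rfl⟩ := Nat.exists_eq_add_of_le hN
  refine ⟨C + s * e, fun t f hf hf0 => ?_⟩
  have e1 : g ^ ((N + e) * (t + 1)) = g ^ (e * (t + 1)) * g ^ (N * (t + 1)) := by
    rw [← pow_add]; congr 1; ring
  rw [e1]
  have := reach_bmul ι (h t f hf hf0) (map_pow_cost ι hs (e * (t + 1)))
  refine reach_mono _ (le_of_eq ?_) this
  ring

theorem good_add (hex : ∀ z : A, ∃ s, z ∈ V ^ s) (h1 : (1 : A) ∈ V) {g h : B} (hg : Good V ι W g) (hh : Good V ι W h) :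
    Good V ι W (g + h) := by
  obtain ⟨N1, H1⟩ := good_raise hex hg
  obtain ⟨N2, H2⟩ := good_raise hex hh
  obtain ⟨C1, H1⟩ := H1 (max N1 N2) (le_max_left _ _)
  obtain ⟨C2, H2⟩ := H2 (max N1 N2) (le_max_right _ _)
  set N := max N1 N2
  obtain ⟨s1, hs1⟩ := hex (ι g)
  obtain ⟨s2, hs2⟩ := hex (ι h)
  refine ⟨2 * N, C1 + C2 + (s1 + s2) * (2 * N), fun t f hf hf0 => ?_⟩
  rw [add_pow, map_sum]
  refine Submodule.sum_mem _ fun i hi => ?_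
  have hi' : i ≤ 2 * N * (t + 1) := Nat.lt_succ_iff.mp (Finset.mem_range.mp hi)
  set j := 2 * N * (t + 1) - i with hj
  have e0 : g ^ i * h ^ j * (((2 * N * (t + 1)).choose i : ℕ) : B)
      = ((2 * N * (t + 1)).choose i) • (g ^ i * h ^ j) := by rw [nsmul_eq_mul, mul_comm]
  rw [e0, map_nsmul]
  refine nsmul_mem ?_ _
  have hij : i + j = 2 * (N * (t + 1)) := by rw [hj, ← mul_assoc]; omega
  by_cases hc : N * (t + 1) ≤ i
  · obtain ⟨e, rfl⟩ := Nat.exists_eq_add_of_le hc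
    have e1 : g ^ (N * (t + 1) + e) * h ^ j = h ^ j * (g ^ e * g ^ (N * (t + 1))) := by
      rw [pow_add]; ring
    rw [e1]
    have := reach_bmul ι (reach_bmul ι (H1 t f hf hf0) (map_pow_cost ι hs1 e))
      (map_pow_cost ι hs2 j)
    refine reach_mono _ ?_ this
    have a1 : s1 * e ≤ s1 * (2 * (N * (t + 1))) := Nat.mul_le_mul_left _ (by omega)
    have a2 : s2 * j ≤ s2 * (2 * (N * (t + 1))) := Nat.mul_le_mul_left _ (by omega)
    nlinarith [Nat.zero_le (C2 * (t + 1))]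
  · have hc' : N * (t + 1) ≤ j := by omega
    obtain ⟨e, he⟩ := Nat.exists_eq_add_of_le hc'
    rw [he]
    have e1 : g ^ i * h ^ (N * (t + 1) + e) = g ^ i * (h ^ e * h ^ (N * (t + 1))) := by
      rw [pow_add]; ring
    rw [e1]
    have := reach_bmul ι (reach_bmul ι (H2 t f hf hf0) (map_pow_cost ι hs2 e))
      (map_pow_cost ι hs1 i)
    refine reach_mono _ ?_ this
    have a1 : s2 * e ≤ s2 * (2 * (N * (t + 1))) := Nat.mul_le_mul_left _ (by omega)
    have a2 : s1 * i ≤ s1 * (2 * (N * (t + 1))) := Nat.mul_le_mul_left _ (by omega)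
    nlinarith [Nat.zero_le (C1 * (t + 1))]

theorem good_der (hex : ∀ z : A, ∃ s, z ∈ V ^ s) (h1 : (1 : A) ∈ V) (δ : Derivation K B B)
    (hder : ∃ z : A, ∀ b, z * ι b = ι b * z + ι (δ b)) {g : B} (hg : Good V ι W g) :
    Good V ι W (δ g) := by
  obtain ⟨N, C, H⟩ := hg
  obtain ⟨z, hz⟩ := hder
  obtain ⟨s, hs⟩ := hex z
  obtain ⟨s1, hs1⟩ := hex (ι (δ g))
  obtain ⟨s2, hs2⟩ := hex (ι (δ (δ g)))
  refine ⟨2 * N, C + (s + s1 + s2) * N, fun t f hf hf0 => ?_⟩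
  set M := N * (t + 1) with hM
  have key : ∀ i, ∀ j, i + j = M → ι (g ^ j * (δ g) ^ (2 * i)) ∈
      Reach V (ι f) (C * (t + 1) + (s + s1 + s2) * i) := by
    intro i
    induction i with
    | zero =>
      intro j hj
      have : j = M := by omega
      subst this
      simpa using H t f hf hf0
    | succ i ih =>
      intro j hj
      have h2 := ih (j + 1) (by omega)
      set u := g ^ (j + 1) * (δ g) ^ (2 * i) with hu
      have h3 : ι (δ g * δ u) ∈ Reach V (ι f) (C * (t + 1) + (s + s1 + s2) * (i + 1)) := by
        refine reach_mono _ ?_ (reach_bmul ι (reach_der ι hz h2 hs) hs1)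
        have e5 : (s + s1 + s2) * (i + 1) = (s + s1 + s2) * i + (s + s1 + s2) := by ring
        omega
      have h4 : ι (δ (δ g) * u) ∈ Reach V (ι f) (C * (t + 1) + (s + s1 + s2) * (i + 1)) := by
        refine reach_mono _ ?_ (reach_bmul ι h2 hs2)
        have e5 : (s + s1 + s2) * (i + 1) = (s + s1 + s2) * i + (s + s1 + s2) := by ring
        omega
      refine nat_cancel ι (n := j + 1) (by omega) ?_
      have e : ((j + 1 : ℕ) : B) * (g ^ j * (δ g) ^ (2 * (i + 1)))
          = δ g * δ u - (2 * i) • (δ (δ g) * u) := by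
        rw [hu, Derivation.leibniz, Derivation.leibniz_pow, Derivation.leibniz_pow]
        rcases i with _ | i
        · simp only [nsmul_eq_mul, smul_eq_mul, Nat.add_sub_cancel]; push_cast; ring
        · have : 2 * (i + 1) - 1 = 2 * i + 1 := by omega
          rw [this]
          simp only [nsmul_eq_mul, smul_eq_mul, Nat.add_sub_cancel]; push_cast; ring
      rw [e, map_sub, map_nsmul]
      exact Submodule.sub_mem _ h3 (nsmul_mem h4 _)
  have := key M 0 (by omega)
  rw [pow_zero, one_mul] at this
  have e1 : 2 * N * (t + 1) = 2 * M := by rw [hM]; ring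
  rw [e1]
  refine reach_mono _ (le_of_eq ?_) this
  rw [hM]; ring

end good

section poly
open MvPolynomial
variable {K A B : Type} [Field K] [CharZero K] [Ring A] [Algebra K A] [CommRing B] [Algebra K B]
  {V : Submodule K A} {ι : B →ₐ[K] A}

theorem totalDegree_pderiv_le' {n D : ℕ} (i : Fin n) (p : MvPolynomial (Fin n) K)
    (hp : p.totalDegree ≤ D + 1) : (pderiv i p).totalDegree ≤ D := by
  refine Finset.sup_le fun m hm => ?_
  rw [mem_support_iff, coeff_pderiv] at hm
  have : m + Finsupp.single i 1 ∈ p.support := by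
    rw [mem_support_iff]; exact left_ne_zero_of_mul hm
  have := (le_totalDegree this).trans hp
  rw [Finsupp.sum_add_index' (by simp) (by simp)] at this
  simpa using this

theorem exists_pderiv_ne {n : ℕ} (p : MvPolynomial (Fin n) K) (hp : p.totalDegree ≠ 0) :
    ∃ i, pderiv i p ≠ 0 := by
  by_contra! h
  apply hp
  rw [totalDegree_eq_zero_iff]
  intro m hm i
  by_contra hmi
  have h2 := coeff_pderiv (i := i) p (m - Finsupp.single i 1)
  have h3 : m - Finsupp.single i 1 + Finsupp.single i 1 = m := by
    apply tsub_add_cancel_of_le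
    rw [Finsupp.single_le_iff]; omega
  rw [h i, h3, coeff_zero] at h2
  rcases mul_eq_zero.mp h2.symm with h4 | h4
  · exact (mem_support_iff.mp hm) h4
  · have : (((m - Finsupp.single i 1 : Fin n →₀ ℕ) i + 1 : ℕ) : K) = 0 := by push_cast; exact h4
    exact absurd (Nat.cast_eq_zero.mp this) (by omega)

theorem reach_poly (hex : ∀ z : A, ∃ s, z ∈ V ^ s)
    (hder : ∀ δ : Derivation K B B, ∃ z : A, ∀ b, z * ι b = ι b * z + ι (δ b))
    {n : ℕ} (φ : MvPolynomial (Fin n) K →ₐ[K] B) (c : B) (δ : Fin n → Derivation K B B)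
    (hδ : ∀ i p, δ i (φ p) = c * φ (pderiv i p)) :
    ∃ q : ℕ, ∀ D : ℕ, ∀ p : MvPolynomial (Fin n) K, p ≠ 0 → p.totalDegree ≤ D →
      ∀ (d : A) (M k : ℕ), ι (c ^ M * φ p) ∈ Reach V d k →
        ι (c ^ (M + 2 * D)) ∈ Reach V d (k + q * D) := by
  choose z hz using fun i => hder (δ i)
  choose s hs using fun i => hex (z i)
  choose s1 hs1 using fun i => hex (ι (δ i c))
  obtain ⟨s2, hs2⟩ := hex (ι c)
  let q := (∑ i, s i) + (∑ i, s1 i) + 2 * s2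
  have hconst : ∀ p : MvPolynomial (Fin n) K, p ≠ 0 → p.totalDegree = 0 → ∀ (d : A) (M k : ℕ),
      ι (c ^ M * φ p) ∈ Reach V d k → ι (c ^ M) ∈ Reach V d k := by
    intro p hp0 hp d M k h
    obtain ⟨a, rfl⟩ : ∃ a, p = C a := ⟨_, totalDegree_eq_zero_iff_eq_C.mp hp⟩
    have ha : a ≠ 0 := by rintro rfl; simp at hp0
    rw [← algebraMap_eq, AlgHom.commutes, mul_comm, ← Algebra.smul_def, map_smul] at h
    have := Submodule.smul_mem _ a⁻¹ h
    rwa [smul_smul, inv_mul_cancel₀ ha, one_smul] at this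
  refine ⟨q, fun D => ?_⟩
  induction D with
  | zero =>
    intro p hp0 hp d M k h
    exact hconst p hp0 (by omega) d M k h
  | succ D ih =>
    intro p hp0 hp d M k h
    by_cases hp1 : p.totalDegree = 0
    · have h2 := hconst p hp0 hp1 d M k h
      have h3 := reach_bmul ι h2 (map_pow_cost ι hs2 (2 * (D + 1)))
      rw [add_comm M, pow_add]
      refine reach_mono _ ?_ h3
      have : s2 * (2 * (D + 1)) ≤ q * (D + 1) := by
        rw [← mul_assoc]
        exact Nat.mul_le_mul_right _ (by simp only [q]; omega)
      omega
    · obtain ⟨i, hi⟩ := exists_pderiv_ne p hp1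
      have hsi : s i ≤ ∑ i, s i := Finset.single_le_sum (fun _ _ => Nat.zero_le _) (Finset.mem_univ i)
      have hs1i : s1 i ≤ ∑ i, s1 i :=
        Finset.single_le_sum (fun _ _ => Nat.zero_le _) (Finset.mem_univ i)
      have h3 : ι (c * δ i (c ^ M * φ p)) ∈ Reach V d (k + q) :=
        reach_mono _ (by simp only [q]; omega) (reach_bmul ι (reach_der ι (hz i) h (hs i)) hs2)
      have h4 : ι (δ i c * (c ^ M * φ p)) ∈ Reach V d (k + q) :=
        reach_mono _ (by simp only [q]; omega) (reach_bmul ι h (hs1 i))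
      have e : c ^ (M + 2) * φ (pderiv i p)
          = c * δ i (c ^ M * φ p) - M • (δ i c * (c ^ M * φ p)) := by
        rw [Derivation.leibniz, Derivation.leibniz_pow, hδ]
        rcases M with _ | M
        · simp only [nsmul_eq_mul, smul_eq_mul]; push_cast; ring
        · simp only [nsmul_eq_mul, smul_eq_mul, Nat.add_sub_cancel]; push_cast; ring
      have h5 : ι (c ^ (M + 2) * φ (pderiv i p)) ∈ Reach V d (k + q) := by
        rw [e, map_sub, map_nsmul]
        exact Submodule.sub_mem _ h3 (nsmul_mem h4 _)
      have h6 := ih _ hi (totalDegree_pderiv_le' i p hp) d (M + 2) (k + q) h5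
      have e2 : M + 2 * (D + 1) = M + 2 + 2 * D := by ring
      rw [e2]
      refine reach_mono _ (le_of_eq ?_) h6
      ring

end poly

theorem exists_span_pow {K A B : Type} [Field K] [Ring A] [Algebra K A] [CommRing B] [Algebra K B]
    {V : Submodule K A} (ι : B →ₐ[K] A) (h1 : (1 : A) ∈ V) (hex : ∀ z : A, ∃ s, z ∈ V ^ s)
    (S : Finset B) :
    ∃ σ : ℕ, ∀ t, ∀ b ∈ (Submodule.span K (S : Set B)) ^ t, ι b ∈ V ^ (σ * t) := by
  choose s hs using fun b => hex (ι b)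
  refine ⟨S.sup s, fun t b hb => ?_⟩
  have h : Submodule.map ι.toLinearMap (Submodule.span K (S : Set B)) ≤ V ^ (S.sup s) := by
    rw [Submodule.map_span_le]
    intro m hm
    exact pow_mono_of_one h1 (Finset.le_sup hm) (hs m)
  rw [pow_mul]
  refine pow_le_pow_left' h t ?_
  rw [← Submodule.map_pow]
  exact ⟨b, hb, rfl⟩

theorem abstract_main {K A B : Type} [Field K] [CharZero K] [Ring A] [Algebra K A] [CommRing B]
    [Algebra K B] [IsDomain B] [Algebra.Smooth K B]
    {V : Submodule K A} (ι : B →ₐ[K] A) (h1 : (1 : A) ∈ V) (hex : ∀ z : A, ∃ s, z ∈ V ^ s)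
    (hder : ∀ δ : Derivation K B B, ∃ z : A, ∀ b, z * ι b = ι b * z + ι (δ b)) :
    ∃ S : Finset B, (1 : B) ∈ S ∧ Algebra.adjoin K (S : Set B) = ⊤ ∧
      ∃ C : ℕ, ∀ t, ∀ f ∈ (Submodule.span K (S : Set B)) ^ t, f ≠ 0 →
        (1 : A) ∈ Reach V (ι f) (C * (t + 1)) := by
  obtain ⟨n, φ, hinj, hfin⟩ := exists_finite_inj_algHom_of_fg K B
  obtain ⟨S, h1S, hS, C, hC⟩ := exists_mult n φ hfin
  obtain ⟨c, hc0, δ, hδ⟩ := exists_ders n φ hinj hfin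
  refine ⟨S, h1S, hS, ?_⟩
  set W := Submodule.span K (S : Set B) with hW
  obtain ⟨σ, hσ⟩ := exists_span_pow ι h1 hex S
  obtain ⟨q, hq⟩ := reach_poly hex hder φ c δ hδ
  have hgood : Good V ι W c := by
    refine ⟨2 * C, σ * C + q * C, fun t f hf hf0 => ?_⟩
    obtain ⟨p, hp0, hpd, h, hh, hph⟩ := hC t f hf hf0
    have h2 : ι (c ^ 0 * φ p) ∈ Reach V (ι f) (0 + σ * (C * t)) := by
      rw [pow_zero, one_mul, hph]
      exact reach_bmul ι (reach_self _ _) (hσ _ h hh)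
    have h3 := hq (C * (t + 1)) p hp0 (hpd.trans (Nat.mul_le_mul_left _ (by omega))) _ _ _ h2
    have e3 : 2 * C * (t + 1) = 0 + 2 * (C * (t + 1)) := by ring
    rw [e3]
    refine reach_mono _ ?_ h3
    nlinarith [Nat.zero_le (σ * C)]
  let I : Ideal B :=
    { carrier := {g | Good V ι W g}
      add_mem' := fun ha hb => good_add hex h1 ha hb
      zero_mem' := by
        have := good_smul hex 0 hgood
        rwa [zero_mul] at this
      smul_mem' := fun a g hg => good_smul hex a hg }
  have hI : I = ⊤ := dsimple (K := K) I
    (fun h => hc0 (by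
      have : c ∈ I := hgood
      rw [h] at this
      exact this))
    (fun δ f hf => good_der hex h1 δ (hder δ) hf)
  have h1I : (1 : B) ∈ I := by rw [hI]; trivial
  obtain ⟨N, C', H⟩ := h1I
  refine ⟨C', fun t f hf hf0 => ?_⟩
  have := H t f hf hf0
  rwa [one_pow, map_one] at this

section dops
variable {K B : Type} [Field K] [CommRing B] [Algebra K B]

theorem mem_diffOpsLE_succ {n : ℕ} {u : Module.End K B} :
    u ∈ diffOpsLE K B (n + 1) ↔
      ∀ r : B, u * Algebra.lmul K B r - Algebra.lmul K B r * u ∈ diffOpsLE K B n := by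
  rw [diffOpsLE, Submodule.mem_iInf]
  rfl

theorem lmul_mem_zero (b : B) : Algebra.lmul K B b ∈ diffOpsLE K B 0 := ⟨b, rfl⟩

theorem lmul_comm (a b : B) :
    Algebra.lmul K B a * Algebra.lmul K B b = Algebra.lmul K B b * Algebra.lmul K B a := by
  rw [← map_mul, ← map_mul, mul_comm]

theorem diffOpsLE_le_succ (n : ℕ) : diffOpsLE K B n ≤ diffOpsLE K B (n + 1) := by
  induction n with
  | zero =>
    rintro _ ⟨b, rfl⟩
    rw [mem_diffOpsLE_succ]
    intro r
    have : (Algebra.lmul K B).toLinearMap b = Algebra.lmul K B b := rfl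
    rw [this, lmul_comm, sub_self]
    exact Submodule.zero_mem _
  | succ n ih =>
    intro u hu
    rw [mem_diffOpsLE_succ] at hu ⊢
    exact fun r => ih (hu r)

theorem diffOpsLE_mono : Monotone (diffOpsLE K B) := monotone_nat_of_le_succ diffOpsLE_le_succ

theorem mul_mem_diffOpsLE : ∀ (N i j : ℕ), i + j = N → ∀ u v : Module.End K B,
    u ∈ diffOpsLE K B i → v ∈ diffOpsLE K B j → u * v ∈ diffOpsLE K B (i + j) := by
  intro N
  induction N with
  | zero =>
    intro i j hij u v hu hv
    obtain rfl : i = 0 := by omega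
    obtain rfl : j = 0 := by omega
    obtain ⟨a, rfl⟩ := hu
    obtain ⟨b, rfl⟩ := hv
    exact ⟨a * b, (map_mul (Algebra.lmul K B) a b)⟩
  | succ N ih =>
    intro i j hij u v hu hv
    rw [hij, mem_diffOpsLE_succ]
    intro r
    set R := Algebra.lmul K B r with hR
    have e : u * v * R - R * (u * v) = u * (v * R - R * v) + (u * R - R * u) * v := by
      simp only [mul_sub, sub_mul, mul_assoc]; abel
    rw [e]
    refine Submodule.add_mem _ ?_ ?_
    · rcases j with _ | j
      · obtain ⟨b, rfl⟩ := hv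
        have : (Algebra.lmul K B).toLinearMap b = Algebra.lmul K B b := rfl
        rw [this, hR, lmul_comm, sub_self, mul_zero]
        exact Submodule.zero_mem _
      · have := ih i j (by omega) u _ hu (mem_diffOpsLE_succ.mp hv r)
        rwa [show i + j = N by omega] at this
    · rcases i with _ | i
      · obtain ⟨b, rfl⟩ := hu
        have : (Algebra.lmul K B).toLinearMap b = Algebra.lmul K B b := rfl
        rw [this, hR, lmul_comm, sub_self, zero_mul]
        exact Submodule.zero_mem _
      · have := ih i j (by omega) _ v (mem_diffOpsLE_succ.mp hu r) hv
        rwa [show i + j = N by omega] at this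

theorem diffOpsLE_le (n : ℕ) (u : Module.End K B) (hu : u ∈ diffOpsLE K B n) :
    u ∈ diffOps K B :=
  Algebra.subset_adjoin (Set.mem_iUnion.mpr ⟨n, hu⟩)

theorem exists_order {u : Module.End K B} (hu : u ∈ diffOps K B) : ∃ n, u ∈ diffOpsLE K B n := by
  induction hu using Algebra.adjoin_induction with
  | mem x hx => exact Set.mem_iUnion.mp hx
  | algebraMap r =>
    exact ⟨0, algebraMap K B r, AlgHom.commutes (Algebra.lmul K B) r⟩
  | add x y _ _ hx hy =>
    obtain ⟨s, hs⟩ := hx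
    obtain ⟨t, ht⟩ := hy
    exact ⟨max s t, Submodule.add_mem _ (diffOpsLE_mono (le_max_left _ _) hs)
      (diffOpsLE_mono (le_max_right _ _) ht)⟩
  | mul x y _ _ hx hy =>
    obtain ⟨s, hs⟩ := hx
    obtain ⟨t, ht⟩ := hy
    exact ⟨s + t, mul_mem_diffOpsLE _ s t rfl _ _ hs ht⟩

/-- multiplication operators -/
def dI (K B : Type) [Field K] [CommRing B] [Algebra K B] : B →ₐ[K] ↥(diffOps K B) :=
  (Algebra.lmul K B).codRestrict (diffOps K B) fun b => diffOpsLE_le 0 _ (lmul_mem_zero b)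

theorem dI_coe (b : B) : ((dI K B b : ↥(diffOps K B)) : Module.End K B) = Algebra.lmul K B b := rfl

theorem dI_apply (b x : B) : ((dI K B b : ↥(diffOps K B)) : Module.End K B) x = b * x := rfl

theorem dI_inj (b : B) (h : dI K B b = 0) : b = 0 := by
  have : ((dI K B b : ↥(diffOps K B)) : Module.End K B) 1 = 0 := by rw [h]; rfl
  rwa [dI_apply, mul_one] at this

theorem dI_der (δ : Derivation K B B) :
    ∃ z : ↥(diffOps K B), ∀ b, z * dI K B b = dI K B b * z + dI K B (δ b) := by
  have key : ∀ b, (δ.toLinearMap : Module.End K B) * Algebra.lmul K B b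
      = Algebra.lmul K B b * δ.toLinearMap + Algebra.lmul K B (δ b) := by
    intro b
    ext x
    simp [mul_comm]
  refine ⟨⟨δ.toLinearMap, diffOpsLE_le 1 _ ?_⟩, fun b => Subtype.ext (key b)⟩
  rw [mem_diffOpsLE_succ]
  intro r
  rw [key, add_sub_cancel_left]
  exact lmul_mem_zero _

theorem map_pow_shift (S : Finset B) (h1S : (1 : B) ∈ S) (hS : Algebra.adjoin K (S : Set B) = ⊤)
    (m : ℕ) : ∀ u : Module.End K B, u ∈ diffOpsLE K B m → ∃ q : ℕ, ∀ t,
      ∀ h ∈ (Submodule.span K (S : Set B)) ^ t, u h ∈ (Submodule.span K (S : Set B)) ^ (t + q) := by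
  have h1 : (1 : B) ∈ Submodule.span K (S : Set B) := Submodule.subset_span h1S
  have hex : ∀ b : B, ∃ s, b ∈ (Submodule.span K (S : Set B)) ^ s :=
    exists_mem_pow h1 (by rw [Algebra.adjoin_span]; exact hS)
  set W := Submodule.span K (S : Set B) with hW
  induction m with
  | zero =>
    rintro u ⟨b, rfl⟩
    obtain ⟨s, hs⟩ := hex b
    refine ⟨s, fun t h hh => ?_⟩
    rw [add_comm, pow_add]
    exact Submodule.mul_mem_mul hs hh
  | succ m ih =>
    intro u hu
    choose q hq using fun w => ih _ (mem_diffOpsLE_succ.mp hu w)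
    obtain ⟨s, hs⟩ := hex (u 1)
    refine ⟨s + S.sup q, fun t => ?_⟩
    induction t with
    | zero =>
      intro h hh
      rw [pow_zero, Submodule.mem_one] at hh
      obtain ⟨a, rfl⟩ := hh
      rw [Algebra.algebraMap_eq_smul_one, map_smul]
      exact Submodule.smul_mem _ _ (pow_mono_of_one h1 (by omega) hs)
    | succ t iht =>
      intro h hh
      rw [pow_succ'] at hh
      refine Submodule.mul_induction_on hh ?_ ?_
      · intro w hw h hh
        induction hw using Submodule.span_induction with
        | mem w hw =>
          have e : u (w * h) = w * u h
              + (u * Algebra.lmul K B w - Algebra.lmul K B w * u) h := by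
            simp
          rw [e]
          refine Submodule.add_mem _ ?_ ?_
          · rw [show t + 1 + (s + S.sup q) = 1 + (t + (s + S.sup q)) by ring, pow_add, pow_one]
            exact Submodule.mul_mem_mul (Submodule.subset_span hw) (iht h hh)
          · refine pow_mono_of_one h1 ?_ (hq w t h hh)
            have : q w ≤ S.sup q := Finset.le_sup hw
            omega
        | zero => rw [zero_mul, map_zero]; exact Submodule.zero_mem _
        | add a b _ _ ha hb => rw [add_mul, map_add]; exact Submodule.add_mem _ ha hb
        | smul a b _ hb => rw [smul_mul_assoc, map_smul]; exact Submodule.smul_mem _ _ hb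
      · intro a b ha hb
        rw [map_add]; exact Submodule.add_mem _ ha hb


end dops

section absops
variable {K A B : Type} [Field K] [CommRing B] [Algebra K B] [Ring A] [Algebra K A]
  (J : A →ₐ[K] Module.End K B) (ι : B →ₐ[K] A)

/-- commuting with generators means being a multiplication operator -/
theorem eq_of_comm (hJ : Function.Injective J) (hι : ∀ b, J (ι b) = Algebra.lmul K B b)
    {S : Set B} (hS : Algebra.adjoin K S = ⊤) (d : A)
    (h : ∀ w ∈ S, d * ι w - ι w * d = 0) : ∃ f, d = ι f := by
  have hc : ∀ b : B, d * ι b = ι b * d := by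
    intro b
    have hb : b ∈ Algebra.adjoin K S := by rw [hS]; trivial
    induction hb using Algebra.adjoin_induction with
    | mem x hx => exact sub_eq_zero.mp (h x hx)
    | algebraMap r => rw [AlgHom.commutes]; exact (Algebra.commutes r d).symm
    | add x y _ _ hx hy => rw [map_add, mul_add, add_mul, hx, hy]
    | mul x y _ _ hx hy => rw [map_mul, ← mul_assoc, hx, mul_assoc, hy, mul_assoc]
  refine ⟨J d 1, hJ (LinearMap.ext fun x => ?_)⟩
  have h2 : J (d * ι x) 1 = J (ι x * d) 1 := by rw [hc]
  rw [map_mul, map_mul, hι] at h2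
  have h3 : J d (x * 1) = x * J d 1 := h2
  rw [hι]
  have h4 : (Algebra.lmul K B) (J d 1) x = J d 1 * x := rfl
  rw [h4, ← mul_comm x, ← h3, mul_one]

theorem step_one (hJ : Function.Injective J) (hι : ∀ b, J (ι b) = Algebra.lmul K B b)
    {V : Submodule K A} (S : Finset B)
    (hS : Algebra.adjoin K (S : Set B) = ⊤) (s : ℕ) (hs : ∀ w ∈ S, ι w ∈ V ^ s) (n : ℕ) :
    ∀ d : A, J d ∈ diffOpsLE K B n → d ≠ 0 →
      ∃ f : B, f ≠ 0 ∧ ι f ∈ Reach V d (s * n) := by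
  induction n with
  | zero =>
    rintro d ⟨b, hb⟩ hd0
    have e : d = ι b := hJ (by rw [hι]; exact hb.symm)
    refine ⟨b, ?_, ?_⟩
    · rintro rfl
      exact hd0 (by rw [e, map_zero])
    · rw [← e]; exact reach_self _ _
  | succ n ih =>
    intro d hd hd0
    by_cases h : ∀ w ∈ (S : Set B), d * ι w - ι w * d = 0
    · obtain ⟨f, hf⟩ := eq_of_comm J ι hJ hι hS d h
      refine ⟨f, ?_, ?_⟩
      · rintro rfl
        exact hd0 (by rw [hf, map_zero])
      · rw [← hf]; exact reach_self _ _
    · push Not at h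
      obtain ⟨w, hw, hne⟩ := h
      obtain ⟨f, hf0, hf⟩ := ih (d * ι w - ι w * d)
        (by rw [map_sub, map_mul, map_mul, hι]; exact mem_diffOpsLE_succ.mp hd w) hne
      refine ⟨f, hf0, ?_⟩
      have h1 : d * ι w - ι w * d ∈ Reach V d (0 + s) :=
        Submodule.sub_mem _ (reach_mul_right (reach_self d 0) (hs w hw))
          (reach_mul_left (reach_self d 0) (hs w hw))
      refine reach_mono _ (le_of_eq ?_) (reach_trans h1 hf)
      ring

theorem uniform_order (hO : ∀ z : A, ∃ n, J z ∈ diffOpsLE K B n) {V : Submodule K A} (hfg : V.FG) :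
    ∃ m : ℕ, ∀ k, ∀ d ∈ V ^ k, J d ∈ diffOpsLE K B (m * k) := by
  obtain ⟨T, hT⟩ := hfg
  choose o ho using fun z : A => hO z
  have hV : ∀ d ∈ V, J d ∈ diffOpsLE K B (T.sup o) := by
    have : V ≤ (diffOpsLE K B (T.sup o)).comap J.toLinearMap := by
      rw [← hT, Submodule.span_le]
      intro z hz
      exact diffOpsLE_mono (Finset.le_sup hz) (ho z)
    exact this
  refine ⟨T.sup o, fun k => ?_⟩
  induction k with
  | zero =>
    intro d hd
    rw [pow_zero, Submodule.mem_one] at hd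
    obtain ⟨a, rfl⟩ := hd
    rw [AlgHom.commutes]
    exact ⟨algebraMap K B a, AlgHom.commutes (Algebra.lmul K B) a⟩
  | succ k ih =>
    intro d hd
    rw [pow_succ] at hd
    refine Submodule.mul_induction_on hd ?_ ?_
    · intro x hx y hy
      rw [map_mul]
      exact mul_mem_diffOpsLE _ _ _ rfl _ _ (ih x hx) (hV y hy)
    · intro a b ha hb
      rw [map_add]; exact Submodule.add_mem _ ha hb

theorem uniform_shift (hO : ∀ z : A, ∃ n, J z ∈ diffOpsLE K B n) {V : Submodule K A} (hfg : V.FG)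
    (S : Finset B) (h1S : (1 : B) ∈ S) (hS : Algebra.adjoin K (S : Set B) = ⊤) :
    ∃ q : ℕ, ∀ k, ∀ d ∈ V ^ k, ∀ t, ∀ h ∈ (Submodule.span K (S : Set B)) ^ t,
      J d h ∈ (Submodule.span K (S : Set B)) ^ (t + q * k) := by
  have h1 : (1 : B) ∈ Submodule.span K (S : Set B) := Submodule.subset_span h1S
  obtain ⟨T, hT⟩ := hfg
  have hz : ∀ z : A, ∃ q : ℕ, ∀ t, ∀ h ∈ (Submodule.span K (S : Set B)) ^ t,
      J z h ∈ (Submodule.span K (S : Set B)) ^ (t + q) := by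
    intro z
    obtain ⟨m, hm⟩ := hO z
    exact map_pow_shift S h1S hS m _ hm
  choose o ho using hz
  have hV : ∀ d ∈ V, ∀ t, ∀ h ∈ (Submodule.span K (S : Set B)) ^ t,
      J d h ∈ (Submodule.span K (S : Set B)) ^ (t + T.sup o) := by
    intro d hd t h hh
    rw [← hT] at hd
    induction hd using Submodule.span_induction with
    | mem z hz =>
      refine pow_mono_of_one h1 ?_ (ho z t h hh)
      have : o z ≤ T.sup o := Finset.le_sup hz
      omega
    | zero => rw [map_zero]; exact Submodule.zero_mem _
    | add a b _ _ ha hb => rw [map_add]; exact Submodule.add_mem _ ha hb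
    | smul a b _ hb => rw [map_smul]; exact Submodule.smul_mem _ a hb
  refine ⟨T.sup o, fun k => ?_⟩
  induction k with
  | zero =>
    intro d hd t h hh
    rw [pow_zero, Submodule.mem_one] at hd
    obtain ⟨a, rfl⟩ := hd
    rw [AlgHom.commutes]
    exact Submodule.smul_mem _ a hh
  | succ k ih =>
    intro d hd t h hh
    rw [pow_succ] at hd
    refine Submodule.mul_induction_on hd ?_ ?_
    · intro x hx y hy
      have := ih x hx _ _ (hV y hy t h hh)
      rw [map_mul, show t + T.sup o * (k + 1) = t + T.sup o + T.sup o * k by ring]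
      exact this
    · intro a b ha hb
      rw [map_add]; exact Submodule.add_mem _ ha hb


theorem abs_main [CharZero K] [IsDomain B] [Algebra.Smooth K B]
    (hJ : Function.Injective J) (hι : ∀ b, J (ι b) = Algebra.lmul K B b)
    (hO : ∀ z : A, ∃ n, J z ∈ diffOpsLE K B n)
    (hder : ∀ δ : Derivation K B B, ∃ z : A, ∀ b, z * ι b = ι b * z + ι (δ b))
    (V : Submodule K A) (hV : IsStdFilt K A V) :
    ∃ a b : ℕ, ∀ k : ℕ, ∀ d ∈ (V ^ k : Submodule K A), d ≠ 0 →
      (1 : A) ∈ Reach V d (a * k + b) := by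
  have hex := exists_mem_pow (K := K) (A := A) (V := V) hV.one_mem hV.gen
  have hfg : V.FG := (Submodule.fg_iff_finiteDimensional V).mpr hV.fin
  obtain ⟨S, h1S, hS, C, hC⟩ := abstract_main ι hV.one_mem hex hder
  obtain ⟨σ, hσ⟩ := exists_span_pow ι hV.one_mem hex S
  have hs : ∀ w ∈ S, ι w ∈ V ^ σ := by
    intro w hw
    have := hσ 1 w (by rw [pow_one]; exact Submodule.subset_span hw)
    rwa [mul_one] at this
  obtain ⟨m, hm⟩ := uniform_order J hO hfg
  obtain ⟨q, hq⟩ := uniform_shift J hO hfg S h1S hS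
  refine ⟨σ * m + C * q * (σ * m + 1), C, fun k d hd hd0 => ?_⟩
  obtain ⟨f, hf0, hf⟩ := step_one J ι hJ hι S hS σ hs (m * k) d (hm k d hd) hd0
  have h2 := reach_le_pow hV.one_mem hd hf
  have h3 := hq _ _ h2 0 1 (by rw [pow_zero]; exact Submodule.one_le.mp le_rfl)
  have h5 : J (ι f) 1 = f := by
    rw [hι]; exact mul_one f
  rw [h5] at h3
  have h4 := reach_trans hf (hC _ f h3 hf0)
  refine reach_mono _ (le_of_eq ?_) h4
  ring

end absops

set_option synthInstance.maxHeartbeats 1000000 in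
/-- Let `K` be a field of characteristic zero and `B` a finitely generated regular
(= smooth) commutative `K`-algebra which is a domain of finite Krull dimension, with
ring of differential operators `Δ = D(B)` filtered by a standard finite-dimensional
filtration `{Δ_k = V ^ k}`. Then there exist natural numbers `a`, `b` such that for every
`k` and every `0 ≠ d ∈ Δ_k` there is an element `w` of the piece `Δ^e_{ak+b}` of the
induced filtration of the enveloping algebra `Δ^e = Δ ⊗ Δ^op` with `w · d = 1`; i.e.
`1` is a sum of elements `x * d * y` with `x ∈ Δ_j`, `y ∈ Δ_l`, `j + l ≤ a * k + b`. -/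
theorem diffOps_enveloping_inverse
    (K B : Type) [Field K] [CharZero K] [CommRing B] [Algebra K B] [IsDomain B]
    [Algebra.Smooth K B] (hdim : ringKrullDim B < ⊤)
    (V : Submodule K ↥(diffOps K B)) (hV : IsStdFilt K ↥(diffOps K B) V) :
    ∃ a b : ℕ, ∀ k : ℕ, ∀ d ∈ (V ^ k : Submodule K ↥(diffOps K B)), d ≠ 0 →
      (1 : ↥(diffOps K B)) ∈ Submodule.span K
        {z : ↥(diffOps K B) | ∃ j l : ℕ, j + l ≤ a * k + b ∧
          ∃ x ∈ (V ^ j : Submodule K ↥(diffOps K B)),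
          ∃ y ∈ (V ^ l : Submodule K ↥(diffOps K B)), z = x * d * y} := by
  have h1 : Function.Injective (diffOps K B).val := Subtype.val_injective
  have h2 : ∀ b, (diffOps K B).val (dI K B b) = Algebra.lmul K B b := fun _ => rfl
  have h3 : ∀ z : ↥(diffOps K B), ∃ n, (diffOps K B).val z ∈ diffOpsLE K B n :=
    fun z => exists_order z.2
  have := abs_main (K := K) (A := ↥(diffOps K B)) (B := B) (diffOps K B).val (dI K B)
  have := this h1
  have := this h2
  have := this h3
  have := this dI_der
  have := this V
  have := this hV
  exact this

end
end

section
/- Let R be a somewhat commutative K-algebra with holonomic number h > 0, let y_1,…,y_s be homogeneous algebra generators of gr R of graded degrees k_1,…,k_s, and let k = lcm(k_1,…,k_s). Then: (1) every holonomic R-module M with multiplicity e(M) has finite length at most e(M)·k^h; (2) every nonzero submodule and every nonzero factor module of a holonomic R-module is holonomic. -/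
/- Common definitions: degree of a function, standard finite-dimensional filtrations,
Gelfand-Kirillov dimension, return functions and filter dimensions (V. Bavula,
"Filter dimension"), and the Rentschler–Gabriel (left) Krull dimension via deviation. -/

open Filter

noncomputable section

/-- `F` is a somewhat commutative filtration of the `K`-algebra `R`: a finite-dimensional
filtration `R = ⋃ R_i` with `R_{-1} = 0`, `R_0 = K`, such that the associated graded
algebra `gr R = ⊕ R_i/R_{i-1}` is commutative (i.e. `[R_i, R_j] ⊆ R_{i+j-1}`). -/
structure IsSomewhatCommFilt (K R : Type) [Field K] [Ring R] [Algebra K R]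
    (F : ℕ → Submodule K R) : Prop where
  mono : Monotone F
  zero_eq : F 0 = Submodule.span K {(1 : R)}
  exhaustive : ∀ x : R, ∃ i, x ∈ F i
  fin : ∀ i, FiniteDimensional K ↥(F i)
  mul_mem : ∀ i j, ∀ x ∈ F i, ∀ y ∈ F j, x * y ∈ F (i + j)
  commutator_mem : ∀ i j, ∀ x ∈ F i, ∀ y ∈ F j, x * y - y * x ∈ F (i + j - 1)

/-- The elements `y t ∈ R_{kdeg t}` represent homogeneous algebra generators of the
associated graded algebra `gr R`, of graded degrees `kdeg t ≥ 1`: every `R_n` is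
contained in `R_{n-1}` plus the span of products of the `y`'s of total degree `n`. -/
structure IsGrGenerators (K R : Type) [Field K] [Ring R] [Algebra K R]
    (F : ℕ → Submodule K R) (s : ℕ) (y : Fin s → R) (kdeg : Fin s → ℕ) : Prop where
  deg_pos : ∀ t, 1 ≤ kdeg t
  mem : ∀ t, y t ∈ F (kdeg t)
  gen : ∀ n, 1 ≤ n → F n ≤ F (n - 1) ⊔ Submodule.span K
    {z : R | ∃ L : List (Fin s), (L.map kdeg).sum = n ∧ z = (L.map y).prod}

/-- The Gelfand-Kirillov dimension of the `R`-module `M` w.r.t. the filtration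
`{F i • W}` attached to a generating subspace `W`. -/
def gkModWF (K : Type) [Field K] {R M : Type} [Ring R] [Algebra K R] [AddCommGroup M]
    [Module K M] [Module R M] [IsScalarTower K R M] (F : ℕ → Submodule K R)
    (W : Submodule K M) : EReal :=
  gammaDeg fun i => (Module.finrank K (smulSub K (F i) W) : ℕ∞)

/-- The Gelfand-Kirillov dimension of the `R`-module `M` w.r.t. the filtration `F` of `R`
(independent of the choice of the generating subspace). -/
def gkModF (K R M : Type) [Field K] [Ring R] [Algebra K R] [AddCommGroup M] [Module K M]
    [Module R M] [IsScalarTower K R M] (F : ℕ → Submodule K R) : EReal :=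
  ⨅ W : {W : Submodule K M // IsGenSub K R W}, gkModWF K F W.1

/-- The holonomic number `h_R = min { GK(M) | M ≠ 0 a finitely generated R-module }`. -/
def holonomicNumberF (K R : Type) [Field K] [Ring R] [Algebra K R]
    (F : ℕ → Submodule K R) : EReal :=
  sInf { x : EReal | ∃ (M : Type) (_ : AddCommGroup M) (_ : Module K M) (_ : Module R M)
    (_ : IsScalarTower K R M), Nontrivial M ∧ Module.Finite R M ∧ x = gkModF K R M F }

/-- `Γ` is a good filtration of the `R`-module `M` w.r.t. the filtration `F` of `R`:
`F i • Γ j ⊆ Γ_{i+j}` and the associated graded module is finitely generated over `gr R`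
(equivalently, `Γ` is eventually generated by finitely many of its terms). -/
structure IsGoodFilt (K R M : Type) [Field K] [Ring R] [Algebra K R] [AddCommGroup M]
    [Module K M] [Module R M] [IsScalarTower K R M] (F : ℕ → Submodule K R)
    (Γ : ℕ → Submodule K M) : Prop where
  mono : Monotone Γ
  exhaustive : ∀ x : M, ∃ i, x ∈ Γ i
  fin : ∀ i, FiniteDimensional K ↥(Γ i)
  compat : ∀ i j, smulSub K (F i) (Γ j) ≤ Γ (i + j)
  fg : ∃ i0 : ℕ, ∀ j, i0 ≤ j →
    Γ j ≤ ⨆ i : Fin (i0 + 1), smulSub K (F (j - (i : ℕ))) (Γ (i : ℕ))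

/-- `e` is the multiplicity of the `R`-module `M` (of Gelfand-Kirillov dimension `hdeg`,
w.r.t. `lcm` of the degrees of the generators equal to `kk`): for some good filtration
`Γ` there are `kk` rational polynomials `γ_0, …, γ_{kk-1}`, all of degree `hdeg` and
leading coefficient `e / hdeg!`, with `dim Γ_i = γ_{i mod kk}(i)` for all `i ≫ 0`. -/
def HasMultiplicityF (K R M : Type) [Field K] [Ring R] [Algebra K R] [AddCommGroup M]
    [Module K M] [Module R M] [IsScalarTower K R M] (F : ℕ → Submodule K R)
    (kk hdeg : ℕ) (e : ℚ) : Prop :=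
  ∃ Γ : ℕ → Submodule K M, IsGoodFilt K R M F Γ ∧
    ∃ γ : ℕ → Polynomial ℚ,
      (∀ j < kk, (γ j).degree = (hdeg : WithBot ℕ)) ∧
      (∀ j < kk, (γ j).leadingCoeff = e / (Nat.factorial hdeg : ℚ)) ∧
      ∀ᶠ i in atTop, (Module.finrank K ↥(Γ i) : ℚ) = (γ (i % kk)).eval (i : ℚ)


theorem down_dichotomy {s : ℕ} (D : Set (Fin s → ℕ)) (hD : IsLowerSet D) (h : ℕ) :
    (∃ S : Finset (Fin s), S.card = h ∧ ∀ α : Fin s → ℕ, (∀ i ∉ S, α i = 0) → α ∈ D) ∨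
    (∃ C : ℕ, ∀ n, ∀ T : Finset (Fin s → ℕ), (∀ α ∈ T, α ∈ D ∧ ∀ i, α i ≤ n) →
      T.card ≤ C * (n + 1) ^ (h - 1)) := by
  classical
  by_cases hS : ∃ S : Finset (Fin s), h ≤ S.card ∧ ∀ α : Fin s → ℕ, (∀ i ∉ S, α i = 0) → α ∈ D
  · left
    obtain ⟨S, hc, hS⟩ := hS
    obtain ⟨S', hS', hc'⟩ := Finset.exists_subset_card_eq hc
    exact ⟨S', hc', fun α hα => hS α fun i hi => hα i fun hi' => hi (hS' hi')⟩
  right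
  push Not at hS
  -- minimal elements
  have hfin : {m | Minimal (fun a => a ∈ Dᶜ) m}.Finite :=
    WellQuasiOrderedLE.finite_of_isAntichain (setOfPred_minimal_antichain _)
  obtain ⟨b, hb⟩ := hfin.bddAbove
  set B : ℕ := ∑ i, b i with hBdef
  have hB : ∀ m, Minimal (fun a => a ∈ Dᶜ) m → ∀ i, m i ≤ B := fun m hm i =>
    (hb hm i).trans (Finset.single_le_sum (f := b) (fun _ _ => Nat.zero_le _) (Finset.mem_univ i))
  have key : ∀ α ∈ D, (Finset.univ.filter fun i => B < α i).card < h := by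
    intro α hα
    by_contra hlt
    push Not at hlt
    obtain ⟨β, hβ, hβD⟩ := hS _ hlt
    obtain ⟨m, hm, hmin⟩ := exists_minimal_le_of_wellFoundedLT (fun a => a ∈ Dᶜ) β hβD
    apply hmin.1
    refine hD ?_ hα
    intro i
    by_cases hi : B < α i
    · exact (hB m hmin i).trans hi.le
    · have := hm i
      rw [hβ i (by simpa using hi)] at this
      exact this.trans (Nat.zero_le _)
  refine ⟨2 ^ s * (B + 1) ^ s, fun n T hT => ?_⟩
  let box : Finset (Fin s) → Finset (Fin s → ℕ) := fun S =>
    Fintype.piFinset fun i => if i ∈ S then Finset.range (n+1) else Finset.range (B+1)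
  have hsub : T ⊆ ((Finset.univ : Finset (Finset (Fin s))).filter (fun S => S.card ≤ h - 1)).biUnion box := by
    intro α hα
    obtain ⟨h1, h2⟩ := hT α hα
    have := key α h1
    simp only [Finset.mem_biUnion, Finset.mem_filter, Finset.mem_univ, true_and]
    refine ⟨Finset.univ.filter fun i => B < α i, by omega, ?_⟩
    · simp only [box, Fintype.mem_piFinset]
      intro i
      have := h2 i
      split_ifs with hi
      · simp; omega
      · simp at hi ⊢; omega
  refine (Finset.card_le_card hsub).trans (Finset.card_biUnion_le.trans ?_)
  have hbox : ∀ S ∈ (Finset.univ : Finset (Finset (Fin s))).filter (fun S => S.card ≤ h - 1),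
      (box S).card ≤ (B + 1) ^ s * (n + 1) ^ (h - 1) := by
    intro S hSc
    simp only [Finset.mem_filter, Finset.mem_univ, true_and] at hSc
    simp only [box, Fintype.card_piFinset]
    calc ∏ i, (if i ∈ S then Finset.range (n+1) else Finset.range (B+1)).card
        ≤ ∏ i : Fin s, ((B + 1) * if i ∈ S then (n+1) else 1) := by
          apply Finset.prod_le_prod (fun _ _ => Nat.zero_le _)
          intro i _
          split_ifs
          · simp only [Finset.card_range]; nlinarith [Nat.zero_le (B * (n+1))]
          · simp
      _ = (B+1)^s * (n+1)^S.card := by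
          rw [Finset.prod_mul_distrib]; simp
      _ ≤ _ := by
        apply Nat.mul_le_mul_left
        exact Nat.pow_le_pow_right (Nat.succ_pos _) hSc
  refine (Finset.sum_le_card_nsmul _ _ _ hbox).trans ?_
  rw [smul_eq_mul, mul_assoc]
  apply Nat.mul_le_mul_right
  refine (Finset.card_filter_le _ _).trans ?_
  simp

theorem simplex_card {s : ℕ} (S : Finset (Fin s)) (h : ℕ) (hS : S.card = h) (hpos : 0 < h) (t : ℕ) :
    ∃ T : Finset (Fin s → ℕ), (∀ α ∈ T, (∀ i ∉ S, α i = 0) ∧ ∑ i, α i ≤ t) ∧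
      (t + h).choose h ≤ T.card := by
  classical
  refine ⟨(Finset.range (t+1)).biUnion fun j => Finset.piAntidiag S j, ?_, ?_⟩
  · intro α hα
    simp only [Finset.mem_biUnion, Finset.mem_range, Finset.mem_piAntidiag] at hα
    obtain ⟨j, hj, hs, h0⟩ := hα
    have h0' : ∀ i ∉ S, α i = 0 := fun i hi => by
      by_contra h; exact hi (h0 i h)
    refine ⟨h0', ?_⟩
    rw [← Finset.sum_subset (Finset.subset_univ S) (fun i _ hi => h0' i hi), hs]
    omega
  · rw [Finset.card_biUnion]
    · have : ∀ j, (Finset.piAntidiag S j).card = (j + (h-1)).choose (h-1) := by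
        intro j
        have h1 : (Finset.piAntidiag S j).card = (Finset.finsuppAntidiag S j).card := by
          simp [Finset.finsuppAntidiag]
        rw [h1, Finset.card_finsuppAntidiag_nat_eq_multichoose, hS, Nat.multichoose_eq,
          ← Nat.choose_symm (by omega)]
        congr 1 <;> omega
      simp only [this]
      rw [Nat.sum_range_add_choose]
      have : t + (h-1) + 1 = t + h := by omega
      rw [this, Nat.sub_add_cancel hpos]
    · intro a _ b _ hab
      show Disjoint _ _
      rw [Finset.disjoint_left]
      intro α h1 h2
      simp only [Finset.mem_piAntidiag] at h1 h2
      exact hab (h1.1.symm.trans h2.1)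

theorem smulSub_eq_map₂ (K : Type) [Field K] {A M : Type} [Ring A] [Algebra K A] [AddCommGroup M]
    [Module K M] [Module A M] [IsScalarTower K A M] (p : Submodule K A) (W : Submodule K M) :
    smulSub K p W = Submodule.map₂ (Algebra.lsmul K K M).toLinearMap p W := by
  rw [Submodule.map₂_eq_span_image2, smulSub]
  congr 1
  ext x
  simp only [Set.mem_ofPred_eq, Set.mem_image2, SetLike.mem_coe]
  constructor
  · rintro ⟨a, ha, w, hw, rfl⟩; exact ⟨a, ha, w, hw, rfl⟩
  · rintro ⟨a, ha, w, hw, rfl⟩; exact ⟨a, ha, w, hw, rfl⟩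

theorem smulSub_fin (K : Type) [Field K] {A M : Type} [Ring A] [Algebra K A] [AddCommGroup M]
    [Module K M] [Module A M] [IsScalarTower K A M] (p : Submodule K A) (W : Submodule K M)
    (hp : FiniteDimensional K p) (hW : FiniteDimensional K W) :
    FiniteDimensional K (smulSub K p W) := by
  rw [smulSub_eq_map₂]
  rw [FiniteDimensional, Module.finite_def, Submodule.fg_top] at *
  exact Submodule.FG.map₂ _ hp hW

theorem smulSub_le {K : Type} [Field K] {A M : Type} [Ring A] [Algebra K A] [AddCommGroup M]
    [Module K M] [Module A M] [IsScalarTower K A M] {p : Submodule K A} {W U : Submodule K M} :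
    smulSub K p W ≤ U ↔ ∀ a ∈ p, ∀ w ∈ W, a • w ∈ U := by
  rw [smulSub, Submodule.span_le]
  constructor
  · intro H a ha w hw; exact H ⟨a, ha, w, hw, rfl⟩
  · rintro H _ ⟨a, ha, w, hw, rfl⟩; exact H a ha w hw

theorem smul_mem_smulSub {K : Type} [Field K] {A M : Type} [Ring A] [Algebra K A] [AddCommGroup M]
    [Module K M] [Module A M] [IsScalarTower K A M] {p : Submodule K A} {W : Submodule K M}
    {a : A} {w : M} (ha : a ∈ p) (hw : w ∈ W) : a • w ∈ smulSub K p W :=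
  Submodule.subset_span ⟨a, ha, w, hw, rfl⟩

namespace HM

variable {K R : Type} [Field K] [Ring R] [Algebra K R] {F : ℕ → Submodule K R}
  {s : ℕ} {y : Fin s → R} {kdeg : Fin s → ℕ}

def Fm (F : ℕ → Submodule K R) (n : ℕ) : Submodule K R := if n = 0 then ⊥ else F (n - 1)

def ms (α : Fin s → ℕ) : Multiset (Fin s) := ∑ i, Multiset.replicate (α i) i

def mon (y : Fin s → R) (α : Fin s → ℕ) : R := ((ms α).toList.map y).prod

def wt (kdeg : Fin s → ℕ) (α : Fin s → ℕ) : ℕ := ∑ i, α i * kdeg i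

theorem wt_add (α β : Fin s → ℕ) : wt kdeg (α + β) = wt kdeg α + wt kdeg β := by
  simp [wt, add_mul, Finset.sum_add_distrib]

theorem ms_add (α β : Fin s → ℕ) : ms (α + β) = ms α + ms β := by
  simp [ms, Multiset.replicate_add, Finset.sum_add_distrib]

theorem ms_count (L : List (Fin s)) : ms (fun i => L.count i) = (L : Multiset (Fin s)) := by
  ext a
  simp [ms, Multiset.count_sum', Multiset.count_replicate]

theorem wt_eq (α : Fin s → ℕ) : ((ms α).toList.map kdeg).sum = wt kdeg α := by
  rw [← Multiset.sum_coe, ← Multiset.map_coe, Multiset.coe_toList, ms, wt]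
  have := map_sum (Multiset.sumAddMonoidHom.comp (Multiset.mapAddMonoidHom kdeg))
    (fun i => Multiset.replicate (α i) i) Finset.univ
  simp only [AddMonoidHom.comp_apply, Multiset.coe_mapAddMonoidHom, Multiset.coe_sumAddMonoidHom,
    Multiset.map_replicate, Multiset.sum_replicate, smul_eq_mul] at this
  exact this

section
variable (hF : IsSomewhatCommFilt K R F) (hgen : IsGrGenerators K R F s y kdeg)
include hF

theorem Fm_le (n : ℕ) : Fm F n ≤ F n := by
  unfold Fm; split_ifs
  · simp
  · exact hF.mono (by omega)

theorem Fm_mono {m n : ℕ} (h : m ≤ n) : Fm F m ≤ Fm F n := by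
  unfold Fm; split_ifs
  · simp
  · simp
  · omega
  · exact hF.mono (by omega)

theorem mul_Fm {m n : ℕ} {a b : R} (ha : a ∈ F m) (hb : b ∈ Fm F n) : a * b ∈ Fm F (m + n) := by
  unfold Fm at *
  split_ifs at hb with h1
  · simp at hb; simp [hb]
  · rw [if_neg (by omega)]
    have := hF.mul_mem _ _ _ ha _ hb
    rwa [show m + n - 1 = m + (n - 1) by omega]

theorem Fm_mul {m n : ℕ} {a b : R} (ha : a ∈ Fm F m) (hb : b ∈ F n) : a * b ∈ Fm F (m + n) := by
  unfold Fm at *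
  split_ifs at ha with h1
  · simp at ha; simp [ha]
  · rw [if_neg (by omega)]
    have := hF.mul_mem _ _ _ ha _ hb
    rwa [show m + n - 1 = (m - 1) + n by omega]

theorem one_mem : (1 : R) ∈ F 0 := by
  rw [hF.zero_eq]; exact Submodule.mem_span_singleton_self 1

include hgen

theorem list_mem (L : List (Fin s)) : (L.map y).prod ∈ F (L.map kdeg).sum := by
  induction L with
  | nil => simpa using one_mem hF
  | cons a L ih => simpa using hF.mul_mem _ _ _ (hgen.mem a) _ ih

theorem list_perm {L L' : List (Fin s)} (h : L.Perm L') :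
    (L.map y).prod - (L'.map y).prod ∈ Fm F (L.map kdeg).sum := by
  induction h with
  | nil => simp
  | cons a h ih =>
    simp only [List.map_cons, List.prod_cons, List.sum_cons, ← mul_sub]
    exact mul_Fm hF (hgen.mem a) ih
  | swap a b L =>
    simp only [List.map_cons, List.prod_cons, List.sum_cons, ← mul_assoc, ← sub_mul, ← add_assoc]
    refine Fm_mul hF ?_ (list_mem hF hgen L)
    have := hF.commutator_mem _ _ _ (hgen.mem b) _ (hgen.mem a)
    have h1 := hgen.deg_pos a
    unfold Fm
    rwa [if_neg (by omega)]
  | trans h1 h2 ih1 ih2 =>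
    rw [← ((h1.map kdeg).sum_eq)] at ih2
    simpa using add_mem ih1 ih2

theorem mon_mem (α : Fin s → ℕ) : mon y α ∈ F (wt kdeg α) := by
  rw [← wt_eq]; exact list_mem hF hgen _

theorem mon_mul (α β : Fin s → ℕ) :
    mon y α * mon y β - mon y (α + β) ∈ Fm F (wt kdeg α + wt kdeg β) := by
  have h : ((ms α).toList ++ (ms β).toList).Perm (ms (α + β)).toList := by
    rw [← Multiset.coe_eq_coe, ← Multiset.coe_add]
    simp [ms_add]
  have := list_perm hF hgen h
  simp only [List.map_append, List.prod_append, List.sum_append, wt_eq] at this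
  exact this

theorem F_le (n : ℕ) : F n ≤ Submodule.span K {z | ∃ β, wt kdeg β ≤ n ∧ z = mon y β} := by
  induction n with
  | zero =>
    rw [hF.zero_eq]
    apply Submodule.span_mono
    rintro _ rfl
    refine ⟨0, by simp [wt], by simp [mon, ms]⟩
  | succ n ih =>
    have ih' : F n ≤ Submodule.span K {z | ∃ β, wt kdeg β ≤ n + 1 ∧ z = mon y β} := by
      refine ih.trans (Submodule.span_mono ?_)
      rintro _ ⟨β, hβ, rfl⟩
      exact ⟨β, by omega, rfl⟩
    refine (hgen.gen (n+1) (by omega)).trans (sup_le ih' ?_)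
    rw [Submodule.span_le]
    rintro _ ⟨L, hL, rfl⟩
    have h1 : L.Perm (ms (fun i => L.count i)).toList := by
      rw [← Multiset.coe_eq_coe]; simp [ms_count]
    have h2 := list_perm hF hgen h1
    rw [hL] at h2
    have h3 : wt kdeg (fun i => L.count i) = n + 1 := by
      rw [← wt_eq, ← (h1.map kdeg).sum_eq, hL]
    have h4 := ih' (by simpa [Fm] using h2)
    have h5 : mon y (fun i => L.count i) ∈
      Submodule.span K {z | ∃ β, wt kdeg β ≤ n + 1 ∧ z = mon y β} :=
      Submodule.subset_span ⟨_, h3.le, rfl⟩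
    have := add_mem h4 h5
    simpa [mon] using this

theorem Fm_le_span (n : ℕ) : Fm F n ≤ Submodule.span K {z | ∃ β, wt kdeg β < n ∧ z = mon y β} := by
  unfold Fm; split_ifs with h
  · simp
  · refine (F_le hF hgen _).trans (Submodule.span_mono ?_)
    rintro _ ⟨β, hβ, rfl⟩
    exact ⟨β, by omega, rfl⟩

end

def key (kdeg : Fin s → ℕ) (α : Fin s → ℕ) : ℕ ×ₗ Lex (Fin s → ℕ) := toLex (wt kdeg α, toLex α)

theorem key_add (α β : Fin s → ℕ) : key kdeg (α + β) = key kdeg α + key kdeg β := by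
  unfold key
  rw [wt_add]; rfl

theorem key_inj : Function.Injective (key kdeg) := by
  intro α β h
  have := congrArg (fun z => ofLex (ofLex z).2) h
  simpa [key] using this

theorem key_lt_of_wt {α β : Fin s → ℕ} (h : wt kdeg α < wt kdeg β) : key kdeg α < key kdeg β := by
  rw [key, key, Prod.Lex.toLex_lt_toLex]
  left; exact h

theorem wt_le_of_key {α β : Fin s → ℕ} (h : key kdeg α < key kdeg β) : wt kdeg α ≤ wt kdeg β := by
  rw [key, key, Prod.Lex.toLex_lt_toLex] at h
  rcases h with h | h
  · exact h.le
  · exact h.1.le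

section
variable {M : Type} [AddCommGroup M] [Module K M] [Module R M] [IsScalarTower K R M]

/-- span of smaller monomials applied to x -/
def low (K : Type) [Field K] {R : Type} [Ring R] {s : ℕ} (y : Fin s → R) (kdeg : Fin s → ℕ)
    {M : Type} [AddCommGroup M] [Module K M] [Module R M] (x : M) (α : Fin s → ℕ) :
    Submodule K M :=
  Submodule.span K {z | ∃ β, key kdeg β < key kdeg α ∧ z = mon y β • x}

def std (K : Type) [Field K] {R : Type} [Ring R] {s : ℕ} (y : Fin s → R) (kdeg : Fin s → ℕ)
    {M : Type} [AddCommGroup M] [Module K M] [Module R M] (x : M) : Set (Fin s → ℕ) :=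
  {α | mon y α • x ∉ low K y kdeg x α}

theorem smul_x_mem (x : M) {S : Set R} {U : Submodule K M} (hS : ∀ a ∈ S, a • x ∈ U) {a : R}
    (ha : a ∈ Submodule.span K S) : a • x ∈ U := by
  induction ha using Submodule.span_induction with
  | mem a h => exact hS a h
  | zero => simp
  | add a b _ _ h1 h2 => rw [add_smul]; exact add_mem h1 h2
  | smul c a _ h => rw [smul_assoc]; exact U.smul_mem _ h

variable (hF : IsSomewhatCommFilt K R F) (hgen : IsGrGenerators K R F s y kdeg)
include hF hgen

theorem Fm_smul (x : M) {a : R} {α : Fin s → ℕ} {n : ℕ} (hn : n ≤ wt kdeg α) (ha : a ∈ Fm F n) :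
    a • x ∈ low K y kdeg x α := by
  refine smul_x_mem x ?_ (Fm_le_span hF hgen n ha)
  rintro _ ⟨β, hβ, rfl⟩
  exact Submodule.subset_span ⟨β, key_lt_of_wt (by omega), rfl⟩

theorem std_lower (x : M) : IsLowerSet (std K y kdeg x) := by
  intro α' α hle hα' hα
  obtain ⟨γ, rfl⟩ : ∃ γ, α' = γ + α := ⟨α' - α, by ext i; simp [Nat.sub_add_cancel (hle i)]⟩
  apply hα'
  have h1 : low K y kdeg x α ≤
      (low K y kdeg x (γ + α)).comap (Algebra.lsmul K K M (mon y γ)) := by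
    rw [low, Submodule.span_le]
    rintro _ ⟨β, hβ, rfl⟩
    show mon y γ • (mon y β • x) ∈ low K y kdeg x (γ + α)
    rw [smul_smul, ← sub_add_cancel (mon y γ * mon y β) (mon y (γ + β)), add_smul]
    refine add_mem (Fm_smul hF hgen x ?_ (mon_mul hF hgen γ β)) ?_
    · rw [wt_add]; have := wt_le_of_key hβ; omega
    · refine Submodule.subset_span ⟨_, ?_, rfl⟩
      rw [key_add, key_add]
      exact add_lt_add_right hβ _
  have h2 : mon y γ • (mon y α • x) ∈ low K y kdeg x (γ + α) := h1 hα
  have h3 := Fm_smul hF hgen x (wt_add γ α).ge (mon_mul hF hgen γ α)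
  have h4 := sub_mem h2 h3
  rw [smul_smul, ← sub_smul] at h4
  simpa using h4

omit [Algebra K R] [IsScalarTower K R M] hF hgen in
theorem span_std (x : M) (n : ℕ) (α : Fin s → ℕ) (hα : wt kdeg α ≤ n) :
    mon y α • x ∈ Submodule.span K
      ((fun β => mon y β • x) '' {β | β ∈ std K y kdeg x ∧ wt kdeg β ≤ n}) := by
  induction α using (InvImage.wf (key kdeg) wellFounded_lt).induction with
  | _ α ih =>
  by_cases hs : α ∈ std K y kdeg x
  · exact Submodule.subset_span ⟨α, ⟨hs, hα⟩, rfl⟩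
  · have hs' : mon y α • x ∈ low K y kdeg x α := by
      by_contra h; exact hs h
    refine (Submodule.span_le.2 ?_) hs'
    rintro _ ⟨β, hβ, rfl⟩
    exact ih β hβ ((wt_le_of_key hβ).trans hα)

omit hF in
theorem le_wt (α : Fin s → ℕ) (i : Fin s) : α i ≤ wt kdeg α :=
  (Nat.le_mul_of_pos_right _ (hgen.deg_pos i)).trans
    (Finset.single_le_sum (f := fun i => α i * kdeg i) (fun _ _ => Nat.zero_le _)
      (Finset.mem_univ i))

theorem finrank_le_of_std (x : M) (n B : ℕ)
    (hB : ∀ T : Finset (Fin s → ℕ), (∀ α ∈ T, α ∈ std K y kdeg x ∧ ∀ i, α i ≤ n) → T.card ≤ B) :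
    Module.finrank K (smulSub K (F n) (Submodule.span K {x})) ≤ B := by
  classical
  let T : Finset (Fin s → ℕ) :=
    (Fintype.piFinset fun _ : Fin s => Finset.range (n + 1)).filter
      fun β => β ∈ std K y kdeg x ∧ wt kdeg β ≤ n
  have hT : (T : Set (Fin s → ℕ)) = {β | β ∈ std K y kdeg x ∧ wt kdeg β ≤ n} := by
    ext β
    simp only [T, Finset.coe_filter, Fintype.mem_piFinset, Finset.mem_range, Set.mem_ofPred_eq]
    refine ⟨fun h => h.2, fun h => ⟨fun i => ?_, h⟩⟩
    have := le_wt hgen β i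
    omega
  have h1 : smulSub K (F n) (Submodule.span K {x}) ≤
      Submodule.span K ((T.image (fun β => mon y β • x) : Finset M) : Set M) := by
    rw [smulSub_le]
    intro a ha w hw
    obtain ⟨c, rfl⟩ := Submodule.mem_span_singleton.1 hw
    rw [smul_comm]
    apply Submodule.smul_mem
    refine smul_x_mem x ?_ (F_le hF hgen n ha)
    rintro _ ⟨β, hβ, rfl⟩
    rw [Finset.coe_image, hT]
    exact span_std x n β hβ
  refine (Submodule.finrank_mono h1).trans ((finrank_span_finset_le_card _).trans
    (Finset.card_image_le.trans (hB T ?_)))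
  intro α hα
  simp only [T, Finset.mem_filter, Fintype.mem_piFinset, Finset.mem_range] at hα
  exact ⟨hα.2.1, fun i => Nat.lt_succ_iff.1 (hα.1 i)⟩

omit hF hgen [Algebra K R] [IsScalarTower K R M] in
theorem std_indep (x : M) (T : Finset (Fin s → ℕ)) (hT : ∀ α ∈ T, α ∈ std K y kdeg x) :
    LinearIndepOn K (fun α => mon y α • x) (T : Set (Fin s → ℕ)) := by
  classical
  induction T using Finset.induction_on_max_value (key kdeg) with
  | empty => simp
  | insert a T ha hmax ih =>
    rw [Finset.coe_insert]
    refine (linearIndepOn_insert (by simpa using ha)).2 ⟨ih fun α h => hT α (by simp [h]), ?_⟩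
    intro hmem
    refine hT a (by simp) (Submodule.span_mono ?_ hmem)
    rintro _ ⟨β, hβ, rfl⟩
    refine ⟨β, lt_of_le_of_ne (hmax β hβ) ?_, rfl⟩
    intro h
    exact ha (key_inj h ▸ hβ)

theorem card_le_finrank (x : M) (n : ℕ) (T : Finset (Fin s → ℕ))
    (hT : ∀ α ∈ T, α ∈ std K y kdeg x ∧ wt kdeg α ≤ n) :
    T.card ≤ Module.finrank K (smulSub K (F n) (Submodule.span K {x})) := by
  have h1 := std_indep x T fun α h => (hT α h).1
  have h2 := finrank_span_eq_card h1
  have h3 : Fintype.card ↑(T : Set (Fin s → ℕ)) = T.card := by simp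
  rw [h3] at h2
  have : FiniteDimensional K (smulSub K (F n) (Submodule.span K {x})) :=
    smulSub_fin K _ _ (hF.fin n) inferInstance
  rw [← h2]
  apply Submodule.finrank_mono
  rw [Submodule.span_le]
  rintro _ ⟨⟨α, hα⟩, rfl⟩
  refine smul_mem_smulSub ?_ (Submodule.mem_span_singleton_self x)
  exact hF.mono (hT α hα).2 (mon_mem hF hgen α)

theorem dichotomy (x : M) (h kk : ℕ) (hpos : 0 < h) (hkk : ∀ i, kdeg i ≤ kk) :
    (∀ t, (t + h).choose h ≤
      Module.finrank K (smulSub K (F (kk * t)) (Submodule.span K {x}))) ∨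
    (∃ C, ∀ n, Module.finrank K (smulSub K (F n) (Submodule.span K {x})) ≤
      C * (n + 1) ^ (h - 1)) := by
  rcases down_dichotomy (std K y kdeg x) (std_lower hF hgen x) h with ⟨S, hS, hD⟩ | ⟨C, hC⟩
  · left
    intro t
    obtain ⟨T, hT, hc⟩ := simplex_card S h hS hpos t
    refine hc.trans (card_le_finrank hF hgen x _ T fun α hα => ⟨hD α (hT α hα).1, ?_⟩)
    calc wt kdeg α ≤ ∑ i, α i * kk :=
          Finset.sum_le_sum fun i _ => Nat.mul_le_mul_left _ (hkk i)
      _ = kk * ∑ i, α i := by rw [← Finset.sum_mul, mul_comm]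
      _ ≤ _ := Nat.mul_le_mul_left _ (hT α hα).2
  · right
    exact ⟨C, fun n => finrank_le_of_std hF hgen x n _ (hC n)⟩
end
end HM

namespace HM

theorem gammaDeg_le_of_bound (f : ℕ → ℕ) (C h : ℕ) (hpos : 0 < h)
    (hf : ∀ n, f n ≤ C * (n + 1) ^ (h - 1)) :
    gammaDeg (fun i => (f i : ℕ∞)) ≤ (((h : ℝ) - 1 / 2 : ℝ) : EReal) := by
  apply sInf_le
  refine ⟨_, rfl, ?_⟩
  have h1 : Tendsto (fun n : ℕ => (n : ℝ) ^ (1 / 2 : ℝ)) atTop atTop :=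
    (tendsto_rpow_atTop (by norm_num)).comp tendsto_natCast_atTop_atTop
  filter_upwards [h1.eventually_ge_atTop ((C : ℝ) * 2 ^ (h - 1)), eventually_ge_atTop 1] with n hn hn1
  rw [Nat.cast_le]
  apply Nat.le_floor
  have hn0 : (1 : ℝ) ≤ n := by exact_mod_cast hn1
  calc (f n : ℝ) ≤ C * ((n : ℝ) + 1) ^ (h - 1) := by exact_mod_cast hf n
    _ ≤ C * (2 * (n : ℝ)) ^ (h - 1) := by gcongr; linarith
    _ = (C * 2 ^ (h - 1)) * (n : ℝ) ^ (h - 1) := by rw [mul_pow]; ring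
    _ ≤ (n : ℝ) ^ (1 / 2 : ℝ) * (n : ℝ) ^ (h - 1) := by gcongr
    _ = (n : ℝ) ^ ((h : ℝ) - 1 / 2) := by
      rw [← Real.rpow_natCast, ← Real.rpow_add (by linarith)]
      congr 1
      rw [Nat.cast_sub hpos]; push_cast; ring

theorem gammaDeg_shift (f g : ℕ → ℕ) (a : ℕ) (hfg : ∀ i, f i ≤ g (i + a)) :
    gammaDeg (fun i => (f i : ℕ∞)) ≤ gammaDeg (fun i => (g i : ℕ∞)) := by
  apply le_sInf
  rintro _ ⟨r, rfl, hr⟩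
  rw [← EReal.le_of_forall_lt_iff_le]
  intro z hz
  rw [EReal.coe_lt_coe_iff] at hz
  apply sInf_le
  refine ⟨z, rfl, ?_⟩
  have h1 : Tendsto (fun n : ℕ => (n : ℝ) ^ (z - r)) atTop atTop :=
    (tendsto_rpow_atTop (by linarith)).comp tendsto_natCast_atTop_atTop
  have h2 := (tendsto_add_atTop_nat a).eventually hr
  filter_upwards [h1.eventually_ge_atTop ((2 : ℝ) ^ r), eventually_ge_atTop (a + 1), h2]
    with n hn hn1 hgn
  have hn0 : (1 : ℝ) ≤ n := by exact_mod_cast (by omega : 1 ≤ n)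
  have hna : (a : ℝ) ≤ n := by exact_mod_cast (by omega : a ≤ n)
  have ha0 : (0 : ℝ) ≤ a := Nat.cast_nonneg a
  rw [Nat.cast_le] at hgn ⊢
  refine (hfg n).trans (hgn.trans (Nat.floor_mono ?_))
  push_cast
  rcases le_or_gt 0 r with h0 | h0
  · calc ((n : ℝ) + a) ^ r ≤ (2 * (n : ℝ)) ^ r := by
          apply Real.rpow_le_rpow <;> linarith
      _ = 2 ^ r * (n : ℝ) ^ r := by rw [Real.mul_rpow (by norm_num) (by linarith)]
      _ ≤ (n : ℝ) ^ (z - r) * (n : ℝ) ^ r := by gcongr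
      _ = (n : ℝ) ^ z := by rw [← Real.rpow_add (by linarith)]; congr 1; ring
  · calc ((n : ℝ) + a) ^ r ≤ (n : ℝ) ^ r :=
          Real.rpow_le_rpow_of_nonpos (by linarith) (by linarith) h0.le
      _ ≤ (n : ℝ) ^ z := Real.rpow_le_rpow_of_exponent_le hn0 hz.le

variable {K R : Type} [Field K] [Ring R] [Algebra K R] {F : ℕ → Submodule K R}
  {s : ℕ} {y : Fin s → R} {kdeg : Fin s → ℕ}
  {M : Type} [AddCommGroup M] [Module K M] [Module R M] [IsScalarTower K R M]
  {Q : Type} [AddCommGroup Q] [Module K Q] [Module R Q] [IsScalarTower K R Q]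

theorem map_smulSub (g : M →ₗ[R] Q) (p : Submodule K R) (W : Submodule K M) :
    (smulSub K p W).map (g.restrictScalars K) = smulSub K p (W.map (g.restrictScalars K)) := by
  apply le_antisymm
  · rw [Submodule.map_le_iff_le_comap, smulSub_le]
    intro a ha w hw
    show g (a • w) ∈ smulSub K p (W.map (g.restrictScalars K))
    rw [map_smul]
    exact smul_mem_smulSub ha ⟨w, hw, rfl⟩
  · rw [smulSub_le]
    rintro a ha _ ⟨w, hw, rfl⟩
    exact ⟨a • w, smul_mem_smulSub ha hw, map_smul g a w⟩

theorem gk_ge {h : ℕ} (hh : holonomicNumberF K R F = (h : EReal)) (hM : Nontrivial M)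
    (hf : Module.Finite R M) : (h : EReal) ≤ gkModF K R M F := by
  rw [← hh]
  exact sInf_le ⟨M, _, _, _, inferInstance, hM, hf, rfl⟩

theorem cyclic_growth (hF : IsSomewhatCommFilt K R F) (hgen : IsGrGenerators K R F s y kdeg)
    (h kk : ℕ) (hpos : 0 < h) (hkk : ∀ i, kdeg i ≤ kk)
    (hh : holonomicNumberF K R F = (h : EReal)) (x : M) (hx : x ≠ 0) (t : ℕ) :
    (t + h).choose h ≤ Module.finrank K (smulSub K (F (kk * t)) (Submodule.span K {x})) := by
  set P := Submodule.span R {x} with hP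
  let x' : P := ⟨x, Submodule.mem_span_singleton_self x⟩
  have hnt : Nontrivial P := ⟨x', 0, fun h => hx (congrArg Subtype.val h)⟩
  have hge := gk_ge (M := P) hh hnt inferInstance
  have hgenP : IsGenSub K R (Submodule.span K {x'}) := by
    refine ⟨inferInstance, ?_⟩
    rw [eq_top_iff]
    rintro ⟨z, hz⟩ -
    obtain ⟨r, rfl⟩ := Submodule.mem_span_singleton.1 hz
    exact Submodule.smul_mem _ r (Submodule.subset_span (Submodule.mem_span_singleton_self x'))
  have hle : gkModF K R P F ≤ gkModWF K F (Submodule.span K {x'}) :=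
    iInf_le (fun W : {W : Submodule K P // IsGenSub K R W} => gkModWF K F W.1) ⟨_, hgenP⟩
  rcases dichotomy hF hgen x' h kk hpos hkk with H | ⟨C, hC⟩
  · refine (H t).trans ?_
    have h1 := map_smulSub P.subtype (F (kk * t)) (Submodule.span K {x'})
    have h2 : (Submodule.span K {x'}).map (P.subtype.restrictScalars K) = Submodule.span K {x} := by
      rw [Submodule.map_span, Set.image_singleton]; rfl
    rw [h2] at h1
    rw [← h1]
    exact (Submodule.equivMapOfInjective (P.subtype.restrictScalars K)
      (Subtype.val_injective) _).finrank_eq.le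
  · exfalso
    have h3 := hge.trans (hle.trans (gammaDeg_le_of_bound _ C h hpos hC))
    rw [← EReal.coe_coe_eq_natCast, EReal.coe_le_coe_iff] at h3
    linarith

theorem chain_dim (hF : IsSomewhatCommFilt K R F) (hgen : IsGrGenerators K R F s y kdeg)
    (h kk : ℕ) (hpos : 0 < h) (hkk : ∀ i, kdeg i ≤ kk) (hkpos : 0 < kk)
    (hh : holonomicNumberF K R F = (h : EReal))
    (Γ : ℕ → Submodule K M) (hΓ : IsGoodFilt K R M F Γ)
    (m : ℕ) (c : ℕ → Submodule R M) (hc : ∀ i < m, c i < c (i + 1)) :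
    ∃ b, ∀ t, m * (t + h).choose h ≤ Module.finrank K (Γ (kk * (t + b))) := by
  have hex : ∀ i < m, ∃ x a, x ∈ c (i + 1) ∧ x ∉ c i ∧ x ∈ Γ a := by
    intro i hi
    obtain ⟨x, h1, h2⟩ := SetLike.exists_of_lt (hc i hi)
    obtain ⟨a, ha⟩ := hΓ.exhaustive x
    exact ⟨x, a, h1, h2, ha⟩
  choose! x a hx1 hx2 hx3 using hex
  let b := ∑ i ∈ Finset.range m, a i
  have hab : ∀ i < m, x i ∈ Γ (kk * b) := by
    intro i hi
    refine hΓ.mono ?_ (hx3 i hi)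
    have : a i ≤ b := Finset.single_le_sum (f := a) (fun _ _ => Nat.zero_le _) (by simpa using hi)
    exact this.trans (Nat.le_mul_of_pos_left _ hkpos)
  refine ⟨b, fun t => ?_⟩
  set n := kk * (t + b) with hn
  have hfin := hΓ.fin n
  have hstep : ∀ j ≤ m, j * (t + h).choose h ≤
      Module.finrank K (Γ n ⊓ (c j).restrictScalars K : Submodule K M) := by
    intro j
    induction j with
    | zero => simp
    | succ j ih =>
      intro hj
      have ih := ih (by omega)
      let A : Submodule K M := Γ n ⊓ (c (j+1)).restrictScalars K
      have hA : FiniteDimensional K A := Submodule.finiteDimensional_of_le (inf_le_left : A ≤ Γ n)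
      let π : M →ₗ[K] (M ⧸ c j) := (c j).mkQ.restrictScalars K
      have h1 := (π.domRestrict A).finrank_range_add_finrank_ker
      have hbar : (c j).mkQ (x j) ≠ 0 := by
        simpa using hx2 j (by omega)
      have h2 := cyclic_growth hF hgen h kk hpos hkk hh _ hbar t
      have h3 : smulSub K (F (kk * t)) (Submodule.span K {(c j).mkQ (x j)}) ≤
          LinearMap.range (π.domRestrict A) := by
        rw [smulSub_le]
        intro r hr w hw
        obtain ⟨k, rfl⟩ := Submodule.mem_span_singleton.1 hw
        rw [smul_comm]
        apply Submodule.smul_mem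
        refine ⟨⟨r • x j, ?_, ?_⟩, ?_⟩
        · have := hΓ.compat (kk * t) (kk * b) (smul_mem_smulSub hr (hab j (by omega)))
          rwa [← mul_add] at this
        · exact (c (j+1)).smul_mem r (hx1 j (by omega))
        · rfl
      have h4 := Submodule.finrank_mono h3
      have h5 : Module.finrank K (Γ n ⊓ (c j).restrictScalars K : Submodule K M) ≤
          Module.finrank K (LinearMap.ker (π.domRestrict A)) := by
        have h6 : (Γ n ⊓ (c j).restrictScalars K : Submodule K M) ≤
            (LinearMap.ker (π.domRestrict A)).map A.subtype := by
          rintro z ⟨hz1, hz2⟩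
          refine ⟨⟨z, hz1, (hc j (by omega)).le hz2⟩, ?_, rfl⟩
          show (c j).mkQ z = 0
          simpa using hz2
        refine (Submodule.finrank_mono h6).trans ?_
        exact Submodule.finrank_map_le _ _
      rw [add_mul, one_mul]
      show _ ≤ Module.finrank K A
      omega
  exact (hstep m le_rfl).trans (Submodule.finrank_mono inf_le_left)

theorem limit_bound (P : Polynomial ℚ) (h m b kk : ℕ) (e : ℚ) (hkpos : 0 < kk)
    (hdeg : P.degree = (h : WithBot ℕ)) (hlc : P.leadingCoeff = e / (Nat.factorial h : ℚ))
    (hP : ∀ᶠ t : ℕ in atTop, ((m * (t + h).choose h : ℕ) : ℚ) ≤ P.eval ((kk * (t + b) : ℕ) : ℚ)) :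
    (m : ℚ) ≤ e * (kk : ℚ) ^ h := by
  have hf0 : (0 : ℚ) < (Nat.factorial h : ℚ) := by exact_mod_cast Nat.factorial_pos h
  have hk0 : (0 : ℚ) < kk := by exact_mod_cast hkpos
  have h1 := Polynomial.div_tendsto_atTop_leadingCoeff_div_of_degree_eq P
    ((Polynomial.X : Polynomial ℚ) ^ h) (by rw [hdeg, Polynomial.degree_X_pow])
  simp only [Polynomial.leadingCoeff_X_pow, div_one, Polynomial.eval_pow, Polynomial.eval_X, hlc] at h1
  have h2 : Tendsto (fun t : ℕ => ((kk * (t + b) : ℕ) : ℚ)) atTop atTop :=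
    tendsto_natCast_atTop_atTop.comp
      ((tendsto_add_atTop_nat b).const_mul_atTop' hkpos)
  have h3 := h1.comp h2
  have h4 : Tendsto (fun t : ℕ => ((t : ℚ) / (t + (b : ℚ)))) atTop (nhds 1) := by
    have h41 : Tendsto (fun t : ℕ => (b : ℚ) / ((t : ℚ) + b)) atTop (nhds 0) :=
      tendsto_const_nhds.div_atTop (tendsto_atTop_add_const_right _ _ tendsto_natCast_atTop_atTop)
    have h42 := h41.const_sub 1
    rw [sub_zero] at h42
    refine h42.congr' ?_
    filter_upwards [eventually_ge_atTop 1] with t ht1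
    have htpos : (0 : ℚ) < t := by exact_mod_cast ht1
    have hb : (0 : ℚ) ≤ b := Nat.cast_nonneg b
    have : (t : ℚ) + b ≠ 0 := by positivity
    field_simp
    ring
  have h5 : Tendsto (fun t : ℕ => (m : ℚ) / ((Nat.factorial h : ℚ) * kk ^ h) *
      ((t : ℚ) / (t + (b : ℚ))) ^ h) atTop
      (nhds ((m : ℚ) / ((Nat.factorial h : ℚ) * kk ^ h) * 1 ^ h)) :=
    (h4.pow h).const_mul _
  have h6 := le_of_tendsto_of_tendsto h5 h3 (by
    filter_upwards [hP, eventually_ge_atTop 1] with t ht ht1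
    have htpos : (0 : ℚ) < t := by exact_mod_cast ht1
    have hb : (0 : ℚ) ≤ b := Nat.cast_nonneg b
    simp only [Function.comp]
    have h7 : (t : ℚ) ^ h / (Nat.factorial h : ℚ) ≤ ((t + h).choose h : ℚ) := by
      have := Nat.pow_le_choose (α := ℚ) h (t + h)
      refine le_trans ?_ this
      gcongr
      omega
    rw [le_div_iff₀ (by push_cast; positivity)]
    refine le_trans (le_of_eq ?_) (le_trans (mul_le_mul_of_nonneg_left h7 (Nat.cast_nonneg m))
      (by exact_mod_cast ht))
    push_cast
    rw [div_pow, mul_pow]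
    field_simp)
  rw [one_pow, mul_one, div_le_div_iff₀ (by positivity) hf0] at h6
  have h8 : (Nat.factorial h : ℚ) * m ≤ (Nat.factorial h : ℚ) * (e * kk ^ h) := by linarith
  exact le_of_mul_le_mul_left h8 hf0

theorem exists_bound (hF : IsSomewhatCommFilt K R F) (W : Submodule K M) (hW : IsGenSub K R W)
    (z : M) : ∃ a, z ∈ smulSub K (F a) W := by
  have hz : z ∈ Submodule.span R (W : Set M) := by rw [hW.2]; trivial
  have hmono : ∀ {a b : ℕ}, a ≤ b → smulSub K (F a) W ≤ smulSub K (F b) W := fun {a b} hab =>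
    smulSub_le.2 fun r hr w hw => smul_mem_smulSub (hF.mono hab hr) hw
  induction hz using Submodule.span_induction with
  | mem w hw => exact ⟨0, by simpa using smul_mem_smulSub (one_mem hF) hw⟩
  | zero => exact ⟨0, zero_mem _⟩
  | add u v _ _ hu hv =>
    obtain ⟨a, ha⟩ := hu
    obtain ⟨b, hb⟩ := hv
    exact ⟨max a b, add_mem (hmono (le_max_left _ _) ha) (hmono (le_max_right _ _) hb)⟩
  | smul r u _ hu =>
    obtain ⟨a, ha⟩ := hu
    obtain ⟨i, hi⟩ := hF.exhaustive r
    refine ⟨i + a, ?_⟩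
    have : smulSub K (F a) W ≤ (smulSub K (F (i + a)) W).comap (Algebra.lsmul K K M r) := by
      rw [smulSub_le]
      intro q hq w hw
      show r • q • w ∈ smulSub K (F (i + a)) W
      rw [smul_smul]
      exact smul_mem_smulSub (hF.mul_mem _ _ _ hi _ hq) hw
    exact this ha

theorem gk_le_quot (hF : IsSomewhatCommFilt K R F) (N : Submodule R M) :
    gkModF K R (M ⧸ N) F ≤ gkModF K R M F := by
  apply le_iInf
  rintro ⟨W, hW⟩
  have hfin := hW.1
  let W' := W.map (N.mkQ.restrictScalars K)
  have hW' : IsGenSub K R W' := by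
    refine ⟨inferInstance, ?_⟩
    have : (W' : Set (M ⧸ N)) = N.mkQ '' (W : Set M) := rfl
    rw [this, ← Submodule.map_span, hW.2, Submodule.map_top, Submodule.range_mkQ]
  refine (iInf_le (fun W : {W : Submodule K (M ⧸ N) // IsGenSub K R W} => gkModWF K F W.1)
    ⟨W', hW'⟩).trans ?_
  refine gammaDeg_shift _ _ 0 fun i => ?_
  have := smulSub_fin K (F i) W (hF.fin i) hfin
  rw [← map_smulSub]
  exact Submodule.finrank_map_le _ _

theorem gk_le_sub (hF : IsSomewhatCommFilt K R F) (N : Submodule R M) (hN : N.FG) :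
    gkModF K R N F ≤ gkModF K R M F := by
  apply le_iInf
  rintro ⟨W, hW⟩
  have hfin := hW.1
  have hNf : Module.Finite R N := Module.Finite.iff_fg.2 hN
  obtain ⟨S, hS⟩ := hNf.fg_top
  let W' : Submodule K N := Submodule.span K (S : Set N)
  have hW'f : FiniteDimensional K W' := FiniteDimensional.span_finset K S
  have hW' : IsGenSub K R W' := by
    refine ⟨hW'f, ?_⟩
    rw [eq_top_iff, ← hS]
    exact Submodule.span_mono Submodule.subset_span
  refine (iInf_le (fun W : {W : Submodule K N // IsGenSub K R W} => gkModWF K F W.1)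
    ⟨W', hW'⟩).trans ?_
  choose a ha using fun z : N => exists_bound hF W hW (z : M)
  let A := ∑ z ∈ S, a z
  refine gammaDeg_shift _ _ A fun i => ?_
  have hfd := smulSub_fin K (F (i + A)) W (hF.fin _) hfin
  rw [(Submodule.equivMapOfInjective (N.subtype.restrictScalars K)
      (Subtype.val_injective) (smulSub K (F i) W')).finrank_eq]
  refine Submodule.finrank_mono ?_
  rw [Submodule.map_le_iff_le_comap, smulSub_le]
  intro r hr w hw
  have hw' : W' ≤ (smulSub K (F (i + A)) W).comap
      ((Algebra.lsmul K K M r) ∘ₗ (N.subtype.restrictScalars K)) := by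
    rw [Submodule.span_le]
    intro z hz
    show r • (z : M) ∈ smulSub K (F (i + A)) W
    have : smulSub K (F (a z)) W ≤ (smulSub K (F (i + A)) W).comap (Algebra.lsmul K K M r) := by
      rw [smulSub_le]
      intro q hq w hw
      show r • q • w ∈ smulSub K (F (i + A)) W
      rw [smul_smul]
      refine smul_mem_smulSub (hF.mono ?_ (hF.mul_mem _ _ _ hr _ hq)) hw
      have : a z ≤ A := Finset.single_le_sum (f := a) (fun _ _ => Nat.zero_le _) hz
      omega
    exact this (ha z)
  exact hw' hw

theorem fg_of_bound (B : ℚ) (hB : ∀ (m : ℕ) (c : ℕ → Submodule R M), (∀ i < m, c i < c (i + 1)) →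
      (m : ℚ) ≤ B) (N : Submodule R M) : N.FG := by
  have hw : WellFoundedGT (Submodule R M) := by
    rw [WellFoundedGT, isWellFounded_iff, RelEmbedding.wellFounded_iff_isEmpty]
    refine ⟨fun f => ?_⟩
    obtain ⟨m, hm⟩ := exists_nat_gt B
    have := hB m f fun i _ => f.map_rel_iff.2 (Nat.lt_succ_self i)
    linarith
  have : IsNoetherian R M := isNoetherian_iff'.2 hw
  exact IsNoetherian.noetherian N

theorem kk_facts (kdeg : Fin s → ℕ) (hd : ∀ t, 1 ≤ kdeg t) :
    0 < (List.ofFn kdeg).foldr Nat.lcm 1 ∧ ∀ i, kdeg i ≤ (List.ofFn kdeg).foldr Nat.lcm 1 := by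
  have hL : ∀ L : List ℕ, (∀ a ∈ L, 1 ≤ a) → 0 < L.foldr Nat.lcm 1 ∧ ∀ a ∈ L, a ∣ L.foldr Nat.lcm 1 := by
    intro L
    induction L with
    | nil => simp
    | cons b L ih =>
      intro hb
      have ih := ih fun a ha => hb a (by simp [ha])
      refine ⟨Nat.lcm_pos (hb b (by simp)) ih.1, ?_⟩
      intro a ha
      rcases List.mem_cons.1 ha with rfl | ha
      · exact Nat.dvd_lcm_left _ _
      · exact (ih.2 a ha).trans (Nat.dvd_lcm_right _ _)
  have := hL (List.ofFn kdeg) (by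
    intro a ha
    obtain ⟨i, rfl⟩ := List.mem_ofFn.1 ha
    exact hd i)
  exact ⟨this.1, fun i => Nat.le_of_dvd this.1 (this.2 _ (List.mem_ofFn.2 ⟨i, rfl⟩))⟩

end HM

/-- Let `R` be a somewhat commutative `K`-algebra with holonomic number `h > 0`, let
`y_1, …, y_s` be homogeneous algebra generators of `gr R` of degrees `k_1, …, k_s` and
`k = lcm(k_1, …, k_s)`. Then (1) every holonomic `R`-module `M` with multiplicity `e(M)`
has finite length at most `e(M) · k ^ h` (every strictly ascending chain of submodules
has at most `e(M) · k ^ h` steps); (2) every nonzero submodule and every nonzero factor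
module of a holonomic `R`-module is holonomic. -/
theorem holonomic_finite_length_and_subquotients
    (K R : Type) [Field K] [Ring R] [Algebra K R]
    (F : ℕ → Submodule K R) (hF : IsSomewhatCommFilt K R F)
    (s : ℕ) (y : Fin s → R) (kdeg : Fin s → ℕ) (hgen : IsGrGenerators K R F s y kdeg)
    (kk : ℕ) (hkk : kk = (List.ofFn kdeg).foldr Nat.lcm 1)
    (h : ℕ) (hpos : 0 < h) (hh : holonomicNumberF K R F = (h : EReal))
    (M : Type) [AddCommGroup M] [Module K M] [Module R M] [IsScalarTower K R M]
    [Nontrivial M] [Module.Finite R M]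
    (hM : gkModF K R M F = (h : EReal))
    (e : ℚ) (he : HasMultiplicityF K R M F kk h e) :
    (∀ (m : ℕ) (c : ℕ → Submodule R M), (∀ i < m, c i < c (i + 1)) →
      (m : ℚ) ≤ e * (kk : ℚ) ^ h) ∧
    (∀ N : Submodule R M, N ≠ ⊥ → gkModF K R ↥N F = (h : EReal)) ∧
    (∀ N : Submodule R M, N ≠ ⊤ → gkModF K R (M ⧸ N) F = (h : EReal)) := by
  obtain ⟨hkpos, hkle⟩ := HM.kk_facts kdeg hgen.deg_pos
  rw [← hkk] at hkpos hkle
  have h1 : ∀ (m : ℕ) (c : ℕ → Submodule R M), (∀ i < m, c i < c (i + 1)) →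
      (m : ℚ) ≤ e * (kk : ℚ) ^ h := by
    intro m c hc
    obtain ⟨Γ, hΓ, γ, hdeg, hlc, hev⟩ := he
    obtain ⟨b, hb⟩ := HM.chain_dim hF hgen h kk hpos hkle hkpos hh Γ hΓ m c hc
    refine HM.limit_bound (γ 0) h m b kk e hkpos (hdeg 0 hkpos) (hlc 0 hkpos) ?_
    have ht : Tendsto (fun t : ℕ => kk * (t + b)) atTop atTop :=
      (tendsto_add_atTop_nat b).const_mul_atTop' hkpos
    filter_upwards [ht.eventually hev] with t ht
    rw [Nat.mul_mod_right] at ht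
    rw [← ht]
    exact_mod_cast hb t
  refine ⟨h1, ?_, ?_⟩
  · intro N hN
    have hfg := HM.fg_of_bound _ h1 N
    refine le_antisymm (hM ▸ HM.gk_le_sub hF N hfg) ?_
    exact HM.gk_ge hh ((Submodule.nontrivial_iff_ne_bot).2 hN) (Module.Finite.iff_fg.2 hfg)
  · intro N hN
    refine le_antisymm (hM ▸ HM.gk_le_quot hF N) ?_
    exact HM.gk_ge hh (Submodule.Quotient.nontrivial_iff.2 hN) inferInstance

end
end
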